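/- arXiv:0803.2656 — 2 statements merged into one kernel-verified Lean document; each statement's English description precedes it below -/
import Mathlib

section
/- (Domination theorem, polynomial growth version) For i = 1, …, k let u_i be upper semicontinuous functions of polynomial growth on [0, T] × ℝᴺ that are viscosity subsolutions of ∂_t u − G_i(u, Du, D²u) = 0 on (0, T) × ℝᴺ, and let β_1, …, β_k > 0. Assume the continuous functions G_i : ℝ × ℝᴺ × S(N) → ℝ satisfy, for some constant C > 0: (i) λ G_i(v, p, Y) ≤ C G_i(λv, λp, λY) for all λ ≥ 0; (ii) the Lipschitz condition |G_i(v_1, p, X) − G_i(v_2, q, Y)| ≤ C(|v_1 − v_2| + |p − q| + ‖X − Y‖) for all v_1, v_2 ∈ ℝ, p, q ∈ ℝᴺ, X, Y ∈ S(N); (iii) the domination condition: Σ_{i=1}^k β_i G_i(v_i, p_i, X_i) ≤ 0 whenever Σ_{i=1}^k β_i v_i ≥ 0, Σ_{i=1}^k β_i p_i = 0 and Σ_{i=1}^k β_i X_i ≤ 0. Then, if Σ_{i=1}^k β_i u_i(0, ·) is a non-positive continuous function, one has Σ_{i=1}^k β_i u_i(t, x) ≤ 0 for all (t, x) ∈ (0,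 T) × ℝᴺ. -/
noncomputable section

open Real Set Filter

/-- `ℝᴺ` as a Euclidean space. -/
abbrev Euc (N : ℕ) := EuclideanSpace ℝ (Fin N)

/-- Time derivative `∂ₜψ` of a function on `ℝ × ℝᴺ`. -/
noncomputable def tderiv {N : ℕ} (ψ : ℝ × Euc N → ℝ) (q : ℝ × Euc N) : ℝ :=
  deriv (fun s => ψ (s, q.2)) q.1

/-- Spatial gradient `Dψ` of a function on `ℝ × ℝᴺ`. -/
noncomputable def xgrad {N : ℕ} (ψ : ℝ × Euc N → ℝ) (q : ℝ × Euc N) : Euc N :=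
  gradient (fun z => ψ (q.1, z)) q.2

/-- Spatial Hessian `D²ψ` (as a matrix) of a function on `ℝ × ℝᴺ`. -/
noncomputable def xhess {N : ℕ} (ψ : ℝ × Euc N → ℝ) (q : ℝ × Euc N) :
    Matrix (Fin N) (Fin N) ℝ :=
  fun i j => iteratedFDeriv ℝ 2 (fun z => ψ (q.1, z)) q.2
    ![EuclideanSpace.single i 1, EuclideanSpace.single j 1]

/-- The operator norm of a matrix, acting on Euclidean space. -/
noncomputable def matOpNorm {N : ℕ} (A : Matrix (Fin N) (Fin N) ℝ) : ℝ :=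
  ‖(Matrix.toEuclideanCLM (𝕜 := ℝ) A : Euc N →L[ℝ] Euc N)‖

/-- `u` is a viscosity subsolution of `∂ₜu − G(u, Du, D²u) = 0` on `(0,T) × ℝᴺ`. -/
def IsViscSubsol {N : ℕ} (T : ℝ)
    (G : ℝ → Euc N → Matrix (Fin N) (Fin N) ℝ → ℝ)
    (u : ℝ × Euc N → ℝ) : Prop :=
  ∀ ψ : ℝ × Euc N → ℝ, ContDiff ℝ 2 ψ →
    ∀ q : ℝ × Euc N, q.1 ∈ Set.Ioo 0 T →
    IsLocalMaxOn (fun z => u z - ψ z)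
      (Set.Ioo (0 : ℝ) T ×ˢ (Set.univ : Set (Euc N))) q →
    tderiv ψ q - G (u q) (xgrad ψ q) (xhess ψ q) ≤ 0

/-- `v` is a viscosity supersolution of `∂ₜv − F(Dv, D²v) = 0` on `(0,T) × ℝᴺ`. -/
def IsViscSupersol' {N : ℕ} (T : ℝ)
    (F : Euc N → Matrix (Fin N) (Fin N) ℝ → ℝ)
    (v : ℝ × Euc N → ℝ) : Prop :=
  ∀ ψ : ℝ × Euc N → ℝ, ContDiff ℝ 2 ψ →
    ∀ q : ℝ × Euc N, q.1 ∈ Set.Ioo 0 T →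
    IsLocalMinOn (fun z => v z - ψ z)
      (Set.Ioo (0 : ℝ) T ×ˢ (Set.univ : Set (Euc N))) q →
    0 ≤ tderiv ψ q - F (xgrad ψ q) (xhess ψ q)

/-- `u` is a viscosity subsolution of `∂ₜu − F(Du, D²u) = 0` on `(0,T) × ℝᴺ`. -/
def IsViscSubsol' {N : ℕ} (T : ℝ)
    (F : Euc N → Matrix (Fin N) (Fin N) ℝ → ℝ)
    (u : ℝ × Euc N → ℝ) : Prop :=
  ∀ ψ : ℝ × Euc N → ℝ, ContDiff ℝ 2 ψ →
    ∀ q : ℝ × Euc N, q.1 ∈ Set.Ioo 0 T →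
    IsLocalMaxOn (fun z => u z - ψ z)
      (Set.Ioo (0 : ℝ) T ×ˢ (Set.univ : Set (Euc N))) q →
    tderiv ψ q - F (xgrad ψ q) (xhess ψ q) ≤ 0

/-- Polynomial growth of a function on `[0,T] × ℝᴺ`. -/
def PolyGrowth {N : ℕ} (T : ℝ) (u : ℝ × Euc N → ℝ) : Prop :=
  ∃ (C : ℝ) (k : ℕ), ∀ t ∈ Set.Icc (0 : ℝ) T, ∀ x : Euc N,
    |u (t, x)| ≤ C * (1 + ‖x‖ ^ k)


lemma vd_partition (h : ℝ → ℝ) (c : ℝ)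
    (hh : ∀ s' s : ℝ, 0 ≤ s' → s' ≤ s → s ≤ 1 → h s - h s' ≤ c * (s - s') ^ 2) :
    h 1 ≤ h 0 := by
  have key : ∀ n : ℕ, h 1 - h 0 ≤ c / ((n : ℝ) + 1) := by
    intro n
    have hn : (0 : ℝ) < (n : ℝ) + 1 := by positivity
    have step : ∀ j : ℕ, j ≤ n + 1 →
        h (j / ((n : ℝ) + 1)) - h 0 ≤ j * (c / ((n : ℝ) + 1) ^ 2) := by
      intro j
      induction j with
      | zero => intro _; simp
      | succ j ih =>
        intro hj
        have h1 := ih (by omega)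
        have hj' : ((j : ℝ) + 1) ≤ (n : ℝ) + 1 := by exact_mod_cast hj
        have h2 := hh (j / ((n : ℝ) + 1)) (((j + 1 : ℕ) : ℝ) / ((n : ℝ) + 1)) (by positivity)
          (by push_cast; gcongr; linarith) (by push_cast; rw [div_le_one hn]; exact hj')
        have h3 : c * (((j + 1 : ℕ) : ℝ) / ((n : ℝ) + 1) - j / ((n : ℝ) + 1)) ^ 2
            = c / ((n : ℝ) + 1) ^ 2 := by
          push_cast; field_simp; ring
        rw [h3] at h2
        push_cast at h2 ⊢
        linarith
    have := step (n + 1) le_rfl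
    push_cast at this
    rw [div_self hn.ne'] at this
    refine this.trans (le_of_eq ?_)
    field_simp
  have lim : Tendsto (fun n : ℕ => c / ((n : ℝ) + 1)) atTop (nhds 0) := by
    have := (tendsto_one_div_add_atTop_nhds_zero_nat (𝕜 := ℝ)).const_mul c
    simpa [div_eq_mul_inv] using this
  have := ge_of_tendsto' lim key
  linarith

section abstract_part
variable {E : Type*} [NormedAddCommGroup E] [InnerProductSpace ℝ E]

local notation "⟪" x "," y "⟫" => inner ℝ x y

/-- `q` is a selection of semiconvex subgradients of `f`. -/
def SubG (f : E → ℝ) (q : E → E) (l : ℝ) : Prop :=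
  ∀ z w : E, f z + ⟪q z, w - z⟫ - l * ‖w - z‖ ^ 2 ≤ f w

lemma vd_upper {f : E → ℝ} {q : E → E} {l : ℝ} (hf : SubG f q l)
    {A : E →L[ℝ] E} {z : E} (hA : HasFDerivAt q A z) {η : ℝ} (hη : 0 < η) :
    ∀ᶠ d in nhds (0 : E), f (z + d) ≤ f z + ⟪q z, d⟫ + (1 / 2) * ⟪A d, d⟫ + η * ‖d‖ ^ 2 := by
  rw [hasFDerivAt_iff_isLittleO_nhds_zero, Asymptotics.isLittleO_iff] at hA
  have h1 := hA hη
  rw [Metric.eventually_nhds_iff] at h1 ⊢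
  obtain ⟨ε, hε, h1⟩ := h1
  refine ⟨ε, hε, fun d hd => ?_⟩
  have hd' : ‖d‖ < ε := by simpa using hd
  set a := ⟪A d, d⟫ with ha
  have key := vd_partition
    (fun s => f (z + s • d) - s * ⟪q z, d⟫ - s ^ 2 / 2 * (a + η * ‖d‖ ^ 2))
    ((a + η * ‖d‖ ^ 2) / 2 + l * ‖d‖ ^ 2) (by
      intro s' s hs' hss hs
      have hs0 : 0 ≤ s := hs'.trans hss
      have e1 := hf (z + s • d) (z + s' • d)
      have e2 : z + s' • d - (z + s • d) = (s' - s) • d := by rw [sub_smul]; abel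
      rw [e2, inner_smul_right, norm_smul, mul_pow, Real.norm_eq_abs, sq_abs] at e1
      have e3 : ‖s • d‖ = s * ‖d‖ := by rw [norm_smul, Real.norm_of_nonneg hs0]
      have e4 : ‖q (z + s • d) - q z - A (s • d)‖ ≤ η * ‖s • d‖ := by
        apply h1
        simp only [dist_zero_right]
        rw [e3]; nlinarith [norm_nonneg d]
      have e5 : ⟪q (z + s • d) - q z - A (s • d), d⟫ ≤ η * (s * ‖d‖) * ‖d‖ := by
        refine (real_inner_le_norm _ _).trans ?_
        rw [e3] at e4
        gcongr
      rw [inner_sub_left, inner_sub_left, map_smul, inner_smul_left] at e5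
      simp only [RCLike.conj_to_real, ← ha] at e5
      have e6 := mul_le_mul_of_nonneg_left e5 (sub_nonneg.2 hss)
      nlinarith [e6, e1])
  simp only [one_smul, zero_smul, add_zero] at key
  nlinarith [key, mul_nonneg hη.le (sq_nonneg ‖d‖)]

lemma vd_lower {f : E → ℝ} {q : E → E} {l : ℝ} (hf : SubG f q l)
    {A : E →L[ℝ] E} {z : E} (hA : HasFDerivAt q A z) {η : ℝ} (hη : 0 < η) :
    ∀ᶠ d in nhds (0 : E), f z + ⟪q z, d⟫ + (1 / 2) * ⟪A d, d⟫ - η * ‖d‖ ^ 2 ≤ f (z + d) := by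
  rw [hasFDerivAt_iff_isLittleO_nhds_zero, Asymptotics.isLittleO_iff] at hA
  have h1 := hA hη
  rw [Metric.eventually_nhds_iff] at h1 ⊢
  obtain ⟨ε, hε, h1⟩ := h1
  refine ⟨ε, hε, fun d hd => ?_⟩
  have hd' : ‖d‖ < ε := by simpa using hd
  set a := ⟪A d, d⟫ with ha
  have key := vd_partition
    (fun s => -f (z + s • d) + s * ⟪q z, d⟫ + s ^ 2 / 2 * (a - η * ‖d‖ ^ 2))
    ((a - η * ‖d‖ ^ 2) / 2 + l * ‖d‖ ^ 2) (by
      intro s s' hs0 hss hs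
      have e1 := hf (z + s • d) (z + s' • d)
      have e2 : z + s' • d - (z + s • d) = (s' - s) • d := by rw [sub_smul]; abel
      rw [e2, inner_smul_right, norm_smul, mul_pow, Real.norm_eq_abs, sq_abs] at e1
      have e3 : ‖s • d‖ = s * ‖d‖ := by rw [norm_smul, Real.norm_of_nonneg hs0]
      have e4 : ‖q (z + s • d) - q z - A (s • d)‖ ≤ η * ‖s • d‖ := by
        apply h1
        simp only [dist_zero_right]
        rw [e3]; nlinarith [norm_nonneg d]
      have e5 : -(η * (s * ‖d‖) * ‖d‖) ≤ ⟪q (z + s • d) - q z - A (s • d), d⟫ := by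
        refine le_trans ?_ (neg_le_of_abs_le (abs_real_inner_le_norm _ _))
        rw [e3] at e4
        gcongr
      rw [inner_sub_left, inner_sub_left, map_smul, inner_smul_left] at e5
      simp only [RCLike.conj_to_real, ← ha] at e5
      have e6 := mul_le_mul_of_nonneg_left e5 (sub_nonneg.2 hss)
      nlinarith [e6, e1])
  simp only [one_smul, zero_smul, add_zero] at key
  nlinarith [key, mul_nonneg hη.le (sq_nonneg ‖d‖)]

/-- comparison of slopes -/
lemma vd_slope {f : E → ℝ} {q : E → E} {l L : ℝ} (hl : 0 ≤ l) (hlL : l ≤ L) (hf : SubG f q l)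
    {c z z' : E} {r : ℝ} (hz : ‖z - c‖ ≤ r / 4) (hz' : ‖z' - c‖ ≤ r / 4)
    (hup : ∀ w, ‖w - c‖ ≤ r → f w ≤ f z + ⟪q z, w - z⟫ + L * ‖w - z‖ ^ 2) :
    ‖q z' - q z‖ ≤ 6 * L * ‖z' - z‖ := by
  have hL : 0 ≤ L := hl.trans hlL
  by_cases h0 : q z' - q z = 0
  · rw [h0, norm_zero]; positivity
  have hn : 0 < ‖q z' - q z‖ := norm_pos_iff.2 h0
  by_cases hzz : z' = z
  · subst hzz; simp
  set s := ‖z' - z‖ with hs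
  have hs0 : 0 < s := norm_pos_iff.2 (sub_ne_zero.2 hzz)
  set v := (s / ‖q z' - q z‖) • (q z' - q z) with hv
  have hvn : ‖v‖ = s := by
    rw [hv, norm_smul, Real.norm_of_nonneg (by positivity)]; field_simp
  have hss : s ≤ r / 2 := by
    have : z' - z = (z' - c) - (z - c) := by abel
    rw [hs, this]
    exact (norm_sub_le _ _).trans (by linarith)
  have h1 := hup (z' + v) (by
    have : z' + v - c = (z' - c) + v := by abel
    rw [this]
    exact (norm_add_le _ _).trans (by linarith))
  have h2 := hf z' (z' + v)
  have h3 := hf z z'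
  have e1 : z' + v - z' = v := by abel
  have e2 : z' + v - z = (z' - z) + v := by abel
  rw [e1] at h2
  rw [e2, inner_add_right] at h1
  have h4 : ‖z' - z + v‖ ≤ 2 * s := (norm_add_le _ _).trans (by rw [hvn]; linarith)
  have h5 : ‖z' - z + v‖ ^ 2 ≤ (2 * s) ^ 2 := by gcongr
  have h6 : ⟪q z' - q z, v⟫ = s * ‖q z' - q z‖ := by
    rw [hv, inner_smul_right, real_inner_self_eq_norm_sq]; field_simp
  rw [inner_sub_left] at h6
  rw [hvn] at h2
  rw [← hs] at h3
  have h7 : s * ‖q z' - q z‖ ≤ 6 * L * s ^ 2 := by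
    nlinarith [mul_le_mul_of_nonneg_left h5 hL, mul_le_mul_of_nonneg_right hlL (sq_nonneg s)]
  have : s * ‖q z' - q z‖ ≤ s * (6 * L * s) := by nlinarith
  exact le_of_mul_le_mul_left this hs0

end abstract_part


section abstract_part2
variable {E : Type*} [NormedAddCommGroup E] [InnerProductSpace ℝ E] [FiniteDimensional ℝ E]

local notation "⟪" x "," y "⟫" => inner ℝ x y

open scoped Pointwise in
lemma vd_density [MeasurableSpace E] [BorelSpace E] (μ : MeasureTheory.Measure E)
    [μ.IsAddHaarMeasure] (s : Set E) (x : E)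
    (h : Tendsto (fun r => μ (s ∩ Metric.closedBall x r) / μ (Metric.closedBall x r))
      (nhdsWithin 0 (Ioi 0)) (nhds 1)) {κ : ℝ} (hκ : 0 < κ) (hxs : x ∈ s) :
    ∀ᶠ d in nhds (0 : E), ∃ y ∈ s, ‖y - (x + d)‖ ≤ κ * ‖d‖ := by
  obtain ⟨t, hts, htf, htc⟩ := (isCompact_sphere (0 : E) 1).finite_cover_balls (half_pos hκ)
  have h1 : ∀ e ∈ t, ∀ᶠ r in nhdsWithin (0 : ℝ) (Ioi 0),
      (s ∩ ({x} + r • Metric.closedBall e (κ / 2))).Nonempty := fun e _ =>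
    MeasureTheory.Measure.eventually_nonempty_inter_smul_of_density_one μ s x h _
      measurableSet_closedBall (Metric.measure_closedBall_pos μ e (half_pos hκ)).ne'
  have h2 := (eventually_all_finite htf).2 h1
  rw [eventually_nhdsWithin_iff, Metric.eventually_nhds_iff] at h2
  obtain ⟨ε, hε, h2⟩ := h2
  rw [Metric.eventually_nhds_iff]
  refine ⟨ε, hε, fun d hd => ?_⟩
  by_cases hd0 : d = 0
  · exact ⟨x, hxs, by simp [hd0]⟩
  have hdn : 0 < ‖d‖ := norm_pos_iff.2 hd0
  have hmem : ‖d‖⁻¹ • d ∈ Metric.sphere (0 : E) 1 := by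
    simp [norm_smul, hdn.ne']
  obtain ⟨e, het, hee⟩ := mem_iUnion₂.1 (htc hmem)
  obtain ⟨y, hys, hy⟩ := h2 (y := ‖d‖) (by simpa using hd) hdn e het
  refine ⟨y, hys, ?_⟩
  obtain ⟨x', hx', w, hw, rfl⟩ := Set.mem_add.1 hy
  rw [Set.mem_singleton_iff] at hx'
  subst hx'
  obtain ⟨v, hv, rfl⟩ := Set.mem_smul_set.1 hw
  have e1 : x' + ‖d‖ • v - (x' + d) = ‖d‖ • ((v - e) - (‖d‖⁻¹ • d - e)) := by
    rw [smul_sub, smul_sub, smul_sub, smul_smul, mul_inv_cancel₀ hdn.ne', one_smul]; abel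
  rw [e1, norm_smul, norm_norm, mul_comm]
  gcongr
  refine (norm_sub_le _ _).trans ?_
  rw [mem_closedBall_iff_norm] at hv
  rw [mem_ball_iff_norm] at hee
  linarith

/-- Differentiability along a density set upgrades to differentiability. -/
lemma vd_diff [MeasurableSpace E] [BorelSpace E] (μ : MeasureTheory.Measure E)
    [μ.IsAddHaarMeasure] (s : Set E) (x : E)
    (h : Tendsto (fun r => μ (s ∩ Metric.closedBall x r) / μ (Metric.closedBall x r))
      (nhdsWithin 0 (Ioi 0)) (nhds 1)) (hxs : x ∈ s) {q : E → E} {A : E →L[ℝ] E}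
    (hA : HasFDerivWithinAt q A s x) {L : ℝ} (hL : 0 ≤ L)
    (hq : ∀ᶠ z in nhds x, ∀ y ∈ s, ‖q z - q y‖ ≤ L * ‖z - y‖) :
    HasFDerivAt q A x := by
  rw [hasFDerivAt_iff_isLittleO_nhds_zero, Asymptotics.isLittleO_iff]
  intro c hc
  set κ := min 1 (c / (L + 2 + ‖A‖)) with hκ
  have hκ0 : 0 < κ := by positivity
  have hκ1 : κ ≤ 1 := min_le_left _ _
  have hκ2 : κ * (L + 2 + ‖A‖) ≤ c := by
    rw [← le_div_iff₀ (by positivity)]; exact min_le_right _ _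
  have h1 := vd_density μ s x h hκ0 hxs
  have hA' := (hasFDerivWithinAt_iff_isLittleO.1 hA)
  rw [Asymptotics.isLittleO_iff] at hA'
  have h2 := hA' hκ0
  rw [eventually_nhdsWithin_iff, Metric.eventually_nhds_iff] at h2
  obtain ⟨ε, hε, h2⟩ := h2
  have h3 : ∀ᶠ d in nhds (0 : E), ∀ y ∈ s, ‖q (x + d) - q y‖ ≤ L * ‖x + d - y‖ := by
    have : Tendsto (fun d : E => x + d) (nhds 0) (nhds x) := by
      have : Continuous fun d : E => x + d := by fun_prop
      simpa using this.tendsto 0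
    exact this.eventually hq
  have h4 : ∀ᶠ d in nhds (0 : E), ‖d‖ < ε / 2 := by
    have := Metric.ball_mem_nhds (0 : E) (half_pos hε)
    filter_upwards [this] with d hd
    simpa using hd
  filter_upwards [h1, h3, h4] with d ⟨y, hys, hy⟩ h3 h4
  have hyx : ‖y - x‖ ≤ 2 * ‖d‖ := by
    have : y - x = (y - (x + d)) + d := by abel
    rw [this]
    refine (norm_add_le _ _).trans ?_
    nlinarith [norm_nonneg d]
  have h5 := h2 (y := y) (by rw [dist_eq_norm]; linarith) hys
  have h6 := h3 y hys
  have h7 : ‖A (y - (x + d))‖ ≤ ‖A‖ * ‖y - (x + d)‖ := A.le_opNorm _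
  have e : q (x + d) - q x - A d = (q (x + d) - q y) + (q y - q x - A (y - x))
      + A (y - (x + d)) := by
    simp only [map_sub, map_add]; abel
  rw [e]
  refine (norm_add₃_le).trans ?_
  rw [← norm_neg (x + d - y), neg_sub] at h6
  have h8 : ‖A‖ * ‖y - (x + d)‖ ≤ ‖A‖ * (κ * ‖d‖) := by gcongr
  have h9 : L * ‖y - (x + d)‖ ≤ L * (κ * ‖d‖) := by gcongr
  nlinarith [norm_nonneg d, mul_le_mul_of_nonneg_right hκ2 (norm_nonneg d),
    mul_le_mul_of_nonneg_left hyx hκ0.le]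

lemma vd_lin_zero {v : E} {L ρ : ℝ} (hρ : 0 < ρ)
    (h : ∀ d : E, ‖d‖ ≤ ρ → ⟪v, d⟫ ≤ L * ‖d‖ ^ 2) : v = 0 := by
  by_contra hv
  have hn : 0 < ‖v‖ := norm_pos_iff.2 hv
  set s := min (ρ / ‖v‖) (1 / (2 * (|L| + 1))) with hs
  have hs0 : 0 < s := by positivity
  have h1 : s ≤ ρ / ‖v‖ := min_le_left _ _
  have h2 : s ≤ 1 / (2 * (|L| + 1)) := min_le_right _ _
  rw [le_div_iff₀ hn] at h1
  rw [le_div_iff₀ (by positivity)] at h2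
  have h3 := h (s • v) (by rw [norm_smul, Real.norm_of_nonneg hs0.le]; exact h1)
  rw [inner_smul_right, real_inner_self_eq_norm_sq, norm_smul, Real.norm_of_nonneg hs0.le,
    mul_pow] at h3
  have h4 : 0 < s * ‖v‖ ^ 2 := by positivity
  have h5 : s * ‖v‖ ^ 2 * 1 ≤ s * ‖v‖ ^ 2 * (L * s) := by nlinarith
  have h6 := le_of_mul_le_mul_left h5 h4
  nlinarith [le_abs_self L, abs_nonneg L]

theorem vd_TS {ι : Type*} [Fintype ι] [Nonempty ι] (f : ι → E → ℝ) (q : ι → E → E) {l : ℝ}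
    (hl : 0 ≤ l) (hf : ∀ i, SubG (f i) (q i) l) (hc : ∀ i, Continuous (f i))
    (c : E) {r : ℝ} (hr : 0 < r) {γ : ℝ} (hγ : 0 < γ)
    (hmax : ∀ z, ‖z - c‖ ≤ r → ∑ i, f i z ≤ ∑ i, f i c - γ * ‖z - c‖ ^ 2)
    {η : ℝ} (hη : 0 < η) :
    ∃ (z : E) (A : ι → E →L[ℝ] E), ‖z - c‖ < η ∧ ‖∑ i, q i z‖ ≤ η ∧
      (∀ i, HasFDerivAt (q i) (A i) z) ∧ ∀ d, ∑ i, ⟪A i d, d⟫ ≤ 0 := by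
  classical
  set F : E → ℝ := fun z => ∑ i, f i z with hF
  set P : E → E := fun z => ∑ i, q i z with hP
  have hFc : Continuous F := by fun_prop
  set L : ℝ := Fintype.card ι * l with hL
  have hcard : (1 : ℝ) ≤ Fintype.card ι := by exact_mod_cast Fintype.card_pos
  have hlL : l ≤ L := by nlinarith
  have hL0 : 0 ≤ L := hl.trans hlL
  have hFs : SubG F P L := by
    intro z w
    have := Finset.sum_le_sum (fun i (_ : i ∈ Finset.univ) => hf i z w)
    simp only [Finset.sum_sub_distrib, Finset.sum_add_distrib, Finset.sum_const,
      Finset.card_univ, nsmul_eq_mul, ← sum_inner] at this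
    simp only [hF, hP, hL]
    linarith
  set δ : ℝ := min η (γ * (min η r / 8)) with hδ
  have hmin : 0 < min η r := lt_min hη hr
  have hδ0 : 0 < δ := by positivity
  have hδη : δ ≤ η := min_le_left _ _
  have hδγ : δ ≤ γ * (min η r / 8) := min_le_right _ _
  set S : Set (E × E) := (Metric.closedBall c r ×ˢ Metric.closedBall 0 δ) ∩
    {a | ∀ w ∈ Metric.closedBall c r, F w ≤ F a.1 + ⟪a.2, w - a.1⟫} with hS
  have hScl : IsClosed {a : E × E | ∀ w ∈ Metric.closedBall c r, F w ≤ F a.1 + ⟪a.2, w - a.1⟫} := by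
    simp only [ofPred_forall]
    refine isClosed_iInter fun w => isClosed_iInter fun _ => isClosed_le (by fun_prop) (by fun_prop)
  have hScomp : IsCompact S :=
    ((isCompact_closedBall c r).prod (isCompact_closedBall 0 δ)).inter_right hScl
  set K : Set E := Prod.fst '' S with hK
  have hKcomp : IsCompact K := hScomp.image continuous_fst
  have hloc : ∀ a ∈ S, ‖a.1 - c‖ ≤ min η r / 8 := by
    rintro ⟨z, p⟩ ⟨⟨hz, hp⟩, hcon⟩
    simp only [mem_closedBall_iff_norm, sub_zero] at hz hp
    have h1 := hcon c (by simp [hr.le])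
    have h2 := hmax z hz
    simp only at h1
    have h3 : ⟪p, c - z⟫ ≤ δ * ‖z - c‖ := by
      refine (real_inner_le_norm _ _).trans ?_
      rw [norm_sub_rev c z]; gcongr
    simp only
    by_contra hcon'
    push Not at hcon'
    have h4 : 0 < ‖z - c‖ := lt_trans (by positivity) hcon'
    have h5 : γ * ‖z - c‖ ^ 2 ≤ δ * ‖z - c‖ := by simp only [hF] at h1; linarith
    have h6 : γ * ‖z - c‖ ≤ δ := by
      have : ‖z - c‖ * (γ * ‖z - c‖) ≤ ‖z - c‖ * δ := by nlinarith
      exact le_of_mul_le_mul_left this h4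
    have h7 : γ * (min η r / 8) < γ * ‖z - c‖ := by gcongr
    linarith
  have hloc4 : ∀ a ∈ S, ‖a.1 - c‖ ≤ r / 8 := fun a ha =>
    (hloc a ha).trans (by have := min_le_right η r; linarith)
  have hslope : ∀ a ∈ S, a.2 = P a.1 := by
    intro a ha
    have h1 := hloc4 a ha
    have h2 : P a.1 - a.2 = 0 := by
      refine vd_lin_zero (L := L) (ρ := r / 2) (by positivity) fun d hd => ?_
      have h3 := ha.2 (a.1 + d) (by
        rw [mem_closedBall_iff_norm]
        have : a.1 + d - c = (a.1 - c) + d := by abel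
        rw [this]
        exact (norm_add_le _ _).trans (by linarith))
      have h4 := hFs a.1 (a.1 + d)
      rw [add_sub_cancel_left] at h3 h4
      rw [inner_sub_left]; linarith
    exact (sub_eq_zero.1 h2).symm
  have hKprop : ∀ z ∈ K, ‖z - c‖ ≤ r / 8 ∧ ‖z - c‖ < η ∧ ‖P z‖ ≤ δ ∧
      ∀ w, ‖w - c‖ ≤ r → F w ≤ F z + ⟪P z, w - z⟫ := by
    rintro _ ⟨a, ha, rfl⟩
    have h1 := hslope a ha
    refine ⟨hloc4 a ha, ?_, ?_, ?_⟩
    · have := hloc a ha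
      have := min_le_left η r
      linarith
    · rw [← h1]; simpa using ha.1.2
    · intro w hw
      rw [← h1]
      exact ha.2 w (by rwa [mem_closedBall_iff_norm])
  have hball : Metric.closedBall 0 δ ⊆ P '' K := by
    intro p hp
    obtain ⟨z, hz, hzmax⟩ := (isCompact_closedBall c r).exists_isMaxOn
      (f := fun z => F z - ⟪p, z⟫) ⟨c, by simp [hr.le]⟩ (by fun_prop)
    have hmem : (z, p) ∈ S := by
      refine ⟨⟨hz, hp⟩, fun w hw => ?_⟩
      have := hzmax hw
      simp only [mem_ofPred_eq] at this
      simp only [inner_sub_right]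
      linarith
    exact ⟨z, ⟨_, hmem, rfl⟩, (hslope _ hmem).symm⟩
  have hup : ∀ z ∈ K, ∀ i, ∀ w, ‖w - c‖ ≤ r →
      f i w ≤ f i z + ⟪q i z, w - z⟫ + L * ‖w - z‖ ^ 2 := by
    intro z hz i w hw
    have h1 := (hKprop z hz).2.2.2 w hw
    have h2 : ∑ j ∈ Finset.univ.erase i, (f j z + ⟪q j z, w - z⟫ - l * ‖w - z‖ ^ 2)
        ≤ ∑ j ∈ Finset.univ.erase i, f j w :=
      Finset.sum_le_sum (fun j _ => hf j z w)
    have s1 := Finset.add_sum_erase Finset.univ (fun j => f j w) (Finset.mem_univ i)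
    have s2 := Finset.add_sum_erase Finset.univ
      (fun j => f j z + ⟪q j z, w - z⟫ - l * ‖w - z‖ ^ 2) (Finset.mem_univ i)
    simp only [Finset.sum_sub_distrib, Finset.sum_add_distrib, Finset.sum_const,
      Finset.card_univ, nsmul_eq_mul, ← sum_inner] at s1 s2 h2
    simp only [hF, hP] at h1
    have : 0 ≤ l * ‖w - z‖ ^ 2 := by positivity
    rw [hL]
    linarith
  have hupF : ∀ z ∈ K, ∀ w, ‖w - c‖ ≤ r → F w ≤ F z + ⟪P z, w - z⟫ + L * ‖w - z‖ ^ 2 := by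
    intro z hz w hw
    have h1 := (hKprop z hz).2.2.2 w hw
    have : 0 ≤ L * ‖w - z‖ ^ 2 := by positivity
    linarith
  have hlip : ∀ i, ∀ z ∈ K, ∀ z', ‖z' - c‖ ≤ r / 4 → ‖q i z' - q i z‖ ≤ 6 * L * ‖z' - z‖ :=
    fun i z hz z' hz' => vd_slope hl hlL (hf i) (by linarith [(hKprop z hz).1]) hz' (hup z hz i)
  have hlipF : ∀ z ∈ K, ∀ z', ‖z' - c‖ ≤ r / 4 → ‖P z' - P z‖ ≤ 6 * L * ‖z' - z‖ :=
    fun z hz z' hz' => vd_slope hL0 le_rfl hFs (by linarith [(hKprop z hz).1]) hz' (hupF z hz)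
  set C : NNReal := ⟨6 * L, by positivity⟩ with hC
  have hlipq : ∀ i, LipschitzOnWith C (q i) K := fun i =>
    LipschitzOnWith.of_dist_le_mul fun z' hz' z hz => by
      rw [dist_eq_norm, dist_eq_norm]
      exact hlip i z hz z' (by linarith [(hKprop z' hz').1])
  have hlipP : LipschitzOnWith C P K :=
    LipschitzOnWith.of_dist_le_mul fun z' hz' z hz => by
      rw [dist_eq_norm, dist_eq_norm]
      exact hlipF z hz z' (by linarith [(hKprop z' hz').1])
  let _ : MeasurableSpace E := borel E
  have : BorelSpace E := ⟨rfl⟩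
  let μ : MeasureTheory.Measure E := MeasureTheory.Measure.hausdorffMeasure (Module.finrank ℝ E)
  have : μ.IsAddHaarMeasure := MeasureTheory.isAddHaarMeasure_hausdorffMeasure
  have hμK : μ K ≠ 0 := by
    intro h0
    have h1 : μ (P '' K) ≤ (C : ENNReal) ^ (Module.finrank ℝ E : ℝ) * μ K :=
      hlipP.hausdorffMeasure_image_le (by positivity)
    rw [h0, mul_zero] at h1
    have h2 : μ (Metric.closedBall 0 δ) ≤ 0 := (MeasureTheory.measure_mono hball).trans h1
    exact (Metric.measure_closedBall_pos μ (0 : E) hδ0).ne' (le_antisymm h2 bot_le)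
  have hae1 : ∀ᵐ x ∂μ.restrict K, ∀ i, DifferentiableWithinAt ℝ (q i) K x :=
    (MeasureTheory.ae_all_iff).2 fun i => (hlipq i).ae_differentiableWithinAt hKcomp.measurableSet
  have hae2 := Besicovitch.ae_tendsto_measure_inter_div μ K
  have hae3 : ∀ᵐ x ∂μ.restrict K, x ∈ K := MeasureTheory.ae_restrict_mem hKcomp.measurableSet
  have : (MeasureTheory.ae (μ.restrict K)).NeBot := by
    rw [MeasureTheory.ae_neBot]
    intro h
    exact hμK (by rw [← MeasureTheory.Measure.restrict_eq_zero]; exact h)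
  obtain ⟨z, hz1, hz2, hzK⟩ := (hae1.and (hae2.and hae3)).exists
  obtain ⟨k1, k2, k3, k4⟩ := hKprop z hzK
  have hnear : ∀ᶠ z' in nhds z, ‖z' - c‖ ≤ r / 4 := by
    filter_upwards [Metric.ball_mem_nhds z (show (0 : ℝ) < r / 8 by positivity)] with z' hz'
    rw [mem_ball_iff_norm] at hz'
    have : z' - c = (z' - z) + (z - c) := by abel
    rw [this]
    exact (norm_add_le _ _).trans (by linarith)
  have hD : ∀ i, HasFDerivAt (q i) (fderivWithin ℝ (q i) K z) z := fun i => by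
    refine vd_diff μ K z hz2 hzK (hz1 i).hasFDerivWithinAt (L := 6 * L) (by positivity) ?_
    filter_upwards [hnear] with z' hz' y hy
    exact hlip i y hy z' hz'
  refine ⟨z, fun i => fderivWithin ℝ (q i) K z, k2, k3.trans hδη, hD, ?_⟩
  have hDP : HasFDerivAt P (∑ i, fderivWithin ℝ (q i) K z) z := by
    have := HasFDerivAt.sum (u := Finset.univ) (fun i _ => hD i)
    convert this using 1
    ext x; simp [hP]
  intro d
  by_contra hpos
  push Not at hpos
  have hsum : ∑ i, ⟪fderivWithin ℝ (q i) K z d, d⟫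
      = ⟪(∑ i, fderivWithin ℝ (q i) K z) d, d⟫ := by
    rw [sum_apply, sum_inner]
  rw [hsum] at hpos
  set a := ⟪(∑ i, fderivWithin ℝ (q i) K z) d, d⟫ with ha
  have h1 := vd_lower hFs hDP (η := a / (4 * (‖d‖ ^ 2 + 1))) (by positivity)
  have hcont : Tendsto (fun s : ℝ => s • d) (nhdsWithin 0 (Ioi 0)) (nhds 0) := by
    have : Continuous fun s : ℝ => s • d := by fun_prop
    have := (this.tendsto 0)
    rw [zero_smul] at this
    exact this.mono_left nhdsWithin_le_nhds
  have hcont2 : Tendsto (fun s : ℝ => z + s • d) (nhdsWithin 0 (Ioi 0)) (nhds z) := by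
    simpa using hcont.const_add z
  obtain ⟨s, ⟨hs1, hs2⟩, hs3⟩ := (((hcont.eventually h1).and (hcont2.eventually hnear)).and
    self_mem_nhdsWithin).exists
  have hs0 : 0 < s := hs3
  have h2 := k4 (z + s • d) (by linarith)
  rw [add_sub_cancel_left] at h2
  have h3 : (1 / 2) * (s * (s * a)) ≤ a / (4 * (‖d‖ ^ 2 + 1)) * (s * ‖d‖) ^ 2 := by
    rw [map_smul, inner_smul_left, inner_smul_right, norm_smul, Real.norm_of_nonneg hs0.le] at hs1
    rw [inner_smul_right] at h2 hs1
    simp only [RCLike.conj_to_real, ← ha] at hs1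
    linarith
  have h4 : a / (4 * (‖d‖ ^ 2 + 1)) * (s * ‖d‖) ^ 2 ≤ a / 4 * s ^ 2 := by
    rw [div_mul_eq_mul_div, div_le_iff₀ (by positivity)]
    have : 0 < a * s ^ 2 := by positivity
    nlinarith
  have : 0 < a * s ^ 2 := by positivity
  nlinarith

end abstract_part2


section abstract_part3
variable {E : Type*} [NormedAddCommGroup E] [InnerProductSpace ℝ E]

local notation "⟪" x "," y "⟫" => inner ℝ x y

lemma vd_supconv {u : E → ℝ} {D : Set E} (hD : IsCompact D) (hne : D.Nonempty)
    (hu : UpperSemicontinuousOn u D) (n : ℝ) :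
    ∃ Y : E → E, (∀ z, Y z ∈ D) ∧
      ∀ z, ∀ y ∈ D, u y - n * ‖z - y‖ ^ 2 ≤ u (Y z) - n * ‖z - Y z‖ ^ 2 := by
  have : ∀ z, ∃ y ∈ D, ∀ y' ∈ D, u y' - n * ‖z - y'‖ ^ 2 ≤ u y - n * ‖z - y‖ ^ 2 := by
    intro z
    have hc : Continuous fun y : E => -(n * ‖z - y‖ ^ 2) := by fun_prop
    have h1 : UpperSemicontinuousOn (fun y => u y + -(n * ‖z - y‖ ^ 2)) D :=
      hu.add (hc.upperSemicontinuous.upperSemicontinuousOn D)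
    obtain ⟨y, hy, hmax⟩ := h1.exists_isMaxOn hne hD
    refine ⟨y, hy, fun y' hy' => ?_⟩
    have := hmax hy'
    simp only [mem_ofPred_eq] at this
    linarith
  choose Y hY hY2 using this
  exact ⟨Y, hY, hY2⟩

lemma vd_supconv_subG {u : E → ℝ} {D : Set E} {n : ℝ} {Y : E → E} (hY : ∀ z, Y z ∈ D)
    (hmax : ∀ z, ∀ y ∈ D, u y - n * ‖z - y‖ ^ 2 ≤ u (Y z) - n * ‖z - Y z‖ ^ 2) :
    SubG (fun z => u (Y z) - n * ‖z - Y z‖ ^ 2) (fun z => (2 * n) • (Y z - z)) n := by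
  intro z w
  have h1 := hmax w (Y z) (hY z)
  have h2 : ‖w - Y z‖ ^ 2 = ‖z - Y z‖ ^ 2 - 2 * ⟪Y z - z, w - z⟫ + ‖w - z‖ ^ 2 := by
    have : w - Y z = (w - z) - (Y z - z) := by abel
    rw [this, norm_sub_sq_real, real_inner_comm, norm_sub_rev (Y z) z]; ring
  simp only [inner_smul_left, RCLike.conj_to_real]
  rw [h2] at h1
  linarith

lemma vd_supconv_cont {u : E → ℝ} {D : Set E} (hD : IsCompact D) {n : ℝ} (hn : 0 ≤ n)
    {Y : E → E} (hY : ∀ z, Y z ∈ D)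
    (hmax : ∀ z, ∀ y ∈ D, u y - n * ‖z - y‖ ^ 2 ≤ u (Y z) - n * ‖z - Y z‖ ^ 2) :
    Continuous (fun z => u (Y z) - n * ‖z - Y z‖ ^ 2) := by
  obtain ⟨R, hR⟩ := hD.isBounded.exists_norm_le
  have hR0 : 0 ≤ R := (norm_nonneg _).trans (hR _ (hY 0))
  set g : E → ℝ := fun z => u (Y z) - n * ‖z - Y z‖ ^ 2 + n * ‖z‖ ^ 2 with hg
  have key : ∀ z w, g z - g w ≤ (2 * n * R) * ‖z - w‖ := by
    intro z w
    have h1 := hmax w (Y z) (hY z)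
    have h2 : ‖w - Y z‖ ^ 2 = ‖w‖ ^ 2 - 2 * ⟪w, Y z⟫ + ‖Y z‖ ^ 2 := norm_sub_sq_real _ _
    have h3 : ‖z - Y z‖ ^ 2 = ‖z‖ ^ 2 - 2 * ⟪z, Y z⟫ + ‖Y z‖ ^ 2 := norm_sub_sq_real _ _
    have h4 : ⟪z - w, Y z⟫ ≤ ‖z - w‖ * R :=
      (real_inner_le_norm _ _).trans (by gcongr; exact hR _ (hY z))
    rw [inner_sub_left] at h4
    simp only [hg]
    have h5 := mul_le_mul_of_nonneg_left h4 hn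
    rw [h2] at h1
    rw [h3]
    nlinarith
  have hgl : LipschitzWith ⟨2 * n * R, by positivity⟩ g :=
    LipschitzWith.of_dist_le_mul fun z w => by
      rw [Real.dist_eq, dist_eq_norm]
      have h1 := key z w
      have h2 := key w z
      rw [norm_sub_rev] at h2
      have h3 : |g z - g w| ≤ (2 * n * R) * ‖z - w‖ := abs_le.2 ⟨by linarith, by linarith⟩
      exact h3
  have : (fun z => u (Y z) - n * ‖z - Y z‖ ^ 2) = fun z => g z - n * ‖z‖ ^ 2 := by
    ext z; simp [hg]
  rw [this]
  have := hgl.continuous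
  fun_prop

lemma SubG.smul {f : E → ℝ} {q : E → E} {l b l' : ℝ} (hf : SubG f q l) (hb : 0 ≤ b)
    (hl : b * l ≤ l') : SubG (fun z => b * f z) (fun z => b • q z) l' := by
  intro z w
  have h1 := mul_le_mul_of_nonneg_left (hf z w) hb
  simp only [inner_smul_left, RCLike.conj_to_real]
  have h2 : b * l * ‖w - z‖ ^ 2 ≤ l' * ‖w - z‖ ^ 2 := by gcongr
  nlinarith

theorem vd_TS' [FiniteDimensional ℝ E] {ι : Type*} [Fintype ι] (β : ι → ℝ) (hβ : ∀ i, 0 < β i)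
    (f : ι → E → ℝ) (q : ι → E → E) {l : ℝ}
    (hl : 0 ≤ l) (hf : ∀ i, SubG (f i) (q i) l) (hc : ∀ i, Continuous (f i))
    (c b : E) (B : E →L[ℝ] E) (hB : ∀ x y, ⟪B x, y⟫ = ⟪x, B y⟫) {r : ℝ} (hr : 0 < r)
    (hmax : ∀ z, ‖z - c‖ ≤ r →
      ∑ i, β i * f i z ≤ ∑ i, β i * f i c + ⟪b, z - c⟫ + ⟪B (z - c), z - c⟫)
    {η : ℝ} (hη : 0 < η) :
    ∃ (z : E) (A : ι → E →L[ℝ] E), ‖z - c‖ < η ∧ ‖∑ i, β i • q i z - b‖ ≤ η ∧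
      (∀ i, HasFDerivAt (q i) (A i) z) ∧
      ∀ d, ∑ i, β i * ⟪A i d, d⟫ ≤ 2 * ⟪B d, d⟫ + η * ‖d‖ ^ 2 := by
  set γ := η / 2 with hγ
  have hγ0 : 0 < γ := by positivity
  set M := ‖B‖ + γ with hM
  have hM0 : 0 < M := by positivity
  have hS0 : 0 ≤ ∑ i, β i := Finset.sum_nonneg fun i _ => (hβ i).le
  set l' := (∑ i, β i) * l + M with hl'
  set B' : E →L[ℝ] E := B + γ • ContinuousLinearMap.id ℝ E with hB'
  have hB's : ∀ x y, ⟪B' x, y⟫ = ⟪x, B' y⟫ := by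
    intro x y
    simp [hB', inner_add_left, inner_add_right, hB, inner_smul_left, inner_smul_right]
  have hB'n : ∀ e, ⟪B' e, e⟫ ≤ M * ‖e‖ ^ 2 := by
    intro e
    have h1 : ⟪B e, e⟫ ≤ ‖B‖ * ‖e‖ * ‖e‖ :=
      (real_inner_le_norm _ _).trans (by gcongr; exact B.le_opNorm _)
    simp only [hB', hM, ContinuousLinearMap.add_apply, ContinuousLinearMap.smul_apply,
      ContinuousLinearMap.id_apply, inner_add_left, inner_smul_left, RCLike.conj_to_real,
      real_inner_self_eq_norm_sq]
    nlinarith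
  have hB'e : ∀ e, ⟪B' e, e⟫ = ⟪B e, e⟫ + γ * ‖e‖ ^ 2 := by
    intro e
    simp only [hB', ContinuousLinearMap.add_apply, ContinuousLinearMap.smul_apply,
      ContinuousLinearMap.id_apply, inner_add_left, inner_smul_left, RCLike.conj_to_real,
      real_inner_self_eq_norm_sq]
  set g0 : E → ℝ := fun z => -⟪b, z - c⟫ - ⟪B' (z - c), z - c⟫ with hg0
  set p0 : E → E := fun z => -b - (2 : ℝ) • B' (z - c) with hp0
  have hg0s : SubG g0 p0 l' := by
    intro z w
    have h1 := hB'n (w - z)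
    have h2 : w - c = (z - c) + (w - z) := by abel
    have h3 : M * ‖w - z‖ ^ 2 ≤ l' * ‖w - z‖ ^ 2 := by
      gcongr
      rw [hl']
      have : 0 ≤ (∑ i, β i) * l := by positivity
      linarith
    simp only [hg0, hp0]
    rw [h2]
    have h4 : ⟪z - c, B' (w - z)⟫ = ⟪B' (z - c), w - z⟫ := (hB's _ _).symm
    simp only [map_add, inner_add_left, inner_add_right, inner_sub_left, inner_neg_left,
      inner_smul_left, RCLike.conj_to_real]
    rw [real_inner_comm (z - c) (B' (w - z)), h4]
    linarith
  set η' := η / (1 + 2 * M) with hη'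
  have hη'0 : 0 < η' := by positivity
  have hη'e : η' * (1 + 2 * M) = η := by rw [hη']; field_simp
  obtain ⟨z, A, hz1, hz2, hz3, hz4⟩ := vd_TS
    (f := fun o : Option ι => o.elim g0 (fun i z => β i * f i z))
    (q := fun o : Option ι => o.elim p0 (fun i z => β i • q i z)) (l := l')
    (by positivity)
    (by
      rintro (_ | i)
      · exact hg0s
      · refine (hf i).smul (hβ i).le ?_
        have : β i ≤ ∑ i, β i := Finset.single_le_sum (fun i _ => (hβ i).le) (Finset.mem_univ i)
        have := mul_le_mul_of_nonneg_right this hl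
        rw [hl']; linarith)
    (by
      rintro (_ | i)
      · simp only [Option.elim, hg0]; fun_prop
      · have := hc i
        simp only [Option.elim]; fun_prop)
    c hr hγ0
    (by
      intro z hz
      have := hmax z hz
      simp only [Fintype.sum_option, Option.elim, hg0, hB'e, sub_self, map_zero, inner_zero_right,
        norm_zero]
      linarith)
    hη'0
  simp only [Fintype.sum_option, Option.elim] at hz2 hz4
  have hηη : η' ≤ η := by nlinarith
  have hp0d : HasFDerivAt p0 (-((2 : ℝ) • B')) z := by
    have h1 : HasFDerivAt (fun z : E => B' (z - c)) B' z := by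
      have := B'.hasFDerivAt.comp z ((hasFDerivAt_id z).sub_const c)
      rw [ContinuousLinearMap.comp_id] at this
      exact this
    simpa [hp0] using (h1.const_smul (2 : ℝ)).const_sub (-b)
  have hA0 : A none = -((2 : ℝ) • B') := (hz3 none).unique hp0d
  refine ⟨z, fun i => (β i)⁻¹ • A (some i), lt_of_lt_of_le hz1 hηη, ?_, ?_, ?_⟩
  · have e : ∑ i, β i • q i z - b = (p0 z + ∑ i, β i • q i z) + (2 : ℝ) • B' (z - c) := by
      simp only [hp0]; abel
    have h1 : ‖B' (z - c)‖ ≤ M * η' := by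
      simp only [hB', ContinuousLinearMap.add_apply, ContinuousLinearMap.smul_apply,
        ContinuousLinearMap.id_apply]
      refine (norm_add_le _ _).trans ?_
      rw [norm_smul, Real.norm_of_nonneg hγ0.le]
      have := B.le_opNorm (z - c)
      nlinarith [norm_nonneg B]
    rw [e]
    refine (norm_add_le _ _).trans ?_
    rw [norm_smul]
    simp only [Real.norm_ofNat]
    linarith
  · intro i
    have h1 := (hz3 (some i)).const_smul (β i)⁻¹
    have h2 : (β i)⁻¹ • (fun z => β i • q i z) = q i := by
      ext1 z
      simp [smul_smul, inv_mul_cancel₀ (hβ i).ne']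
    simp only [Option.elim] at h1
    rwa [h2] at h1
  · intro d
    have h1 := hz4 d
    rw [hA0] at h1
    have h2 : ∀ i, β i * ⟪((β i)⁻¹ • A (some i)) d, d⟫ = ⟪A (some i) d, d⟫ := by
      intro i
      rw [ContinuousLinearMap.smul_apply, inner_smul_left]
      simp only [RCLike.conj_to_real]
      rw [← mul_assoc, mul_inv_cancel₀ (hβ i).ne', one_mul]
    simp only [h2]
    simp only [ContinuousLinearMap.neg_apply, ContinuousLinearMap.smul_apply, inner_neg_left,
      inner_smul_left, RCLike.conj_to_real, hB'e] at h1
    rw [hγ] at h1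
    linarith

lemma vd_penal {k : ℕ} (β : Fin k → ℝ) (hβ : ∀ i, 0 < β i) (u : Fin k → E → ℝ) {D I : Set E}
    (hD : IsCompact D) (hI : IsOpen I) (hu : ∀ i, UpperSemicontinuousOn (u i) D)
    {φ : E → ℝ} (hφ : Continuous φ) (hφ0 : ∀ z, 0 ≤ φ z) {m : ℝ} (hm : 0 < m)
    (hbd : ∀ z ∈ D, z ∉ I → ∑ i, β i * u i z - φ z ≤ 0) :
    ∃ n : ℕ, 0 < n ∧ ∀ z ∈ D, ∀ y : Fin k → E, (∀ i, y i ∈ D) →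
      m ≤ ∑ i, β i * (u i (y i) - n * ‖z - y i‖ ^ 2) - φ z → z ∈ I ∧ ∀ i, y i ∈ I := by
  by_contra hcon
  push Not at hcon
  have hcon' : ∀ n : ℕ, ∃ a : E × (Fin k → E), a.1 ∈ D ∧ (∀ i, a.2 i ∈ D) ∧
      m ≤ ∑ i, β i * (u i (a.2 i) - ((n + 1 : ℕ) : ℝ) * ‖a.1 - a.2 i‖ ^ 2) - φ a.1 ∧
      ¬ (a.1 ∈ I ∧ ∀ i, a.2 i ∈ I) := by
    intro n
    obtain ⟨z, hz, y, hy, h1, h2⟩ := hcon (n + 1) (by omega)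
    refine ⟨(z, y), hz, hy, h1, ?_⟩
    rintro ⟨h3, h4⟩
    obtain ⟨i, hi⟩ := h2 h3
    exact hi (h4 i)
  choose a ha1 ha2 ha3 ha4 using hcon'
  have hcomp : IsCompact (D ×ˢ (Set.univ.pi fun _ : Fin k => D)) :=
    hD.prod (isCompact_univ_pi fun _ => hD)
  obtain ⟨⟨z, y⟩, hzy, σ, hσ, hlim⟩ := hcomp.tendsto_subseq (x := a)
    (fun n => ⟨ha1 n, fun i _ => ha2 n i⟩)
  have hzD : z ∈ D := hzy.1
  have hlz : Tendsto (fun n => (a (σ n)).1) atTop (nhds z) :=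
    (continuous_fst.tendsto _).comp hlim
  have hly : ∀ i, Tendsto (fun n => (a (σ n)).2 i) atTop (nhds (y i)) := fun i =>
    (((continuous_apply i).comp continuous_snd).tendsto (z, y)).comp hlim
  have hU : ∀ i, ∃ U, ∀ z ∈ D, u i z ≤ U := by
    intro i
    obtain ⟨w, hw, hmax⟩ := (hu i).exists_isMaxOn ⟨z, hzD⟩ hD
    exact ⟨u i w, fun z hz => hmax hz⟩
  choose U hU using hU
  set W := ∑ i, β i * U i with hW
  have hpen : ∀ n i, (((n + 1 : ℕ) : ℝ)) * (β i * ‖(a n).1 - (a n).2 i‖ ^ 2) ≤ W := by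
    intro n i
    have h1 := ha3 n
    have h2 : ∑ j, β j * u j ((a n).2 j) ≤ W :=
      Finset.sum_le_sum fun j _ => mul_le_mul_of_nonneg_left (hU j _ (ha2 n j)) (hβ j).le
    have h3 : (((n + 1 : ℕ) : ℝ)) * (β i * ‖(a n).1 - (a n).2 i‖ ^ 2) ≤
        ∑ j, (((n + 1 : ℕ) : ℝ)) * (β j * ‖(a n).1 - (a n).2 j‖ ^ 2) :=
      Finset.single_le_sum (f := fun j => (((n + 1 : ℕ) : ℝ)) * (β j * ‖(a n).1 - (a n).2 j‖ ^ 2))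
        (fun j _ => by have := (hβ j).le; positivity) (Finset.mem_univ i)
    have h4 : ∑ j, β j * (u j ((a n).2 j) - ((n + 1 : ℕ) : ℝ) * ‖(a n).1 - (a n).2 j‖ ^ 2)
        = ∑ j, β j * u j ((a n).2 j) -
          ∑ j, (((n + 1 : ℕ) : ℝ)) * (β j * ‖(a n).1 - (a n).2 j‖ ^ 2) := by
      rw [← Finset.sum_sub_distrib]
      exact Finset.sum_congr rfl fun j _ => by ring
    have h5 := hφ0 (a n).1
    linarith
  have hyz : ∀ i, y i = z := by
    intro i
    have l1 : Tendsto (fun n => β i * ‖(a (σ n)).1 - (a (σ n)).2 i‖ ^ 2) atTop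
        (nhds (β i * ‖z - y i‖ ^ 2)) := (((hlz.sub (hly i)).norm).pow 2).const_mul _
    have l2 : Tendsto (fun n : ℕ => W / ((σ n : ℝ) + 1)) atTop (nhds 0) := by
      have h1 := ((tendsto_one_div_add_atTop_nhds_zero_nat (𝕜 := ℝ)).const_mul W).comp
        hσ.tendsto_atTop
      simpa [Function.comp_def, div_eq_mul_inv] using h1
    have h1 : β i * ‖z - y i‖ ^ 2 ≤ 0 := by
      refine le_of_tendsto_of_tendsto' l1 l2 fun n => ?_
      rw [le_div_iff₀ (by positivity)]
      have := hpen (σ n) i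
      push_cast at this
      linarith
    have h2 : ‖z - y i‖ ^ 2 ≤ 0 := by
      by_contra h
      push Not at h
      have := mul_pos (hβ i) h
      linarith
    have h3 : ‖z - y i‖ = 0 := by
      have := sq_nonneg ‖z - y i‖
      exact pow_eq_zero_iff (two_ne_zero) |>.1 (le_antisymm h2 this)
    exact (sub_eq_zero.1 (norm_eq_zero.1 h3)).symm
  simp only [hyz] at hly
  by_cases hzI : z ∈ I
  · have e1 : ∀ᶠ n in atTop, (a (σ n)).1 ∈ I := hlz.eventually (hI.mem_nhds hzI)
    have e2 : ∀ᶠ n in atTop, ∀ i, (a (σ n)).2 i ∈ I :=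
      eventually_all.2 fun i => (hly i).eventually (hI.mem_nhds hzI)
    obtain ⟨n, h1, h2⟩ := (e1.and e2).exists
    exact ha4 (σ n) ⟨h1, h2⟩
  · have hb := hbd z hzD hzI
    have hS0 : 0 ≤ ∑ i, β i := Finset.sum_nonneg fun i _ => (hβ i).le
    set e := m / (2 * (∑ i, β i + 1)) with he
    have he0 : 0 < e := by positivity
    have hem : e * (∑ i, β i + 1) = m / 2 := by rw [he]; field_simp
    have e1 : ∀ᶠ n in atTop, φ z - e < φ (a (σ n)).1 :=
      (hφ.continuousAt.tendsto.comp hlz).eventually (lt_mem_nhds (by linarith))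
    have e2 : ∀ᶠ n in atTop, ∀ i, u i ((a (σ n)).2 i) < u i z + e := by
      refine eventually_all.2 fun i => ?_
      have h1 : ∀ᶠ w in nhdsWithin z D, u i w < u i z + e := hu i z hzD _ (by linarith)
      have h2 : Tendsto (fun n => (a (σ n)).2 i) atTop (nhdsWithin z D) :=
        tendsto_nhdsWithin_iff.2 ⟨hly i, Eventually.of_forall fun n => ha2 _ i⟩
      exact h2.eventually h1
    obtain ⟨n, h1, h2⟩ := (e1.and e2).exists
    have h3 := ha3 (σ n)
    have h4 : ∑ i, β i * (u i ((a (σ n)).2 i) -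
        ((σ n + 1 : ℕ) : ℝ) * ‖(a (σ n)).1 - (a (σ n)).2 i‖ ^ 2) ≤ ∑ i, β i * (u i z + e) := by
      refine Finset.sum_le_sum fun i _ => mul_le_mul_of_nonneg_left ?_ (hβ i).le
      have : 0 ≤ ((σ n + 1 : ℕ) : ℝ) * ‖(a (σ n)).1 - (a (σ n)).2 i‖ ^ 2 := by positivity
      linarith [h2 i]
    simp only [mul_add, Finset.sum_add_distrib, ← Finset.sum_mul] at h4
    nlinarith

theorem vd_core [FiniteDimensional ℝ E] {k : ℕ} (β : Fin k → ℝ) (hβ : ∀ i, 0 < β i)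
    (u : Fin k → E → ℝ) {D I : Set E} (hID : I ⊆ D)
    (hD : IsCompact D) (hI : IsOpen I) (hu : ∀ i, UpperSemicontinuousOn (u i) D)
    {φ : E → ℝ} (hφ : Continuous φ) (hφ0 : ∀ z, 0 ≤ φ z)
    (hbd : ∀ z ∈ D, z ∉ I → ∑ i, β i * u i z - φ z ≤ 0)
    (b : E → E) (B : E → E →L[ℝ] E) (hB : ∀ c x y, ⟪B c x, y⟫ = ⟪x, B c y⟫)
    (hφB : ∀ c, ∀ᶠ z in nhds c, φ z ≤ φ c + ⟪b c, z - c⟫ + ⟪B c (z - c), z - c⟫)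
    (zs : E) (hzs : zs ∈ D) (hpos : 0 < ∑ i, β i * u i zs - φ zs) :
    ∃ c ∈ I, ∀ η > 0, ∃ (y : Fin k → E) (p : Fin k → E) (A : Fin k → E →L[ℝ] E),
      (∀ i, y i ∈ I) ∧ 0 ≤ ∑ i, β i * u i (y i) ∧
      (∀ i, ∀ᶠ d in nhds (0 : E),
        u i (y i + d) ≤ u i (y i) + ⟪p i, d⟫ + (1 / 2) * ⟪A i d, d⟫ + η * ‖d‖ ^ 2) ∧
      ‖∑ i, β i • p i - b c‖ ≤ η ∧
      ∀ d, ∑ i, β i * ⟪A i d, d⟫ ≤ 2 * ⟪B c d, d⟫ + η * ‖d‖ ^ 2 := by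
  set m := ∑ i, β i * u i zs - φ zs with hm
  obtain ⟨n, hn, hpen⟩ := vd_penal β hβ u hD hI hu hφ hφ0 (half_pos hpos) hbd
  have hn0 : (0 : ℝ) ≤ n := by positivity
  choose Y hY hYmax using fun i => vd_supconv hD ⟨zs, hzs⟩ (hu i) (n : ℝ)
  set f : Fin k → E → ℝ := fun i z => u i (Y i z) - n * ‖z - Y i z‖ ^ 2 with hf
  have hfs : ∀ i, SubG (f i) (fun z => (2 * (n : ℝ)) • (Y i z - z)) n := fun i =>
    vd_supconv_subG (hY i) (hYmax i)
  have hfc : ∀ i, Continuous (f i) := fun i => vd_supconv_cont hD hn0 (hY i) (hYmax i)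
  have hfu : ∀ i, ∀ z ∈ D, u i z ≤ f i z := by
    intro i z hz
    have := hYmax i z z hz
    simpa using this
  set F : E → ℝ := fun z => ∑ i, β i * f i z - φ z with hF
  have hFc : Continuous F := by fun_prop
  obtain ⟨c, hcD, hcmax⟩ := hD.exists_isMaxOn ⟨zs, hzs⟩ hFc.continuousOn
  have hFm : m ≤ F c := by
    have h1 : F zs ≤ F c := hcmax hzs
    have h2 : m ≤ F zs := by
      simp only [hm, hF]
      gcongr with i
      · exact (hβ i).le
      · exact hfu i zs hzs
    linarith
  have hcI : c ∈ I := (hpen c hcD (fun i => Y i c) (fun i => hY i c)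
    (by simp only [hF, hf] at hFm; linarith)).1
  refine ⟨c, hcI, fun η hη => ?_⟩
  have hev : ∀ᶠ z in nhds c, ∑ i, β i * f i z ≤
      ∑ i, β i * f i c + ⟪b c, z - c⟫ + ⟪B c (z - c), z - c⟫ := by
    filter_upwards [hφB c, hI.mem_nhds hcI] with z hz1 hz2
    have : F z ≤ F c := hcmax (hID hz2)
    simp only [hF] at this
    linarith
  obtain ⟨r, hr, hrev⟩ := Metric.eventually_nhds_iff.1 hev
  have hev2 : ∀ᶠ z in nhds c, z ∈ I ∧ m / 2 < F z :=
    Filter.Eventually.and (hI.eventually_mem hcI)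
      (hFc.continuousAt.eventually (lt_mem_nhds (by linarith)))
  obtain ⟨ρ, hρ, hρev⟩ := Metric.eventually_nhds_iff.1 hev2
  obtain ⟨z, A, hz1, hz2, hz3, hz4⟩ := vd_TS' β hβ f _ hn0 hfs hfc c (b c) (B c) (hB c)
    (half_pos hr) (fun z hz => hrev (by rw [dist_eq_norm]; linarith)) (lt_min hη hρ)
  obtain ⟨hzI, hzm⟩ := hρev (y := z) (by rw [dist_eq_norm]; exact hz1.trans_le (min_le_right _ _))
  have hyI := (hpen z (hID hzI) (fun i => Y i z) (fun i => hY i z)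
    (by simp only [hF, hf] at hzm; linarith)).2
  have hmin : min η ρ ≤ η := min_le_left _ _
  refine ⟨fun i => Y i z, fun i => (2 * (n : ℝ)) • (Y i z - z), A, hyI, ?_, ?_, ?_, ?_⟩
  · have h1 : ∑ i, β i * f i z ≤ ∑ i, β i * u i (Y i z) := by
      gcongr with i
      · exact (hβ i).le
      · simp only [hf]
        have : 0 ≤ (n : ℝ) * ‖z - Y i z‖ ^ 2 := by positivity
        linarith
    have h2 := hφ0 z
    simp only [hF] at hzm
    linarith
  · intro i
    have h1 := vd_upper (hfs i) (hz3 i) hη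
    have h2 : ∀ᶠ d in nhds (0 : E), Y i z + d ∈ I := by
      have : Tendsto (fun d : E => Y i z + d) (nhds 0) (nhds (Y i z)) := by
        have : Continuous fun d : E => Y i z + d := by fun_prop
        simpa using this.tendsto 0
      exact this.eventually (hI.mem_nhds (hyI i))
    filter_upwards [h1, h2] with d hd1 hd2
    have h3 := hYmax i (z + d) (Y i z + d) (hID hd2)
    rw [add_sub_add_right_eq_sub] at h3
    simp only [hf] at hd1
    linarith
  · exact hz2.trans hmin
  · intro d
    refine (hz4 d).trans ?_
    gcongr

end abstract_part3


section P4a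

local notation "⟪" x "," y "⟫" => inner ℝ x y

/-- Space-time with the Euclidean norm. -/
abbrev VdE (N : ℕ) := WithLp 2 (ℝ × Euc N)

def vdT (N : ℕ) : ℝ →L[ℝ] VdE N :=
  ((WithLp.prodContinuousLinearEquiv 2 ℝ ℝ (Euc N)).symm : ℝ × Euc N →L[ℝ] VdE N).comp
    (ContinuousLinearMap.inl ℝ ℝ (Euc N))

def vdS (N : ℕ) : Euc N →L[ℝ] VdE N :=
  ((WithLp.prodContinuousLinearEquiv 2 ℝ ℝ (Euc N)).symm : ℝ × Euc N →L[ℝ] VdE N).comp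
    (ContinuousLinearMap.inr ℝ ℝ (Euc N))

lemma vdT_apply {N : ℕ} (s : ℝ) : vdT N s = WithLp.toLp 2 (s, 0) := rfl
lemma vdS_apply {N : ℕ} (x : Euc N) : vdS N x = WithLp.toLp 2 (0, x) := rfl

lemma vd_quad_deriv {F : Type*} [NormedAddCommGroup F] [InnerProductSpace ℝ F] [CompleteSpace F]
    (p y : F) (A : F →L[ℝ] F) (z : F) :
    HasFDerivAt (fun z => ⟪p, z - y⟫ + (1 / 2) * ⟪A (z - y), z - y⟫)
      (innerSL ℝ (p + (1 / 2 : ℝ) • (A + A.adjoint) (z - y))) z := by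
  have h0 : HasFDerivAt (fun z : F => z - y) (ContinuousLinearMap.id ℝ F) z :=
    (hasFDerivAt_id z).sub_const y
  have h1 : HasFDerivAt (fun z : F => A (z - y)) (A.comp (ContinuousLinearMap.id ℝ F)) z :=
    A.hasFDerivAt.comp z h0
  have h2 := (h1.inner ℝ h0).const_mul (1 / 2 : ℝ)
  have h3 := ((innerSL ℝ p).hasFDerivAt.comp z h0)
  refine (h3.add h2).congr_fderiv ?_
  ext w
  have e1 : ⟪A w, z - y⟫ = ⟪z - y, A w⟫ := real_inner_comm _ _
  simp [ContinuousLinearMap.adjoint_inner_left, -map_sub, e1]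
  ring

lemma vd_quad_grad {F : Type*} [NormedAddCommGroup F] [InnerProductSpace ℝ F] [CompleteSpace F]
    (p y : F) (A : F →L[ℝ] F) :
    gradient (fun z => ⟪p, z - y⟫ + (1 / 2) * ⟪A (z - y), z - y⟫) y = p := by
  apply HasGradientAt.gradient
  rw [hasGradientAt_iff_hasFDerivAt]
  refine (vd_quad_deriv p y A y).congr_fderiv ?_
  ext w
  simp

lemma vd_quad_hess {F : Type*} [NormedAddCommGroup F] [InnerProductSpace ℝ F] [CompleteSpace F]
    (p y : F) (A : F →L[ℝ] F) (a b : F) :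
    iteratedFDeriv ℝ 2 (fun z => ⟪p, z - y⟫ + (1 / 2) * ⟪A (z - y), z - y⟫) y ![a, b] =
      (1 / 2) * (⟪A a, b⟫ + ⟪A b, a⟫) := by
  rw [iteratedFDeriv_two_apply]
  have e : fderiv ℝ (fun z => ⟪p, z - y⟫ + (1 / 2) * ⟪A (z - y), z - y⟫) =
      fun z => innerSL ℝ (p + (1 / 2 : ℝ) • (A + A.adjoint) (z - y)) := by
    ext1 z
    exact (vd_quad_deriv p y A z).fderiv
  rw [e]
  have h0 : HasFDerivAt (fun z : F => z - y) (ContinuousLinearMap.id ℝ F) y :=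
    (hasFDerivAt_id y).sub_const y
  have h1 : HasFDerivAt (fun z : F => p + (1 / 2 : ℝ) • (A + A.adjoint) (z - y))
      ((1 / 2 : ℝ) • (A + A.adjoint).comp (ContinuousLinearMap.id ℝ F)) y :=
    (((A + A.adjoint).hasFDerivAt.comp y h0).const_smul (1 / 2 : ℝ)).const_add p
  have h2 := (innerSL ℝ (E := F)).hasFDerivAt.comp y h1
  have h3 := h2.fderiv
  have h4 : fderiv ℝ (fun z => innerSL ℝ (p + (1 / 2 : ℝ) • (A + A.adjoint) (z - y))) y =
    (innerSL ℝ (E := F)).comp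
      ((1 / 2 : ℝ) • (A + A.adjoint).comp (ContinuousLinearMap.id ℝ F)) := h3
  rw [h4]
  simp [ContinuousLinearMap.adjoint_inner_left]
  rw [real_inner_comm a]
  ring

lemma vd_form {N : ℕ} (B : Euc N →L[ℝ] Euc N) (x : Fin N → ℝ) :
    x ⬝ᵥ (Matrix.of fun i j => (1 / 2) * (⟪B (EuclideanSpace.single i 1), EuclideanSpace.single j 1⟫
      + ⟪B (EuclideanSpace.single j 1), EuclideanSpace.single i 1⟫)).mulVec x
      = ⟪B (WithLp.toLp 2 x), (WithLp.toLp 2 x : Euc N)⟫ := by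
  have hx : (WithLp.toLp 2 x : Euc N) = ∑ i, x i • EuclideanSpace.single i (1 : ℝ) := by
    ext j
    simp [Finset.sum_apply, Pi.single_apply]
  have h1 : ⟪B (WithLp.toLp 2 x), (WithLp.toLp 2 x : Euc N)⟫ =
      ∑ i, ∑ j, x i * x j * ⟪B (EuclideanSpace.single i 1), EuclideanSpace.single j 1⟫ := by
    rw [hx]
    simp only [map_sum, map_smul, sum_inner, inner_sum, inner_smul_left, inner_smul_right]
    rw [Finset.sum_comm]
    refine Finset.sum_congr rfl fun i _ => ?_
    rw [Finset.mul_sum]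
    refine Finset.sum_congr rfl fun j _ => ?_
    simp; ring
  have h2 : ⟪B (WithLp.toLp 2 x), (WithLp.toLp 2 x : Euc N)⟫ =
      ∑ i, ∑ j, x i * x j * ⟪B (EuclideanSpace.single j 1), EuclideanSpace.single i 1⟫ := by
    rw [h1, Finset.sum_comm]
    refine Finset.sum_congr rfl fun i _ => Finset.sum_congr rfl fun j _ => ?_
    ring
  have h3 : ⟪B (WithLp.toLp 2 x), (WithLp.toLp 2 x : Euc N)⟫ =
     (1 / 2) * ⟪B (WithLp.toLp 2 x), (WithLp.toLp 2 x : Euc N)⟫ + 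
     (1 / 2) * ⟪B (WithLp.toLp 2 x), (WithLp.toLp 2 x : Euc N)⟫ := by ring
  rw [h3]
  nth_rewrite 1 [h1]
  rw [h2, Finset.mul_sum, Finset.mul_sum, ← Finset.sum_add_distrib]
  simp only [dotProduct, Matrix.mulVec, Matrix.of_apply]
  refine Finset.sum_congr rfl fun i _ => ?_
  rw [Finset.mul_sum, Finset.mul_sum, Finset.mul_sum, ← Finset.sum_add_distrib]
  refine Finset.sum_congr rfl fun j _ => ?_
  ring

set_option maxHeartbeats 1000000 in
lemma vd_visc {N : ℕ} {T : ℝ} {G : ℝ → Euc N → Matrix (Fin N) (Fin N) ℝ → ℝ}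
    {u : ℝ × Euc N → ℝ} (hsub : IsViscSubsol T G u) (y : VdE N) (hy : y.fst ∈ Ioo 0 T)
    (p : VdE N) (A : VdE N →L[ℝ] VdE N) (η : ℝ)
    (h : ∀ᶠ d in nhds (0 : VdE N), u (WithLp.ofLp (y + d)) ≤
      u (WithLp.ofLp y) + ⟪p, d⟫ + (1 / 2) * ⟪A d, d⟫ + η * ‖d‖ ^ 2) :
    ∃ X : Matrix (Fin N) (Fin N) ℝ, X.IsSymm ∧
      (∀ x : Fin N → ℝ, x ⬝ᵥ X.mulVec x =
        ⟪A (vdS N (WithLp.toLp 2 x)), vdS N (WithLp.toLp 2 x)⟫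
          + 2 * η * ‖(WithLp.toLp 2 x : Euc N)‖ ^ 2) ∧
      p.fst ≤ G (u (WithLp.ofLp y)) p.snd X := by
  set A' : VdE N →L[ℝ] VdE N := A + (2 * η) • ContinuousLinearMap.id ℝ (VdE N) with hA'
  have hA'q : ∀ d, (1 / 2) * ⟪A' d, d⟫ = (1 / 2) * ⟪A d, d⟫ + η * ‖d‖ ^ 2 := by
    intro d
    simp [hA', inner_add_left, inner_smul_left]
    ring
  set ψ : ℝ × Euc N → ℝ := fun w => ⟪p, WithLp.toLp 2 w - y⟫ +
    (1 / 2) * ⟪A' (WithLp.toLp 2 w - y), WithLp.toLp 2 w - y⟫ with hψ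
  have hψc : ContDiff ℝ 2 ψ := by
    have h1 : ContDiff ℝ 2 (fun w : ℝ × Euc N => (WithLp.toLp 2 w : VdE N) - y) :=
      ((WithLp.prodContinuousLinearEquiv 2 ℝ ℝ (Euc N)).symm.contDiff).sub contDiff_const
    exact (contDiff_const.inner ℝ h1).add
      (contDiff_const.mul ((A'.contDiff.comp h1).inner ℝ h1))
  set B : Euc N →L[ℝ] Euc N := (vdS N).adjoint.comp (A'.comp (vdS N)) with hB
  have hS : (fun z => ψ (y.fst, z)) =
      fun z => ⟪p.snd, z - y.snd⟫ + (1 / 2) * ⟪B (z - y.snd), z - y.snd⟫ := by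
    ext z
    have e : (WithLp.toLp 2 (y.fst, z) : VdE N) - y = vdS N (z - y.snd) := by
      rw [vdS_apply]
      apply (WithLp.equiv 2 _).injective
      ext1 <;> simp
    simp only [hψ, e, hB, ContinuousLinearMap.comp_apply, ContinuousLinearMap.adjoint_inner_left]
    congr 1
    rw [vdS_apply]
    simp [WithLp.prod_inner_apply]
  have hTt : (fun s => ψ (s, y.snd)) =
      fun s => p.fst * (s - y.fst) + (1 / 2) * ⟪A' (vdT N 1), vdT N 1⟫ * (s - y.fst) ^ 2 := by
    ext s
    have e : (WithLp.toLp 2 (s, y.snd) : VdE N) - y = (s - y.fst) • vdT N 1 := by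
      rw [vdT_apply]
      apply (WithLp.equiv 2 _).injective
      ext1 <;> simp
    simp only [hψ, e, map_smul, inner_smul_left, inner_smul_right]
    have : ⟪p, vdT N 1⟫ = p.fst := by
      rw [vdT_apply]
      simp [WithLp.prod_inner_apply]
    rw [this]
    simp
    ring
  have htd : tderiv ψ (WithLp.ofLp y) = p.fst := by
    have e : tderiv ψ (WithLp.ofLp y) = deriv (fun s => ψ (s, y.snd)) y.fst := rfl
    rw [e, hTt]
    have h1 : HasDerivAt (fun s : ℝ => s - y.fst) 1 y.fst := (hasDerivAt_id _).sub_const _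
    have h2 := (h1.const_mul p.fst).add
      ((h1.pow 2).const_mul ((1 / 2) * ⟪A' (vdT N 1), vdT N 1⟫))
    refine h2.deriv.trans ?_
    simp
  have hgr : xgrad ψ (WithLp.ofLp y) = p.snd := by
    have e : xgrad ψ (WithLp.ofLp y) = gradient (fun z => ψ (y.fst, z)) y.snd := rfl
    rw [e, hS]
    exact vd_quad_grad _ _ _
  set X := xhess ψ (WithLp.ofLp y) with hX
  have hXe : X = Matrix.of fun i j => (1 / 2) *
      (⟪B (EuclideanSpace.single i 1), EuclideanSpace.single j 1⟫
      + ⟪B (EuclideanSpace.single j 1), EuclideanSpace.single i 1⟫) := by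
    ext i j
    have e : X i j = iteratedFDeriv ℝ 2 (fun z => ψ (y.fst, z)) y.snd
      ![EuclideanSpace.single i 1, EuclideanSpace.single j 1] := rfl
    rw [e, hS, vd_quad_hess]
    rfl
  refine ⟨X, ?_, ?_, ?_⟩
  · rw [hXe]
    ext i j
    simp only [Matrix.transpose_apply, Matrix.of_apply]
    rw [add_comm]
  · intro x
    rw [hXe, vd_form]
    simp only [hB, ContinuousLinearMap.comp_apply, ContinuousLinearMap.adjoint_inner_left]
    have h1 := hA'q (vdS N (WithLp.toLp 2 x))
    have h2 : ‖vdS N (WithLp.toLp 2 x)‖ ^ 2 = ‖(WithLp.toLp 2 x : Euc N)‖ ^ 2 := by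
      rw [vdS_apply, WithLp.prod_norm_sq_eq_of_L2]
      simp
    rw [h2] at h1
    linarith
  · have hm : IsLocalMaxOn (fun z => u z - ψ z)
      (Set.Ioo (0 : ℝ) T ×ˢ (Set.univ : Set (Euc N))) (WithLp.ofLp y) := by
      apply Filter.Eventually.filter_mono nhdsWithin_le_nhds
      have ht : Tendsto (fun w : ℝ × Euc N => (WithLp.toLp 2 w : VdE N) - y)
          (nhds (WithLp.ofLp y)) (nhds 0) := by
        have hc : Continuous (fun w : ℝ × Euc N => (WithLp.toLp 2 w : VdE N) - y) :=
          ((WithLp.prodContinuousLinearEquiv 2 ℝ ℝ (Euc N)).symm.continuous).sub continuous_const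
        have := hc.tendsto (WithLp.ofLp y)
        simpa using this
      filter_upwards [ht.eventually h] with w hw
      have e1 : WithLp.ofLp (y + ((WithLp.toLp 2 w : VdE N) - y)) = w := by simp
      rw [e1] at hw
      have e2 : ψ (WithLp.ofLp y) = 0 := by simp [hψ]
      have e3 := hA'q ((WithLp.toLp 2 w : VdE N) - y)
      rw [e2]
      simp only [hψ]
      linarith
    have := hsub ψ hψc (WithLp.ofLp y) hy hm
    rw [htd, hgr] at this
    linarith

lemma vd_opnorm_one {N : ℕ} (c : ℝ) : matOpNorm (c • (1 : Matrix (Fin N) (Fin N) ℝ)) ≤ |c| := by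
  unfold matOpNorm
  rw [map_smul, map_one, norm_smul, Real.norm_eq_abs]
  have : ‖(1 : Euc N →L[ℝ] Euc N)‖ ≤ 1 := ContinuousLinearMap.norm_id_le
  nlinarith [abs_nonneg c]

lemma vd_alg {N k : ℕ} 
    (G : Fin k → ℝ → Euc N → Matrix (Fin N) (Fin N) ℝ → ℝ)
    (β : Fin k → ℝ) (hβ : ∀ i, 0 < β i)
    (C : ℝ) (hC : 0 < C)
    (hlip : ∀ i, ∀ v₁ v₂ : ℝ, ∀ p q : Euc N, ∀ A B : Matrix (Fin N) (Fin N) ℝ,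
      A.IsSymm → B.IsSymm →
      |G i v₁ p A - G i v₂ q B| ≤ C * (|v₁ - v₂| + ‖p - q‖ + matOpNorm (A - B)))
    (hdom : ∀ v : Fin k → ℝ, ∀ p : Fin k → Euc N,
      ∀ A : Fin k → Matrix (Fin N) (Fin N) ℝ, (∀ i, (A i).IsSymm) →
      0 ≤ ∑ i, β i * v i → ∑ i, β i • p i = 0 → (-(∑ i, β i • A i)).PosSemidef →
      ∑ i, β i * G i (v i) (p i) (A i) ≤ 0)
    (i0 : Fin k) (v τ : Fin k → ℝ) (p : Fin k → Euc N) (X : Fin k → Matrix (Fin N) (Fin N) ℝ)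
    (hX : ∀ i, (X i).IsSymm) (hv : 0 ≤ ∑ i, β i * v i) (S : ℝ) (hS : 0 ≤ S)
    (hXS : ∀ x : Fin N → ℝ, ∑ i, β i * (x ⬝ᵥ (X i).mulVec x) ≤ S * (x ⬝ᵥ x))
    (hτ : ∀ i, τ i ≤ G i (v i) (p i) (X i)) :
    ∑ i, β i * τ i ≤ C * (‖∑ i, β i • p i‖ + S) := by
  classical
  set P := ∑ i, β i • p i with hP
  set p' : Fin k → Euc N := fun i => p i - if i = i0 then (β i0)⁻¹ • P else 0 with hp'
  set X' : Fin k → Matrix (Fin N) (Fin N) ℝ :=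
    fun i => X i - if i = i0 then ((β i0)⁻¹ * S) • 1 else 0 with hX'
  have hb := hβ i0
  have hX's : ∀ i, (X' i).IsSymm := by
    intro i
    simp only [hX']
    refine (hX i).sub ?_
    split_ifs
    · exact (Matrix.isSymm_one).smul _
    · exact Matrix.isSymm_zero
  have hXsum : ∑ i, β i • X' i = ∑ i, β i • X i - S • 1 := by
    simp only [hX', smul_sub, Finset.sum_sub_distrib]
    congr 1
    simp [smul_smul, hb.ne']
  have h1 := hdom v p' X' hX's hv (by
      simp only [hp', smul_sub, Finset.sum_sub_distrib]
      simp [smul_smul, hb.ne', hP]) (by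
      apply Matrix.PosSemidef.of_dotProduct_mulVec_nonneg
      · have : (∑ i, β i • X' i).IsSymm := by
          unfold Matrix.IsSymm
          rw [Matrix.transpose_sum]
          exact Finset.sum_congr rfl fun i _ => by rw [Matrix.transpose_smul, (hX's i)]
        have h2 : (-(∑ i, β i • X' i)).IsSymm := this.neg
        rw [Matrix.IsHermitian, Matrix.conjTranspose_eq_transpose_of_trivial]
        exact h2
      · intro x
        rw [hXsum]
        have := hXS x
        simp [Matrix.sub_mulVec, Matrix.sum_mulVec, Matrix.smul_mulVec, dotProduct_sum, 
          Matrix.neg_mulVec]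
        linarith)
  have h2 : ∑ i, β i * τ i ≤ ∑ i, (β i * G i (v i) (p' i) (X' i) + 
      if i = i0 then C * (‖P‖ + S) else 0) := by
    refine Finset.sum_le_sum fun i _ => ?_
    by_cases hi : i = i0
    · subst hi
      have h3 := (abs_le.1 (hlip i (v i) (v i) (p i) (p' i) (X i) (X' i) (hX i) (hX's i))).2
      have e1 : p i - p' i = (β i)⁻¹ • P := by simp [hp']
      have e2 : X i - X' i = ((β i)⁻¹ * S) • 1 := by simp [hX']
      rw [e1, e2, norm_smul, Real.norm_of_nonneg (inv_pos.2 hb).le] at h3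
      have h4 := vd_opnorm_one (N := N) ((β i)⁻¹ * S)
      rw [abs_of_nonneg (by positivity)] at h4
      have h5 : τ i ≤ G i (v i) (p' i) (X' i) + C * ((β i)⁻¹ * ‖P‖ + (β i)⁻¹ * S) := by
        have := hτ i
        have h6 := mul_le_mul_of_nonneg_left h4 hC.le
        simp only [sub_self, abs_zero, zero_add, mul_add] at h3 h6 ⊢
        linarith
      have h6 := mul_le_mul_of_nonneg_left h5 hb.le
      have e3 : β i * (G i (v i) (p' i) (X' i) + C * ((β i)⁻¹ * ‖P‖ + (β i)⁻¹ * S)) =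
        β i * G i (v i) (p' i) (X' i) + C * (‖P‖ + S) := by field_simp
      simp only [if_true]
      linarith
    · simp only [hi, if_false, add_zero, hp', hX', sub_zero]
      exact mul_le_mul_of_nonneg_left (hτ i) (hβ i).le
  rw [Finset.sum_add_distrib] at h2
  simp at h2 h1 ⊢
  linarith
end P4a


section P5

local notation "⟪" x "," y "⟫" => inner ℝ x y

lemma vd_expsum {E J : Type*} [NormedAddCommGroup E] [InnerProductSpace ℝ E] [Fintype J]
    (a : J → ℝ) (ha : ∀ j, 0 ≤ a j) (l : J → E) (c : E) :
    ∀ᶠ z in nhds c, ∑ j, a j * exp ⟪l j, z⟫ ≤ ∑ j, a j * exp ⟪l j, c⟫ +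
      ⟪∑ j, (a j * exp ⟪l j, c⟫) • l j, z - c⟫ +
      ⟪(∑ j, (a j * exp ⟪l j, c⟫) • (innerSL ℝ (l j)).smulRight (l j) : E →L[ℝ] E) (z - c),
        z - c⟫ := by
  have h : ∀ j, ∀ᶠ z in nhds c, |⟪l j, z - c⟫| < 1 := by
    intro j
    have hc : Continuous fun z => |⟪l j, z - c⟫| := by fun_prop
    exact hc.continuousAt.eventually (gt_mem_nhds (by simp))
  filter_upwards [eventually_all.2 h] with z hz
  simp only [sum_inner, inner_smul_left, ContinuousLinearMap.sum_apply,
    ContinuousLinearMap.smul_apply, ContinuousLinearMap.smulRight_apply, innerSL_apply_apply]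
  rw [← Finset.sum_add_distrib, ← Finset.sum_add_distrib]
  refine Finset.sum_le_sum fun j _ => ?_
  have h1 := (abs_le.1 (Real.abs_exp_sub_one_sub_id_le (hz j).le)).2
  have e : ⟪l j, z⟫ = ⟪l j, c⟫ + ⟪l j, z - c⟫ := by rw [inner_sub_right]; ring
  rw [e, exp_add]
  have h2 : 0 ≤ a j * exp ⟪l j, c⟫ := mul_nonneg (ha j) (exp_pos _).le
  simp only [conj_trivial]
  nlinarith

lemma vd_euc_sum {N : ℕ} (x : Euc N) : x = ∑ i, x i • EuclideanSpace.single i (1 : ℝ) := by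
  ext j
  simp [Finset.sum_apply, Pi.single_apply]

lemma vd_exp_lower {N : ℕ} (x : Euc N) (hx : 0 < ‖x‖) :
    exp ((N : ℝ)⁻¹ * ‖x‖) ≤ ∑ j, exp |x j| := by
  have h1 : ‖x‖ ≤ ∑ j, |x j| := by
    conv_lhs => rw [vd_euc_sum x]
    refine (norm_sum_le _ _).trans (Finset.sum_le_sum fun j _ => ?_)
    rw [norm_smul]
    simp
  have hN : N ≠ 0 := by
    rintro rfl
    have : x = 0 := Subsingleton.elim _ _
    rw [this, norm_zero] at hx
    exact lt_irrefl _ hx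
  have hN' : (0 : ℝ) < N := by positivity
  have : Nonempty (Fin N) := ⟨⟨0, Nat.pos_of_ne_zero hN⟩⟩
  obtain ⟨j, _, hj⟩ := Finset.exists_le_of_sum_le (s := (Finset.univ : Finset (Fin N)))
    (f := fun _ => (N : ℝ)⁻¹ * ‖x‖) (g := fun j => |x j|) Finset.univ_nonempty (by
      simp
      rw [← mul_assoc, mul_inv_cancel₀ hN'.ne', one_mul]
      exact h1)
  refine (exp_le_exp.2 hj).trans ?_
  exact Finset.single_le_sum (f := fun j => exp |x j|) (fun j _ => (exp_pos _).le)
    (Finset.mem_univ j)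

lemma vd_growth {N k : ℕ} (T : ℝ) (β : Fin k → ℝ) (hβ : ∀ i, 0 < β i)
    (u : Fin k → ℝ × Euc N → ℝ) (hgrowth : ∀ i, PolyGrowth T (u i)) {δ : ℝ} (hδ : 0 < δ)
    (R0 : ℝ) :
    ∃ R > R0, 0 < R ∧ (∀ t ∈ Icc (0 : ℝ) T, ∀ x : Euc N, ‖x‖ = R →
      ∑ i, β i * u i (t, x) ≤ δ * ∑ j, exp |x j|) ∧
      ∃ K, ∀ t ∈ Icc (0 : ℝ) T, ∀ x : Euc N, ‖x‖ ≤ R → ∑ i, β i * u i (t, x) ≤ K := by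
  choose c m hcm using hgrowth
  have hb : ∀ t ∈ Icc (0 : ℝ) T, ∀ x : Euc N,
      ∑ i, β i * u i (t, x) ≤ ∑ i, β i * (c i * (1 + ‖x‖ ^ m i)) := fun t ht x =>
    Finset.sum_le_sum fun i _ =>
      mul_le_mul_of_nonneg_left ((le_abs_self _).trans (hcm i t ht x)) (hβ i).le
  have hbK : ∀ R, 0 < R → ∃ K, ∀ t ∈ Icc (0 : ℝ) T, ∀ x : Euc N, ‖x‖ ≤ R →
      ∑ i, β i * u i (t, x) ≤ K := by
    intro R hR
    refine ⟨∑ i, β i * (|c i| * (1 + R ^ m i)), fun t ht x hx => (hb t ht x).trans ?_⟩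
    refine Finset.sum_le_sum fun i _ => mul_le_mul_of_nonneg_left ?_ (hβ i).le
    gcongr
    exact le_abs_self _
  by_cases hN : N = 0
  · subst hN
    refine ⟨max R0 0 + 1, by linarith [le_max_left R0 0], by positivity, ?_,
      hbK _ (by positivity)⟩
    intro t ht x hx
    have : x = 0 := Subsingleton.elim _ _
    rw [this, norm_zero] at hx
    linarith [le_max_right R0 0]
  · have hNp : (0 : ℝ) < (N : ℝ)⁻¹ := by positivity
    have ho : (fun R : ℝ => ∑ i, β i * (c i * (1 + R ^ m i))) =o[atTop]
        fun R => exp ((N : ℝ)⁻¹ * R) := by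
      have hfs : (fun R : ℝ => ∑ i, β i * (c i * (1 + R ^ m i))) =
          ∑ i, fun R : ℝ => β i * (c i * (1 + R ^ m i)) := by
        ext R; simp
      rw [hfs]
      apply Asymptotics.IsLittleO.sum
      intro i _
      apply Asymptotics.IsLittleO.const_mul_left
      apply Asymptotics.IsLittleO.const_mul_left
      have h0 := isLittleO_pow_exp_pos_mul_atTop 0 hNp
      simp only [pow_zero] at h0
      exact h0.add (isLittleO_pow_exp_pos_mul_atTop (m i) hNp)
    obtain ⟨R, hR1, hR2, hR3⟩ := ((ho.def hδ).and
      ((eventually_gt_atTop R0).and (eventually_gt_atTop 0))).exists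
    refine ⟨R, hR2, hR3, ?_, hbK R hR3⟩
    intro t ht x hx
    have h1 := vd_exp_lower x (by linarith)
    rw [Real.norm_eq_abs, Real.norm_eq_abs, abs_of_pos (exp_pos _)] at hR1
    have h2 := hb t ht x
    rw [hx] at h1 h2
    calc _ ≤ _ := h2
      _ ≤ _ := le_abs_self _
      _ ≤ _ := hR1
      _ ≤ _ := by gcongr

def vdFst (N : ℕ) : VdE N →L[ℝ] ℝ := (ContinuousLinearMap.fst ℝ ℝ (Euc N)).comp
  ((WithLp.prodContinuousLinearEquiv 2 ℝ ℝ (Euc N)) : VdE N →L[ℝ] ℝ × Euc N)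

def vdSnd (N : ℕ) : VdE N →L[ℝ] Euc N := (ContinuousLinearMap.snd ℝ ℝ (Euc N)).comp
  ((WithLp.prodContinuousLinearEquiv 2 ℝ ℝ (Euc N)) : VdE N →L[ℝ] ℝ × Euc N)

lemma vdFst_apply {N : ℕ} (z : VdE N) : vdFst N z = z.fst := rfl
lemma vdSnd_apply {N : ℕ} (z : VdE N) : vdSnd N z = z.snd := rfl

lemma vdFst_le {N : ℕ} (z : VdE N) : |vdFst N z| ≤ ‖z‖ := by
  exact WithLp.norm_fst_le _ z

lemma vdSnd_le {N : ℕ} (z : VdE N) : ‖vdSnd N z‖ ≤ ‖z‖ := WithLp.norm_snd_le _ z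

def vdSgn (b : Bool) : ℝ := if b then 1 else -1

def vdL {N : ℕ} (M L : ℝ) : Option (Fin N × Bool) → VdE N
  | none => WithLp.toLp 2 (L, 0)
  | some jb => WithLp.toLp 2 (M, vdSgn jb.2 • EuclideanSpace.single jb.1 1)

lemma vdL_none {N : ℕ} (M L : ℝ) (z : VdE N) : ⟪vdL M L none, z⟫ = L * z.fst := by
  simp [vdL, WithLp.prod_inner_apply, mul_comm]

lemma vdL_some {N : ℕ} (M L : ℝ) (j : Fin N) (b : Bool) (z : VdE N) :
    ⟪vdL M L (some (j, b)), z⟫ = M * z.fst + vdSgn b * z.snd j := by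
  have h : ⟪(EuclideanSpace.single j 1 : Euc N), z.snd⟫ = z.snd j := by
    rw [EuclideanSpace.inner_single_left]; simp
  simp only [vdL, WithLp.prod_inner_apply]
  have h2 : ⟪vdSgn b • (EuclideanSpace.single j 1 : Euc N), z.snd⟫ = vdSgn b * z.snd j := by
    rw [inner_smul_left, h]; simp
  have h3 : ⟪M, z.fst⟫ = M * z.fst := by simp [mul_comm]
  exact congrArg₂ (· + ·) h3 h2

end P5

local notation "⟪" x "," y "⟫" => inner ℝ x y
/-- Domination theorem, polynomial growth version, for viscosity subsolutions of
`∂ₜuᵢ − Gᵢ(uᵢ, Duᵢ, D²uᵢ) = 0`. -/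
theorem stmt_16 {N k : ℕ} (T : ℝ) (hT : 0 < T)
    (G : Fin k → ℝ → Euc N → Matrix (Fin N) (Fin N) ℝ → ℝ)
    (β : Fin k → ℝ) (hβ : ∀ i, 0 < β i)
    (u : Fin k → ℝ × Euc N → ℝ)
    (husc : ∀ i, UpperSemicontinuousOn (u i)
      (Set.Icc (0 : ℝ) T ×ˢ (Set.univ : Set (Euc N))))
    (hgrowth : ∀ i, PolyGrowth T (u i))
    (hsub : ∀ i, IsViscSubsol T (G i) (u i))
    (hGcont : ∀ i, Continuous (fun z : ℝ × Euc N × Matrix (Fin N) (Fin N) ℝ =>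
      G i z.1 z.2.1 z.2.2))
    (C : ℝ) (hC : 0 < C)
    (hhom : ∀ i, ∀ v : ℝ, ∀ p : Euc N, ∀ Y : Matrix (Fin N) (Fin N) ℝ, Y.IsSymm →
      ∀ l : ℝ, 0 ≤ l → l * G i v p Y ≤ C * G i (l * v) (l • p) (l • Y))
    (hlip : ∀ i, ∀ v₁ v₂ : ℝ, ∀ p q : Euc N, ∀ A B : Matrix (Fin N) (Fin N) ℝ,
      A.IsSymm → B.IsSymm →
      |G i v₁ p A - G i v₂ q B| ≤ C * (|v₁ - v₂| + ‖p - q‖ + matOpNorm (A - B)))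
    (hdom : ∀ v : Fin k → ℝ, ∀ p : Fin k → Euc N,
      ∀ A : Fin k → Matrix (Fin N) (Fin N) ℝ, (∀ i, (A i).IsSymm) →
      0 ≤ ∑ i, β i * v i → ∑ i, β i • p i = 0 → (-(∑ i, β i • A i)).PosSemidef →
      ∑ i, β i * G i (v i) (p i) (A i) ≤ 0)
    (hinit_cont : Continuous (fun x : Euc N => ∑ i, β i * u i (0, x)))
    (hinit_nonpos : ∀ x : Euc N, ∑ i, β i * u i (0, x) ≤ 0) :
    ∀ t ∈ Set.Ioo (0 : ℝ) T, ∀ x : Euc N, ∑ i, β i * u i (t, x) ≤ 0 := by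

  intro ts hts xs
  by_contra hneg
  push Not at hneg
  set s0 := ∑ i, β i * u i (ts, xs) with hs0
  obtain ⟨i0⟩ : Nonempty (Fin k) := by
    by_contra hne
    rw [not_nonempty_iff] at hne
    rw [hs0, Finset.univ_eq_empty, Finset.sum_empty] at hneg
    exact lt_irrefl _ hneg
  set M := 3 * C with hM
  set Φ := ∑ jb : Fin N × Bool, exp (M * ts + vdSgn jb.2 * xs jb.1) with hΦ
  have hΦ0 : 0 ≤ Φ := Finset.sum_nonneg fun _ _ => (exp_pos _).le
  set δ := s0 / (2 * (Φ + 1)) with hδ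
  have hδ0 : 0 < δ := by positivity
  have hδΦ : δ * Φ < s0 / 2 := by
    rw [hδ, div_mul_eq_mul_div, div_lt_div_iff₀ (by positivity) (by positivity)]
    nlinarith
  obtain ⟨R, hR, hR0, hRφ, K, hK⟩ := vd_growth T β hβ u hgrowth hδ0 ‖xs‖
  obtain ⟨t1, ht1, ht1T⟩ := exists_between hts.2
  obtain ⟨L, hL0, hL1, hL2⟩ : ∃ L : ℝ, 0 < L ∧ exp (L * (ts - t1)) < s0 / 2 ∧
      K ≤ exp (L * (T - t1)) := by
    have h1 : Tendsto (fun L : ℝ => exp (L * (ts - t1))) atTop (nhds 0) :=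
      tendsto_exp_atBot.comp (tendsto_id.atTop_mul_const_of_neg (by linarith))
    have h2 : Tendsto (fun L : ℝ => exp (L * (T - t1))) atTop atTop :=
      tendsto_exp_atTop.comp (tendsto_id.atTop_mul_const (by linarith))
    exact ((eventually_gt_atTop 0).and ((h1.eventually (gt_mem_nhds (half_pos hneg))).and
      (h2.eventually_ge_atTop K))).exists
  set a : Option (Fin N × Bool) → ℝ := fun j => j.elim (exp (-(L * t1))) (fun _ => δ) with ha
  have ha0 : ∀ j, 0 < a j := by
    rintro (_ | j)
    · exact exp_pos _
    · exact hδ0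
  set l : Option (Fin N × Bool) → VdE N := vdL M L with hl
  set φ : VdE N → ℝ := fun z => ∑ j, a j * exp ⟪l j, z⟫ with hφ
  have hφe : ∀ z, φ z = exp (L * (z.fst - t1)) +
      δ * ∑ jb : Fin N × Bool, exp (M * z.fst + vdSgn jb.2 * z.snd jb.1) := by
    intro z
    simp only [hφ, Fintype.sum_option, hl, vdL_none, ha, Option.elim, ← exp_add, Finset.mul_sum]
    congr 1
    · congr 1; ring
    · refine Finset.sum_congr rfl fun jb _ => ?_
      rw [← vdL_some M L jb.1 jb.2]
  have hφ0 : ∀ z, 0 ≤ φ z := fun z =>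
    Finset.sum_nonneg fun j _ => mul_nonneg (ha0 j).le (exp_pos _).le
  set D : Set (VdE N) := (WithLp.prodContinuousLinearEquiv 2 ℝ ℝ (Euc N)).toHomeomorph ⁻¹'
    (Icc (0 : ℝ) T ×ˢ Metric.closedBall (0 : Euc N) R) with hD
  set I : Set (VdE N) := (WithLp.prodContinuousLinearEquiv 2 ℝ ℝ (Euc N)).toHomeomorph ⁻¹'
    (Ioo (0 : ℝ) T ×ˢ Metric.ball (0 : Euc N) R) with hI
  have memD : ∀ z, z ∈ D ↔ z.fst ∈ Icc 0 T ∧ ‖z.snd‖ ≤ R := by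
    intro z
    rw [← mem_closedBall_zero_iff]
    rfl
  have memI : ∀ z, z ∈ I ↔ z.fst ∈ Ioo 0 T ∧ ‖z.snd‖ < R := by
    intro z
    rw [← mem_ball_zero_iff]
    rfl
  have hID : I ⊆ D := fun z hz =>
    (memD z).2 ⟨Ioo_subset_Icc_self ((memI z).1 hz).1, ((memI z).1 hz).2.le⟩
  have hDc : IsCompact D :=
    (Homeomorph.isCompact_preimage _).2 (isCompact_Icc.prod (isCompact_closedBall _ _))
  have hIo : IsOpen I :=
    (isOpen_Ioo.prod Metric.isOpen_ball).preimage (Homeomorph.continuous _)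
  have hu : ∀ i, UpperSemicontinuousOn (fun z : VdE N => u i (WithLp.ofLp z)) D := by
    intro i
    refine (husc i).comp (g := fun z : VdE N => WithLp.ofLp z) ?_ ?_
    · exact (WithLp.prodContinuousLinearEquiv 2 ℝ ℝ (Euc N)).continuous.continuousOn
    · intro z hz
      exact ⟨((memD z).1 hz).1, mem_univ _⟩
  have hφc : Continuous φ := by
    simp only [hφ]
    fun_prop
  have hbd : ∀ z ∈ D, z ∉ I → ∑ i, β i * u i (WithLp.ofLp z) - φ z ≤ 0 := by
    intro z hz hzI
    obtain ⟨hz1, hz2⟩ := (memD z).1 hz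
    rw [memI, not_and_or] at hzI
    have e : ∀ i, u i (WithLp.ofLp z) = u i (z.fst, z.snd) := fun i => rfl
    simp only [e]
    have hs : 0 ≤ δ * ∑ jb : Fin N × Bool, exp (M * z.fst + vdSgn jb.2 * z.snd jb.1) :=
      mul_nonneg hδ0.le (Finset.sum_nonneg fun _ _ => (exp_pos _).le)
    rcases hzI with h | h
    · rcases hz1.1.eq_or_lt with h0 | h0
      · have := hinit_nonpos z.snd
        rw [← h0]
        linarith [hφ0 z]
      · have h1 : z.fst = T := le_antisymm hz1.2 (not_lt.1 fun h' => h ⟨h0, h'⟩)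
        have h2 := hK z.fst hz1 z.snd hz2
        rw [hφe z]
        rw [h1] at h2 hs ⊢
        linarith
    · have h1 : ‖z.snd‖ = R := le_antisymm hz2 (not_lt.1 h)
      have h2 := hRφ z.fst hz1 z.snd h1
      have h3 : ∑ j, exp |z.snd j| ≤
          ∑ jb : Fin N × Bool, exp (M * z.fst + vdSgn jb.2 * z.snd jb.1) := by
        rw [Fintype.sum_prod_type]
        refine Finset.sum_le_sum fun j _ => ?_
        have hM0 : 0 ≤ M * z.fst := mul_nonneg (by positivity) hz1.1
        simp only [Fintype.sum_bool, vdSgn, if_true, Bool.false_eq_true, if_false]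
        rcases abs_cases (z.snd j) with ⟨h, _⟩ | ⟨h, _⟩
        · rw [h]
          have := exp_pos (M * z.fst + -1 * z.snd j)
          have : exp (z.snd j) ≤ exp (M * z.fst + 1 * z.snd j) := exp_le_exp.2 (by linarith)
          linarith
        · rw [h]
          have := exp_pos (M * z.fst + 1 * z.snd j)
          have : exp (-z.snd j) ≤ exp (M * z.fst + -1 * z.snd j) := exp_le_exp.2 (by linarith)
          linarith
      have h4 := mul_le_mul_of_nonneg_left h3 hδ0.le
      rw [hφe z]
      linarith [exp_pos (L * (z.fst - t1))]
  obtain ⟨c, hcI, hcore⟩ := vd_core β hβ (fun i z => u i (WithLp.ofLp z)) hID hDc hIo hu hφc hφ0 hbd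
    (fun c => ∑ j, (a j * exp ⟪l j, c⟫) • l j)
    (fun c => ∑ j, (a j * exp ⟪l j, c⟫) • (innerSL ℝ (l j)).smulRight (l j))
    (by
      intro c x y
      simp only [ContinuousLinearMap.sum_apply, ContinuousLinearMap.smul_apply,
        ContinuousLinearMap.smulRight_apply, innerSL_apply_apply, sum_inner, inner_sum,
        inner_smul_left, inner_smul_right, conj_trivial]
      refine Finset.sum_congr rfl fun j _ => ?_
      rw [real_inner_comm x]
      ring)
    (vd_expsum a (fun j => (ha0 j).le) l)
    (WithLp.toLp 2 (ts, xs)) ((memD _).2 ⟨Ioo_subset_Icc_self hts, hR.le⟩)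
    (by
      rw [hφe]
      have : δ * ∑ jb : Fin N × Bool, exp (M * ts + vdSgn jb.2 * xs jb.1) < s0 / 2 := hδΦ
      change 0 < s0 - (exp (L * (ts - t1)) +
        δ * ∑ jb : Fin N × Bool, exp (M * ts + vdSgn jb.2 * xs jb.1))
      linarith)
  set W : Option (Fin N × Bool) → ℝ := fun j => a j * exp ⟪l j, c⟫ with hW
  have hW0 : ∀ j, 0 < W j := fun j => mul_pos (ha0 j) (exp_pos _)
  set φ1 := ∑ jb, W (some jb) with hφ1
  have hφ10 : 0 ≤ φ1 := Finset.sum_nonneg fun j _ => (hW0 _).le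
  set bc := ∑ j, W j • l j with hbc
  have hbf : vdFst N bc = L * W none + M * φ1 := by
    simp only [hbc, map_sum, map_smul, map_add, Fintype.sum_option, smul_eq_mul]
    have e1 : vdFst N (l none) = L := rfl
    have e2 : ∀ jb, vdFst N (l (some jb)) = M := fun _ => rfl
    simp only [e1, e2]
    rw [← Finset.sum_mul]
    ring
  have hsgn : ∀ b, |vdSgn b| = 1 := by
    intro b; cases b <;> simp [vdSgn]
  have hbs : ‖vdSnd N bc‖ ≤ φ1 := by
    simp only [hbc, map_sum, map_smul, map_add, Fintype.sum_option]
    have e1 : vdSnd N (l none) = 0 := rfl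
    rw [e1, smul_zero, zero_add]
    refine (norm_sum_le _ _).trans (Finset.sum_le_sum fun jb _ => ?_)
    have e2 : vdSnd N (l (some jb)) = vdSgn jb.2 • EuclideanSpace.single jb.1 1 := rfl
    rw [e2, norm_smul, norm_smul, Real.norm_eq_abs, Real.norm_eq_abs, hsgn, abs_of_pos (hW0 _)]
    simp
  set Bc : VdE N →L[ℝ] VdE N := ∑ j, W j • (innerSL ℝ (l j)).smulRight (l j) with hBc
  have hBcS : ∀ x : Euc N, ⟪Bc (vdS N x), vdS N x⟫ ≤ φ1 * ‖x‖ ^ 2 := by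
    intro x
    simp only [hBc, ContinuousLinearMap.sum_apply, ContinuousLinearMap.smul_apply,
        ContinuousLinearMap.add_apply, inner_add_left,
        ContinuousLinearMap.smulRight_apply, innerSL_apply_apply, sum_inner,
        inner_smul_left, conj_trivial, Fintype.sum_option, hl, vdL_none]
    have e0 : (vdS N x).fst = 0 := rfl
    rw [e0, hφ1, Finset.sum_mul]
    simp only [mul_zero, zero_add]
    refine Finset.sum_le_sum fun jb _ => ?_
    refine mul_le_mul_of_nonneg_left ?_ (hW0 _).le
    have e1 := vdL_some M L jb.1 jb.2 (vdS N x)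
    rw [e0] at e1
    have e2 : (vdS N x).snd = x := rfl
    rw [e2, mul_zero, zero_add] at e1
    change ⟪vdL M L (some (jb.1, jb.2)), vdS N x⟫ * ⟪vdL M L (some (jb.1, jb.2)), vdS N x⟫ ≤ _
    rw [e1]
    have e3 : vdSgn jb.2 ^ 2 = 1 := by rw [← sq_abs, hsgn, one_pow]
    have e4 : |x jb.1| ≤ ‖x‖ := PiLp.norm_apply_le x jb.1
    have e5 : x jb.1 ^ 2 ≤ ‖x‖ ^ 2 := by
      rw [← sq_abs]; gcongr
    calc _ = vdSgn jb.2 ^ 2 * x jb.1 ^ 2 := by ring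
      _ ≤ _ := by rw [e3, one_mul]; exact e5
  set Sβ := ∑ i, β i with hSβ
  have hSβ0 : 0 ≤ Sβ := Finset.sum_nonneg fun i _ => (hβ i).le
  have key : ∀ η > 0, L * W none ≤ η * (1 + C * (2 + 2 * Sβ)) := by
    intro η hη
    obtain ⟨y, p, A, hyI, hy0, hjet, hp, hA⟩ := hcore η hη
    choose X hXs hXq hXG using fun i =>
      vd_visc (hsub i) (y i) ((memI _).1 (hyI i)).1 (p i) (A i) η (hjet i)
    have h1 := vd_alg G β hβ C hC hlip hdom i0 (fun i => u i (WithLp.ofLp (y i)))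
      (fun i => (p i).fst) (fun i => (p i).snd) X hXs hy0 (2 * φ1 + η + 2 * η * Sβ)
      (by positivity)
      (by
        intro x
        have e1 : x ⬝ᵥ x = ‖(WithLp.toLp 2 x : Euc N)‖ ^ 2 := by
          rw [EuclideanSpace.norm_sq_eq]
          simp [dotProduct, sq]
        simp only [hXq, mul_add, Finset.sum_add_distrib]
        have h2 := hA (vdS N (WithLp.toLp 2 x))
        have h3 := hBcS (WithLp.toLp 2 x)
        have h4 : ‖vdS N (WithLp.toLp 2 x)‖ ^ 2 = ‖(WithLp.toLp 2 x : Euc N)‖ ^ 2 := by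
          rw [vdS_apply, WithLp.prod_norm_sq_eq_of_L2]
          simp
        have h5 : ∑ i, β i * (2 * η * ‖(WithLp.toLp 2 x : Euc N)‖ ^ 2) =
            2 * η * Sβ * ‖(WithLp.toLp 2 x : Euc N)‖ ^ 2 := by
          rw [← Finset.sum_mul]; ring
        rw [e1, h5]
        rw [h4] at h2
        linarith)
      hXG
    have e1 : ∑ i, β i * (p i).fst = vdFst N (∑ i, β i • p i) := by
      simp only [map_sum, map_smul, smul_eq_mul, vdFst_apply]
    have e2 : ∑ i, β i • (p i).snd = vdSnd N (∑ i, β i • p i) := by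
      simp only [map_sum, map_smul, vdSnd_apply]
    rw [e1, e2] at h1
    have h2 := (abs_le.1 ((vdFst_le (∑ i, β i • p i - bc)).trans hp)).1
    have h3 := (vdSnd_le (∑ i, β i • p i - bc)).trans hp
    rw [map_sub] at h2 h3
    have h4 : ‖vdSnd N (∑ i, β i • p i)‖ ≤ φ1 + η := by
      have := norm_le_norm_add_norm_sub (vdSnd N bc) (vdSnd N (∑ i, β i • p i))
      rw [norm_sub_rev] at this
      linarith
    have h5 := mul_le_mul_of_nonneg_left h4 hC.le
    rw [hbf, hM] at h2
    linarith
  have hLW : 0 < L * W none := mul_pos hL0 (hW0 _)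
  have hQ : 0 < 1 + C * (2 + 2 * Sβ) := by positivity
  have := key (L * W none / (2 * (1 + C * (2 + 2 * Sβ)))) (by positivity)
  have e : L * W none / (2 * (1 + C * (2 + 2 * Sβ))) * (1 + C * (2 + 2 * Sβ)) = L * W none / 2 := by
    field_simp
  rw [e] at this
  linarith
end
end

section
/- (Domination of supersolutions by a subsolution) Let F_0, F_1 : ℝᴺ × S(N) → ℝ be continuous functions satisfying, for some constant C > 0: λ F_i(p, Y) ≤ C F_i(λp, λY) for all λ ≥ 0, and |F_i(p, X) − F_i(q, Y)| ≤ C(|p − q| + ‖X − Y‖). Let v_0 and v_1 be lower semicontinuous viscosity supersolutions of ∂_t v − F_0(Dv, D²v) = 0 and ∂_t v − F_1(Dv, D²v) = 0 respectively on (0, T) × ℝᴺ, and let v_2 be an upper semicontinuous viscosity subsolution of ∂_t v − F_1(Dv, D²v) = 0 on (0, T) × ℝᴺ (all of polynomial growth). Assume that F_1(p, X) − F_1(q, Y) ≤ F_0(p − q, Z) for all p, q ∈ ℝᴺ and X, Y, Z ∈ S(N) with X − Y ≤ Z. If v_0(0, ·) + v_1(0, ·) − v_2(0, ·) is a continuous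 non-negative function, then v_0(t, ·) + v_1(t, ·) − v_2(t, ·) ≥ 0 for all t > 0 within the time horizon. -/
noncomputable section

open Real Set Filter

open Topology MeasureTheory in
/-- continuity of a subgradient selection at differentiability points -/
lemma subgrad_continuousAt {E : Type*} [NormedAddCommGroup E] [InnerProductSpace ℝ E]
    {g : E → ℝ} {s : E → E}
    (hs : ∀ z w, g z + inner ℝ (s z) (w - z) ≤ g w) {z : E} (hd : DifferentiableAt ℝ g z) :
    ContinuousAt s z := by
  have hD := hd.hasFDerivAt
  have hgrad : ∀ v, fderiv ℝ g z v = inner ℝ (s z) v := by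
    have hmin : IsLocalMin (fun w => g w - inner ℝ (s z) (w - z)) z := by
      refine Filter.Eventually.of_forall fun w => ?_
      have := hs z w
      simp only [sub_self, inner_zero_right]; linarith
    have h2 : HasFDerivAt (fun w => g w - inner ℝ (s z) (w - z))
        (fderiv ℝ g z - innerSL ℝ (s z)) z := by
      refine hD.sub ?_
      exact ((innerSL ℝ (s z)).hasFDerivAt).comp z ((hasFDerivAt_id z).sub_const z)
    have h3 := hmin.hasFDerivAt_eq_zero h2
    intro v
    have := congrArg (fun l => l v) h3
    simp at this
    linarith
  rw [Metric.continuousAt_iff]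
  intro ε hε
  have h4 := hasFDerivAt_iff_isLittleO_nhds_zero.1 hD
  have h5 := h4.def (c := ε / 4) (by positivity)
  obtain ⟨r, hr, hball⟩ := Metric.eventually_nhds_iff.1 h5
  refine ⟨r / 2, by positivity, fun {z'} hz' => ?_⟩
  rw [dist_eq_norm] at hz' ⊢
  by_cases hne : s z' - s z = 0
  · rw [hne]; simpa using hε
  by_cases hzz : z' = z
  · subst hzz; simpa using hε
  have hn : 0 < ‖s z' - s z‖ := norm_pos_iff.2 hne
  have hzn : 0 < ‖z' - z‖ := norm_pos_iff.2 (sub_ne_zero.2 hzz)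
  set v : E := (‖z' - z‖ / ‖s z' - s z‖) • (s z' - s z) with hv
  have hvn : ‖v‖ = ‖z' - z‖ := by
    rw [hv, norm_smul, norm_div, norm_norm, norm_norm]; field_simp
  have hvi : inner ℝ (s z' - s z) v = ‖z' - z‖ * ‖s z' - s z‖ := by
    rw [hv, inner_smul_right, real_inner_self_eq_norm_sq]; field_simp
  have e1 := hs z' (z' + v)
  have b1 := hball (y := z' - z) (by rw [dist_zero_right]; linarith)
  have hle : ‖z' - z + v‖ ≤ 2 * ‖z' - z‖ := by
    calc _ ≤ ‖z' - z‖ + ‖v‖ := norm_add_le _ _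
      _ = _ := by rw [hvn]; ring
  have b2 := hball (y := z' - z + v) (by rw [dist_zero_right]; linarith)
  rw [hgrad, Real.norm_eq_abs] at b1 b2
  have e2 : z + (z' - z + v) = z' + v := by abel
  have e3 : z + (z' - z) = z' := by abel
  rw [e2] at b2
  rw [e3] at b1
  rw [inner_add_right] at b2
  rw [add_sub_cancel_left] at e1
  rw [inner_sub_left] at hvi
  have b1' := (abs_le.1 b1).1
  have b2' := (abs_le.1 b2).2
  have : ‖z' - z‖ * ‖s z' - s z‖ ≤ ‖z' - z‖ * (3 * (ε / 4)) := by
    have : ε / 4 * ‖z' - z + v‖ ≤ ε / 4 * (2 * ‖z' - z‖) := by gcongr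
    nlinarith
  have := le_of_mul_le_mul_left this hzn
  linarith

/-- A function with bounded subgradients is Lipschitz. -/
lemma subgrad_lipschitz {E : Type*} [NormedAddCommGroup E] [InnerProductSpace ℝ E]
    {g : E → ℝ} {s : E → E} {R : ℝ} (hR : ∀ z, ‖s z‖ ≤ R)
    (hs : ∀ z w, g z + inner ℝ (s z) (w - z) ≤ g w) : LipschitzWith R.toNNReal g := by
  have hR0 : 0 ≤ R := (norm_nonneg _).trans (hR 0)
  refine LipschitzWith.of_dist_le_mul fun x y => ?_
  have h1 := hs x y
  have h2 := hs y x
  have c1 := abs_le.1 (abs_real_inner_le_norm (s x) (y - x))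
  have c2 := abs_le.1 (abs_real_inner_le_norm (s y) (x - y))
  have d1 : ‖s x‖ * ‖y - x‖ ≤ R * ‖x - y‖ := by
    rw [norm_sub_rev]; gcongr; exact hR x
  have d2 : ‖s y‖ * ‖x - y‖ ≤ R * ‖x - y‖ := by
    gcongr; exact hR y
  rw [Real.dist_eq, dist_eq_norm, Real.coe_toNNReal _ hR0, abs_le]
  constructor <;> linarith [c1.1, c2.1]

open Topology MeasureTheory in
/-- Alexandrov, first form: a bounded subgradient selection is a.e. differentiable. -/
lemma subgrad_ae_diff {E : Type*} [NormedAddCommGroup E] [InnerProductSpace ℝ E]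
    [FiniteDimensional ℝ E] [MeasurableSpace E] [BorelSpace E]
    {g : E → ℝ} {s : E → E} {R : ℝ} (hR : ∀ z, ‖s z‖ ≤ R)
    (hs : ∀ z w, g z + inner ℝ (s z) (w - z) ≤ g w) :
    ∀ᵐ z ∂(μH[Module.finrank ℝ E] : Measure E), ∃ A : E →L[ℝ] E, HasFDerivAt s A z := by
  set μ : Measure E := μH[Module.finrank ℝ E] with hμ
  have hlip := subgrad_lipschitz hR hs
  have hdiff : ∀ᵐ z ∂μ, DifferentiableAt ℝ g z := hlip.ae_differentiableAt
  set X : E → E := fun z => z + s z with hX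
  have hexp : ∀ z w, ‖z - w‖ ≤ ‖X z - X w‖ := by
    intro z w
    have h1 := hs z w
    have h2 := hs w z
    have e1 : inner ℝ (s z) (w - z) = - inner ℝ (s z) (z - w) := by
      rw [← inner_neg_right, neg_sub]
    have h3 : 0 ≤ inner ℝ (s z - s w) (z - w) := by
      rw [inner_sub_left]; linarith
    have h4 : X z - X w = (z - w) + (s z - s w) := by simp only [hX]; abel
    have h5 : inner ℝ (X z - X w) (z - w) = ‖z - w‖ ^ 2 + inner ℝ (s z - s w) (z - w) := by
      rw [h4, inner_add_left, real_inner_self_eq_norm_sq]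
    have h6 := real_inner_le_norm (X z - X w) (z - w)
    by_contra hcon
    push Not at hcon
    have : 0 < ‖z - w‖ := (norm_nonneg _).trans_lt hcon
    nlinarith
  have hinj : Function.Injective X := by
    intro z w h
    have := hexp z w
    rw [h, sub_self, norm_zero] at this
    exact sub_eq_zero.1 (norm_le_zero_iff.1 this)
  set J : E → E := Function.invFun X with hJ
  have hJX : ∀ z, J (X z) = z := Function.leftInverse_invFun hinj
  set D : Set E := Set.range X with hD
  have hJlip : LipschitzOnWith 1 J D := by
    refine LipschitzOnWith.of_dist_le_mul ?_
    rintro _ ⟨z, rfl⟩ _ ⟨w, rfl⟩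
    rw [hJX, hJX, dist_eq_norm, dist_eq_norm]
    simpa using hexp z w
  have hnd := hJlip.ae_differentiableWithinAt_of_mem (μ := μ)
  set B1 : Set E := {x | ¬ (x ∈ D → DifferentiableWithinAt ℝ J D x)} with hB1
  have hB1z : μ B1 = 0 := hnd
  have hB1D : B1 ⊆ D := fun x hx => by
    by_contra h
    exact hx (fun h' => absurd h' h)
  have hB1i : μ (J '' B1) = 0 := by
    have := (hJlip.mono hB1D).hausdorffMeasure_image_le (d := Module.finrank ℝ E) (by positivity)
    rw [← hμ, hB1z, mul_zero] at this
    exact nonpos_iff_eq_zero.1 this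
  set B2 : Set E := {x | x ∈ D ∧ DifferentiableWithinAt ℝ J D x ∧ (fderivWithin ℝ J D x).det = 0}
    with hB2
  have hB2i : μ (J '' B2) = 0 := by
    refine addHaar_image_eq_zero_of_det_fderivWithin_eq_zero μ
      (f' := fun x => fderivWithin ℝ J D x) (fun x hx => ?_) (fun x hx => hx.2.2)
    exact (hx.2.1.hasFDerivWithinAt).mono (fun y hy => hy.1)
  have n1 : ∀ᵐ z ∂μ, z ∉ J '' B1 := measure_eq_zero_iff_ae_notMem.1 hB1i
  have n2 : ∀ᵐ z ∂μ, z ∉ J '' B2 := measure_eq_zero_iff_ae_notMem.1 hB2i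
  filter_upwards [hdiff, n1, n2] with z hz h1 h2
  have hXc : ContinuousAt X z := continuousAt_id.add (subgrad_continuousAt hs hz)
  have hmem : X z ∈ D := ⟨z, rfl⟩
  have hJd : DifferentiableWithinAt ℝ J D (X z) := by
    by_contra h
    exact h1 ⟨X z, fun h' => h (h' hmem), hJX z⟩
  have hdet : (fderivWithin ℝ J D (X z)).det ≠ 0 := by
    intro h
    exact h2 ⟨X z, ⟨hmem, hJd, h⟩, hJX z⟩
  set e : E ≃L[ℝ] E :=
    ContinuousLinearMap.toContinuousLinearEquivOfDetNeZero (fderivWithin ℝ J D (X z)) hdet with he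
  have hJ' : HasFDerivWithinAt J (e : E →L[ℝ] E) D (X z) := by
    rw [he, ContinuousLinearMap.coe_toContinuousLinearEquivOfDetNeZero]
    exact hJd.hasFDerivWithinAt
  have hX' : HasFDerivWithinAt X (e.symm : E →L[ℝ] E) Set.univ z := by
    refine HasFDerivWithinAt.of_local_left_inverse (f := J) (t := D) ?_ hJ' (Set.mem_univ _)
      (Filter.Eventually.of_forall fun w => hJX w)
    rw [nhdsWithin_univ]
    exact tendsto_nhdsWithin_iff.2 ⟨hXc, Filter.Eventually.of_forall fun w => ⟨w, rfl⟩⟩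
  rw [hasFDerivWithinAt_univ] at hX'
  refine ⟨(e.symm : E →L[ℝ] E) - ContinuousLinearMap.id ℝ E, ?_⟩
  have := hX'.sub (hasFDerivAt_id z)
  have hse : s = X - id := by
    funext w; simp [hX]
  rw [hse]
  exact this

open Topology in
/-- Second order expansion. -/
lemma subgrad_peano {E : Type*} [NormedAddCommGroup E] [InnerProductSpace ℝ E]
    {g : E → ℝ} {s : E → E} (hg : Continuous g)
    (hs : ∀ z w, g z + inner ℝ (s z) (w - z) ≤ g w) {z : E} {A : E →L[ℝ] E}
    (hA : HasFDerivAt s A z) {κ : ℝ} (hκ : 0 < κ) :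
    ∀ᶠ h in 𝓝 (0 : E), |g (z + h) - g z - inner ℝ (s z) h - inner ℝ (A h) h / 2| ≤ κ * ‖h‖ ^ 2 := by
  have h4 := (hasFDerivAt_iff_isLittleO_nhds_zero.1 hA).def (c := κ) hκ
  obtain ⟨r, hr, hball⟩ := Metric.eventually_nhds_iff.1 h4
  filter_upwards [Metric.ball_mem_nhds (0 : E) hr] with h hh
  rw [mem_ball_zero_iff] at hh
  have hin : ∀ t ∈ Set.Icc (0:ℝ) 1, |inner ℝ (s (z + t • h)) h - inner ℝ (s z) h -
      t * inner ℝ (A h) h| ≤ κ * t * ‖h‖ ^ 2 := by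
    intro t ht
    have hth : ‖t • h‖ ≤ ‖h‖ := by
      rw [norm_smul, Real.norm_eq_abs, abs_of_nonneg ht.1]
      exact mul_le_of_le_one_left (norm_nonneg _) ht.2
    have b := hball (y := t • h) (by rw [dist_zero_right]; linarith)
    have e : inner ℝ (s (z + t • h)) h - inner ℝ (s z) h - t * inner ℝ (A h) h
        = inner ℝ (s (z + t • h) - s z - A (t • h)) h := by
      rw [inner_sub_left, inner_sub_left, map_smul, inner_smul_left]; simp
    rw [e]
    refine (abs_real_inner_le_norm _ _).trans ?_
    rw [norm_smul, Real.norm_eq_abs, abs_of_nonneg ht.1] at b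
    calc _ ≤ (κ * (t * ‖h‖)) * ‖h‖ := by gcongr
      _ = _ := by ring
  have hline : Continuous (fun t : ℝ => g (z + t • h)) := by fun_prop
  have hsl : ∀ t t' : ℝ, t < t' → slope (fun t : ℝ => g (z + t • h)) t t' ≤
      inner ℝ (s (z + t' • h)) h ∧ inner ℝ (s (z + t • h)) h ≤
      slope (fun t : ℝ => g (z + t • h)) t t' := by
    intro t t' htt
    have p : 0 < t' - t := by linarith
    rw [slope_def_field]
    have a1 := hs (z + t • h) (z + t' • h)
    have a2 := hs (z + t' • h) (z + t • h)
    have e1 : z + t' • h - (z + t • h) = (t' - t) • h := by module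
    have e2 : z + t • h - (z + t' • h) = (-(t' - t)) • h := by module
    rw [e1, inner_smul_right] at a1
    rw [e2, inner_smul_right] at a2
    constructor
    · rw [div_le_iff₀ p]; linarith
    · rw [le_div_iff₀ p]; linarith
  have hslneg : ∀ t t' : ℝ, slope (fun t : ℝ => -g (z + t • h)) t t' =
      - slope (fun t : ℝ => g (z + t • h)) t t' := by
    intro t t'; rw [slope_def_field, slope_def_field]; ring
  have hpoly : ∀ a b c : ℝ, ∀ x : ℝ, HasDerivAt (fun t : ℝ => a + b * t + c * t ^ 2)
      (b + 2 * c * x) x := by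
    intro a b c x
    have := ((hasDerivAt_const x a).add ((hasDerivAt_id x).const_mul b)).add
      (((hasDerivAt_id x).pow 2).const_mul c)
    convert! this using 1
    simp; ring
  have up := image_le_of_liminf_slope_right_le_deriv_boundary (f := fun t : ℝ => g (z + t • h))
    (a := 0) (b := 1) hline.continuousOn
    (B := fun t => g z + inner ℝ (s z) h * t + (inner ℝ (A h) h / 2 + κ * ‖h‖ ^ 2 / 2) * t ^ 2)
    (B' := fun t => inner ℝ (s z) h + 2 * (inner ℝ (A h) h / 2 + κ * ‖h‖ ^ 2 / 2) * t)
    (by simp) (by fun_prop) (fun x _ => (hpoly _ _ _ x).hasDerivWithinAt) (by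
      intro x hx r hr
      apply Filter.Eventually.frequently
      have c1 : Filter.Tendsto (fun t => inner ℝ (s z) h +
          2 * (inner ℝ (A h) h / 2 + κ * ‖h‖ ^ 2 / 2) * t) (𝓝[>] x)
          (𝓝 (inner ℝ (s z) h + 2 * (inner ℝ (A h) h / 2 + κ * ‖h‖ ^ 2 / 2) * x)) := by
        refine Filter.Tendsto.mono_left (Continuous.tendsto (by fun_prop) x) nhdsWithin_le_nhds
      filter_upwards [c1.eventually (gt_mem_nhds hr), Ioo_mem_nhdsGT hx.2] with t ht ht2
      have k1 := (hsl x t ht2.1).1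
      have k2 := (abs_le.1 (hin t ⟨hx.1.trans ht2.1.le, ht2.2.le⟩)).2
      linarith)
  have lo := image_le_of_liminf_slope_right_le_deriv_boundary (f := fun t : ℝ => -g (z + t • h))
    (a := 0) (b := 1) hline.neg.continuousOn
    (B := fun t => -g z + (-inner ℝ (s z) h) * t +
      (-inner ℝ (A h) h / 2 + κ * ‖h‖ ^ 2 / 2) * t ^ 2)
    (B' := fun t => -inner ℝ (s z) h + 2 * (-inner ℝ (A h) h / 2 + κ * ‖h‖ ^ 2 / 2) * t)
    (by simp) (by fun_prop) (fun x _ => (hpoly _ _ _ x).hasDerivWithinAt) (by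
      intro x hx r hr
      apply Filter.Eventually.frequently
      filter_upwards [Ioo_mem_nhdsGT hx.2] with t ht2
      have k1 := (hsl x t ht2.1).2
      have k2 := (abs_le.1 (hin x ⟨hx.1, hx.2.le⟩)).1
      rw [hslneg]
      linarith)
  have u1 := up (x := 1) (by simp)
  have l1 := lo (x := 1) (by simp)
  simp only [one_smul] at u1 l1
  have hp : 0 ≤ κ * ‖h‖ ^ 2 := by positivity
  rw [abs_le]
  constructor <;> linarith

open Topology MeasureTheory in
/-- A form of Jensen's lemma. -/
lemma jensen_pert {E : Type*} [NormedAddCommGroup E] [InnerProductSpace ℝ E]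
    [FiniteDimensional ℝ E] [MeasurableSpace E] [BorelSpace E]
    {g : E → ℝ} {s : E → E}
    (hs : ∀ z w, g z + inner ℝ (s z) (w - z) ≤ g w)
    {S : E → ℝ} (hS : ContDiff ℝ 2 S) {R δ : ℝ} (hR : 0 < R) (hδ : 0 < δ)
    (hZ : ∀ p : E, ‖p‖ < δ → ∃ z ∈ Metric.closedBall (0 : E) R,
      ∀ w ∈ Metric.closedBall (0 : E) (6 * R),
        g w - S w - inner ℝ p w ≤ g z - S z - inner ℝ p z)
    {N : Set E} (hN : (μH[Module.finrank ℝ E] : Measure E) N = 0) :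
    ∃ p z : E, ‖p‖ < δ ∧ z ∉ N ∧ z ∈ Metric.closedBall (0 : E) R ∧
      (∀ w ∈ Metric.closedBall (0 : E) (6 * R),
        g w - S w - inner ℝ p w ≤ g z - S z - inner ℝ p z) ∧
      (∀ h, inner ℝ (s z) h = fderiv ℝ S z h + inner ℝ p h) := by
  have hSd : Differentiable ℝ S := hS.differentiable (by norm_num)
  have hgradI : ∀ z h, inner ℝ (gradient S z) h = fderiv ℝ S z h := by
    intro z h
    simp [gradient]
  -- Lipschitz gradient
  have hS1 : ContDiff ℝ 1 (fderiv ℝ S) := hS.fderiv_right (by norm_num)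
  obtain ⟨L, hL⟩ := LocallyLipschitzOn.exists_lipschitzOnWith_of_compact
    (isCompact_closedBall (0 : E) (6 * R)) (hS1.locallyLipschitz.locallyLipschitzOn)
  have hL' : ∀ x ∈ Metric.closedBall (0 : E) (6 * R), ∀ y ∈ Metric.closedBall (0 : E) (6 * R),
      ‖fderiv ℝ S x - fderiv ℝ S y‖ ≤ L * ‖x - y‖ := by
    intro x hx y hy
    have := hL.dist_le_mul x hx y hy
    rwa [dist_eq_norm, dist_eq_norm] at this
  have hsub : Metric.closedBall (0 : E) R ⊆ Metric.closedBall (0 : E) (6 * R) :=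
    Metric.closedBall_subset_closedBall (by linarith)
  -- first-order condition
  have hfirst : ∀ p z, z ∈ Metric.closedBall (0 : E) R →
      (∀ w ∈ Metric.closedBall (0 : E) (6 * R),
        g w - S w - inner ℝ p w ≤ g z - S z - inner ℝ p z) →
      (∀ h, inner ℝ (s z) h = fderiv ℝ S z h + inner ℝ p h) := by
    intro p z hz hmax
    have hnh : Metric.closedBall (0 : E) (6 * R) ∈ 𝓝 z := by
      refine Filter.mem_of_superset (Metric.ball_mem_nhds z hR) ?_
      intro w hw
      rw [mem_closedBall_zero_iff] at hz ⊢
      rw [mem_ball_iff_norm] at hw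
      have : ‖w‖ ≤ ‖w - z‖ + ‖z‖ := by simpa using norm_add_le (w - z) z
      linarith
    have hmin : IsLocalMin (fun w => S w + inner ℝ p w - inner ℝ (s z) w) z := by
      filter_upwards [hnh] with w hw
      have h1 := hmax w hw
      have h2 := hs z w
      rw [inner_sub_right] at h2
      linarith
    have h2 : HasFDerivAt (fun w => S w + inner ℝ p w - inner ℝ (s z) w)
        (fderiv ℝ S z + innerSL ℝ p - innerSL ℝ (s z)) z :=
      ((hSd z).hasFDerivAt.add (innerSL ℝ p).hasFDerivAt).sub (innerSL ℝ (s z)).hasFDerivAt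
    have h3 := hmin.hasFDerivAt_eq_zero h2
    intro h
    have := congrArg (fun l => l h) h3
    simp at this
    linarith
  set Z : Set E := {z | z ∈ Metric.closedBall (0 : E) R ∧ ∃ p, ‖p‖ < δ ∧
      ∀ w ∈ Metric.closedBall (0 : E) (6 * R),
        g w - S w - inner ℝ p w ≤ g z - S z - inner ℝ p z} with hZdef
  have hquad : ∀ z ∈ Z, ∀ w ∈ Metric.closedBall (0 : E) (6 * R),
      g w - g z ≤ inner ℝ (s z) (w - z) + L * ‖w - z‖ ^ 2 := by
    rintro z ⟨hz, p, hp, hmax⟩ w hw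
    have h1 := hmax w hw
    have h2 := hfirst p z hz hmax (w - z)
    have h3 : ‖S w - S z - fderiv ℝ S z (w - z)‖ ≤ (L * ‖w - z‖) * ‖w - z‖ := by
      refine Convex.norm_image_sub_le_of_norm_hasFDerivWithin_le' (s := segment ℝ z w)
        (f' := fun x => fderiv ℝ S x) (fun x _ => (hSd x).hasFDerivAt.hasFDerivWithinAt) ?_
        (convex_segment z w) (left_mem_segment ℝ z w) (right_mem_segment ℝ z w)
      intro x hx
      have hxb : x ∈ Metric.closedBall (0 : E) (6 * R) :=
        (convex_closedBall (0 : E) (6 * R)).segment_subset (hsub hz) hw hx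
      refine (hL' x hxb z (hsub hz)).trans ?_
      gcongr
      have := norm_sub_le_of_mem_segment hx
      rwa [norm_sub_rev w z, norm_sub_rev x z] at *
    rw [Real.norm_eq_abs] at h3
    have h4 := (abs_le.1 h3).2
    rw [inner_sub_right p] at h2
    rw [h2]
    nlinarith
  have hsLip : ∀ z ∈ Z, ∀ z' ∈ Z, ‖s z' - s z‖ ≤ 4 * L * ‖z' - z‖ := by
    intro z hz z' hz'
    by_cases hne : s z' - s z = 0
    · rw [hne, norm_zero]; positivity
    by_cases hzz : z' = z
    · subst hzz; simp
    have hn : 0 < ‖s z' - s z‖ := norm_pos_iff.2 hne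
    have hzn : 0 < ‖z' - z‖ := norm_pos_iff.2 (sub_ne_zero.2 hzz)
    set v : E := (‖z' - z‖ / ‖s z' - s z‖) • (s z' - s z) with hv
    have hvn : ‖v‖ = ‖z' - z‖ := by
      rw [hv, norm_smul, norm_div, norm_norm, norm_norm]; field_simp
    have hvi : inner ℝ (s z' - s z) v = ‖z' - z‖ * ‖s z' - s z‖ := by
      rw [hv, inner_smul_right, real_inner_self_eq_norm_sq]; field_simp
    have hz1 := mem_closedBall_zero_iff.1 hz.1
    have hz2 := mem_closedBall_zero_iff.1 hz'.1
    have hzd : ‖z' - z‖ ≤ 2 * R := (norm_sub_le _ _).trans (by linarith)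
    have hw : z' + v ∈ Metric.closedBall (0 : E) (6 * R) := by
      rw [mem_closedBall_zero_iff]
      refine (norm_add_le _ _).trans ?_
      rw [hvn]; linarith
    have q1 := hquad z hz (z' + v) hw
    have q2 := hs z' (z' + v)
    have q3 := hs z z'
    rw [add_sub_cancel_left] at q2
    have e : z' + v - z = (z' - z) + v := by abel
    rw [e, inner_add_right] at q1
    have hle : ‖z' - z + v‖ ≤ 2 * ‖z' - z‖ := by
      calc _ ≤ ‖z' - z‖ + ‖v‖ := norm_add_le _ _
        _ = _ := by rw [hvn]; ring
    have hle2 : (L : ℝ) * ‖z' - z + v‖ ^ 2 ≤ L * (2 * ‖z' - z‖) ^ 2 := by gcongr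
    rw [inner_sub_left] at hvi
    have : ‖z' - z‖ * ‖s z' - s z‖ ≤ ‖z' - z‖ * (4 * L * ‖z' - z‖) := by nlinarith
    exact le_of_mul_le_mul_left this hzn
  set G : E → E := fun z => s z - gradient S z with hG
  have hGLip : LipschitzOnWith (5 * L) G Z := by
    refine LipschitzOnWith.of_dist_le_mul ?_
    intro z hz z' hz'
    rw [dist_eq_norm, dist_eq_norm]
    have e : G z - G z' = (s z - s z') - (gradient S z - gradient S z') := by
      simp only [hG]; abel
    have e2 : ‖gradient S z - gradient S z'‖ ≤ L * ‖z - z'‖ := by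
      have : gradient S z - gradient S z' =
        (InnerProductSpace.toDual ℝ E).symm (fderiv ℝ S z - fderiv ℝ S z') := by
        simp [gradient]
      rw [this, LinearIsometryEquiv.norm_map]
      exact hL' z (hsub hz.1) z' (hsub hz'.1)
    rw [e]
    refine (norm_sub_le _ _).trans ?_
    have := hsLip z' hz' z hz
    push_cast
    linarith
  by_contra hcon
  have hZN : Z ⊆ N := by
    rintro z ⟨hz, p, hp, hmax⟩
    by_contra hzN
    exact hcon ⟨p, z, hp, hzN, hz, hmax, hfirst p z hz hmax⟩
  have hZ0 : (μH[Module.finrank ℝ E] : Measure E) Z = 0 := measure_mono_null hZN hN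
  have hGZ : (μH[Module.finrank ℝ E] : Measure E) (G '' Z) = 0 := by
    have := hGLip.hausdorffMeasure_image_le (d := Module.finrank ℝ E) (by positivity)
    rw [hZ0, mul_zero] at this
    exact nonpos_iff_eq_zero.1 this
  have hball : Metric.ball (0 : E) δ ⊆ G '' Z := by
    intro p hp
    rw [mem_ball_zero_iff] at hp
    obtain ⟨z, hz, hmax⟩ := hZ p hp
    refine ⟨z, ⟨hz, p, hp, hmax⟩, ?_⟩
    refine ext_inner_right ℝ fun h => ?_
    simp only [hG]
    rw [inner_sub_left, hgradI, hfirst p z hz hmax h]; ring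
  have := Metric.measure_ball_pos (μH[Module.finrank ℝ E] : Measure E) (0 : E) hδ
  exact this.ne' (measure_mono_null hball hGZ)

open Topology in
/-- Penalization: for large penalization parameter, near-maximizers live in `U`. -/
lemma penal_compact {ι : Type*} [Fintype ι] [Nonempty ι] {E : Type*} [NormedAddCommGroup E]
    {K U B : Set E} (hK : IsCompact K) (hB : IsCompact B) (hU : IsOpen U)
    (f : ι → E → ℝ) (hf : ∀ i, UpperSemicontinuousOn (f i) K) {φ : E → ℝ} (hφ : Continuous φ)
    {c : ℝ} (hc : 0 < c) (hbd : ∀ z ∈ K, z ∉ U → ∑ i, f i z - φ z ≤ 0) :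
    ∃ Λ : ℝ, 0 < Λ ∧ ∀ z ∈ B, ∀ y : ι → E, (∀ i, y i ∈ K) →
      c ≤ ∑ i, f i (y i) - φ z - Λ / 2 * ∑ i, ‖z - y i‖ ^ 2 → z ∈ U ∧ ∀ i, y i ∈ U := by
  set P : Set (E × (ι → E)) := B ×ˢ Set.univ.pi (fun _ => K) with hP
  have hPc : IsCompact P := hB.prod (isCompact_univ_pi fun _ => hK)
  set Θ : E × (ι → E) → ℝ := fun x => ∑ i, f i (x.2 i) + (-φ x.1) with hΘ
  have husc : UpperSemicontinuousOn Θ P := by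
    refine UpperSemicontinuousOn.add ?_ ?_
    · refine upperSemicontinuousOn_sum fun i _ => ?_
      refine UpperSemicontinuousOn.comp (hf i) (g := fun x : E × (ι → E) => x.2 i) ?_ ?_
      · exact Continuous.continuousOn (by fun_prop)
      · intro x hx
        exact hx.2 i (Set.mem_univ i)
    · exact (Continuous.continuousOn (by fun_prop)).upperSemicontinuousOn
  have hC0 := husc.isCompact_inter_preimage_Ici hPc c
  have hVo : IsOpen {x : E × (ι → E) | x.1 ∈ U ∧ ∀ i, x.2 i ∈ U} := by
    have : {x : E × (ι → E) | x.1 ∈ U ∧ ∀ i, x.2 i ∈ U} =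
        (Prod.fst ⁻¹' U) ∩ ⋂ i, (fun x : E × (ι → E) => x.2 i) ⁻¹' U := by
      ext x; simp
    rw [this]
    exact (hU.preimage continuous_fst).inter
      (isOpen_iInter_of_finite fun i => hU.preimage (by fun_prop))
  have hC := hC0.inter_right hVo.isClosed_compl
  obtain ⟨M, hM⟩ := husc.bddAbove_of_isCompact hPc
  have hM' : ∀ x ∈ P, Θ x ≤ M := fun x hx => hM ⟨x, hx, rfl⟩
  by_cases hne : (P ∩ Θ ⁻¹' Set.Ici c ∩ {x : E × (ι → E) | x.1 ∈ U ∧ ∀ i, x.2 i ∈ U}ᶜ).Nonempty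
  · obtain ⟨x, hx, hmin⟩ := hC.exists_isMinOn hne
      (f := fun x : E × (ι → E) => ∑ i, ‖x.1 - x.2 i‖ ^ 2)
      (Continuous.continuousOn (by fun_prop))
    have hpos : 0 < ∑ i, ‖x.1 - x.2 i‖ ^ 2 := by
      have hnn : 0 ≤ ∑ i, ‖x.1 - x.2 i‖ ^ 2 := Finset.sum_nonneg fun i _ => by positivity
      refine lt_of_le_of_ne hnn fun h0 => ?_
      have h1 := (Finset.sum_eq_zero_iff_of_nonneg (fun i _ => by positivity)).1 h0.symm
      have h2 : ∀ i, x.2 i = x.1 := by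
        intro i
        have := h1 i (Finset.mem_univ i)
        have := pow_eq_zero_iff (two_ne_zero) |>.1 this
        exact (sub_eq_zero.1 (norm_eq_zero.1 this)).symm
      have hxU : x.1 ∉ U := by
        intro h
        refine hx.2 ⟨h, fun i => ?_⟩
        rw [h2 i]; exact h
      obtain ⟨i0⟩ := ‹Nonempty ι›
      have hxK : x.1 ∈ K := by
        rw [← h2 i0]; exact hx.1.1.2 i0 (Set.mem_univ _)
      have h3 := hbd x.1 hxK hxU
      have h4 : c ≤ Θ x := hx.1.2
      simp only [hΘ, h2] at h4
      linarith
    set d := ∑ i, ‖x.1 - x.2 i‖ ^ 2 with hd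
    refine ⟨2 * (|M| + 1) / d, by positivity, ?_⟩
    intro z hz y hy hcy
    have hnn : 0 ≤ ∑ i, ‖z - y i‖ ^ 2 := Finset.sum_nonneg fun i _ => by positivity
    by_contra hcon
    have hmemP : (z, y) ∈ P := ⟨hz, fun i _ => hy i⟩
    have hT : Θ (z, y) = ∑ i, f i (y i) - φ z := by simp only [hΘ]; ring
    have hL : 0 ≤ 2 * (|M| + 1) / d / 2 * ∑ i, ‖z - y i‖ ^ 2 := by positivity
    have hge : d ≤ ∑ i, ‖z - y i‖ ^ 2 := by
      refine hmin (a := (z, y)) ⟨⟨hmemP, ?_⟩, hcon⟩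
      change c ≤ Θ (z, y)
      rw [hT]; linarith
    have h5 := hM' _ hmemP
    rw [hT] at h5
    have h6 : 2 * (|M| + 1) / d / 2 * d ≤ 2 * (|M| + 1) / d / 2 * ∑ i, ‖z - y i‖ ^ 2 := by
      gcongr
    have h7 : 2 * (|M| + 1) / d / 2 * d = |M| + 1 := by field_simp
    have := le_abs_self M
    linarith
  · refine ⟨1, one_pos, ?_⟩
    intro z hz y hy hcy
    have hnn : 0 ≤ ∑ i, ‖z - y i‖ ^ 2 := Finset.sum_nonneg fun i _ => by positivity
    by_contra hcon
    refine hne ⟨(z, y), ⟨⟨hz, fun i _ => hy i⟩, ?_⟩, hcon⟩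
    change c ≤ ∑ i, f i (y i) + (-φ z)
    linarith

open Topology MeasureTheory in
/-- A theorem on sums for a finite family of upper semicontinuous functions of one variable. -/
lemma theorem_on_sums {ι : Type*} [Fintype ι] [Nonempty ι] {E : Type*} [NormedAddCommGroup E]
    [InnerProductSpace ℝ E] [FiniteDimensional ℝ E]
    {K U : Set E} (hK : IsCompact K) (hU : IsOpen U) (hUK : U ⊆ K)
    (f : ι → E → ℝ) (hf : ∀ i, UpperSemicontinuousOn (f i) K) {φ : E → ℝ} (hφ : ContDiff ℝ 2 φ)
    {z0 : E} (hz0 : z0 ∈ K) (hpos : 0 < ∑ i, f i z0 - φ z0)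
    (hbd : ∀ z ∈ K, z ∉ U → ∑ i, f i z - φ z ≤ 0) {η : ℝ} (hη : 0 < η) :
    ∃ z ∈ U, ∃ (y p : ι → E) (A : ι → E →L[ℝ] E), (∀ i, y i ∈ U) ∧
      (∀ i, ∀ᶠ h in 𝓝 (0 : E),
        f i (y i + h) ≤ f i (y i) + inner ℝ (p i) h + inner ℝ (A i h) h / 2) ∧
      (∀ h, |∑ i, inner ℝ (p i) h - fderiv ℝ φ z h| ≤ η * ‖h‖) ∧
      (∀ (h : E) (b : ℝ),
        (∀ᶠ t in 𝓝 (0 : ℝ), φ (z + t • h) ≤ φ z + t * fderiv ℝ φ z h + b * t ^ 2) →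
        ∑ i, inner ℝ (A i h) h / 2 ≤ b + η * ‖h‖ ^ 2) := by
  let _ : MeasurableSpace E := borel E
  have : BorelSpace E := ⟨rfl⟩
  obtain ⟨R, hR, hKR⟩ : ∃ R : ℝ, 0 < R ∧ K ⊆ Metric.closedBall (0 : E) R := by
    obtain ⟨R, hR⟩ := hK.isBounded.subset_closedBall (0 : E)
    exact ⟨max R 1, by positivity, hR.trans (Metric.closedBall_subset_closedBall (le_max_left _ _))⟩
  set c : ℝ := (∑ i, f i z0 - φ z0) / 2 with hc
  have hcpos : 0 < c := by positivity
  obtain ⟨l, hl, hpen⟩ := penal_compact hK (isCompact_closedBall (0 : E) (6 * R)) hU f hf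
    hφ.continuous hcpos hbd
  -- sup-convolution
  have hex : ∀ i z, ∃ y ∈ K, ∀ y' ∈ K,
      f i y' - l / 2 * ‖z - y'‖ ^ 2 ≤ f i y - l / 2 * ‖z - y‖ ^ 2 := by
    intro i z
    have hu : UpperSemicontinuousOn (fun y' => f i y' + -(l / 2 * ‖z - y'‖ ^ 2)) K :=
      (hf i).add (Continuous.continuousOn (by fun_prop)).upperSemicontinuousOn
    obtain ⟨y, hy, hmax⟩ := hu.exists_isMaxOn ⟨z0, hz0⟩ hK
    refine ⟨y, hy, fun y' hy' => ?_⟩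
    have : f i y' + -(l / 2 * ‖z - y'‖ ^ 2) ≤ f i y + -(l / 2 * ‖z - y‖ ^ 2) := hmax hy'
    linarith
  choose Y hYK hYmax using hex
  set m : ι → E → ℝ := fun i z => f i (Y i z) - l / 2 * ‖z - Y i z‖ ^ 2 with hm
  set g : ι → E → ℝ := fun i z => m i z + l / 2 * ‖z‖ ^ 2 with hg
  set s : ι → E → E := fun i z => l • Y i z with hs
  have hsub : ∀ i z w, g i z + inner ℝ (s i z) (w - z) ≤ g i w := by
    intro i z w
    have h1 := hYmax i w (Y i z) (hYK i z)
    simp only [hg, hm, hs]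
    have e1 := norm_sub_sq_real w (Y i z)
    have e2 := norm_sub_sq_real z (Y i z)
    rw [e1] at h1
    rw [e2, inner_smul_left, inner_sub_right, real_inner_comm w (Y i z),
      real_inner_comm z (Y i z)]
    simp only [conj_trivial]
    nlinarith
  have hsb : ∀ i z, ‖s i z‖ ≤ l * R := by
    intro i z
    simp only [hs]
    rw [norm_smul, Real.norm_eq_abs, abs_of_pos hl]
    gcongr
    exact mem_closedBall_zero_iff.1 (hKR (hYK i z))
  have hgc : ∀ i, Continuous (g i) := fun i => (subgrad_lipschitz (hsb i) (hsub i)).continuous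
  have hae : ∀ᵐ z ∂(μH[Module.finrank ℝ E] : Measure E),
      ∀ i, ∃ A : E →L[ℝ] E, HasFDerivAt (s i) A z :=
    ae_all_iff.2 fun i => subgrad_ae_diff (hsb i) (hsub i)
  set n : ℝ := (Fintype.card ι : ℝ) with hn
  have hnpos : 0 < n := by rw [hn]; exact_mod_cast Fintype.card_pos
  set S : E → ℝ := fun w => φ w + n * (l / 2) * ‖w‖ ^ 2 with hS
  have hSc : ContDiff ℝ 2 S := hφ.add (contDiff_const.mul (contDiff_norm_sq ℝ))
  set gg : E → ℝ := fun z => ∑ i, g i z with hgg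
  set ss : E → E := fun z => ∑ i, s i z with hss
  have hsubs : ∀ z w, gg z + inner ℝ (ss z) (w - z) ≤ gg w := by
    intro z w
    simp only [hgg, hss]
    rw [sum_inner, ← Finset.sum_add_distrib]
    exact Finset.sum_le_sum fun i _ => hsub i z w
  have hWeq : ∀ w, gg w - S w = ∑ i, m i w - φ w := by
    intro w
    simp only [hgg, hS, hg, Finset.sum_add_distrib, Finset.sum_const, Finset.card_univ,
      nsmul_eq_mul, ← hn]
    ring
  set δ : ℝ := min η (c / (12 * R)) with hδdef
  have hδ : 0 < δ := lt_min hη (by positivity)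
  have hmU : ∀ z ∈ Metric.closedBall (0 : E) (6 * R), c ≤ ∑ i, m i z - φ z →
      z ∈ U ∧ ∀ i, Y i z ∈ U := by
    intro z hz hcz
    refine hpen z hz (fun i => Y i z) (fun i => hYK i z) ?_
    simp only [hm, Finset.sum_sub_distrib, ← Finset.mul_sum] at hcz
    linarith
  have hz0R : ‖z0‖ ≤ R := mem_closedBall_zero_iff.1 (hKR hz0)
  have hz0m : 2 * c ≤ ∑ i, m i z0 - φ z0 := by
    have : ∑ i, f i z0 ≤ ∑ i, m i z0 := by
      refine Finset.sum_le_sum fun i _ => ?_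
      have := hYmax i z0 z0 hz0
      simpa [hm] using this
    rw [hc]; linarith
  -- perturbed maxima are in `U`
  have hinU : ∀ p z : E, ‖p‖ < δ → z ∈ Metric.closedBall (0 : E) (6 * R) →
      (∀ w ∈ Metric.closedBall (0 : E) (6 * R),
        gg w - S w - inner ℝ p w ≤ gg z - S z - inner ℝ p z) → z ∈ U ∧ ∀ i, Y i z ∈ U := by
    intro p z hp hz hmax
    refine hmU z hz ?_
    have h1 := hmax z0 (mem_closedBall_zero_iff.2 (by linarith))
    rw [hWeq, hWeq] at h1
    have h2 : |inner ℝ p (z - z0)| ≤ c := by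
      refine (abs_real_inner_le_norm _ _).trans ?_
      have : ‖z - z0‖ ≤ 12 * R := by
        refine (norm_sub_le _ _).trans ?_
        have := mem_closedBall_zero_iff.1 hz
        linarith
      calc ‖p‖ * ‖z - z0‖ ≤ (c / (12 * R)) * (12 * R) := by
            gcongr
            exact hp.le.trans (min_le_right _ _)
        _ = c := by field_simp
    rw [inner_sub_right] at h2
    have := (abs_le.1 h2).1
    linarith
  have hZ : ∀ p : E, ‖p‖ < δ → ∃ z ∈ Metric.closedBall (0 : E) R,
      ∀ w ∈ Metric.closedBall (0 : E) (6 * R),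
        gg w - S w - inner ℝ p w ≤ gg z - S z - inner ℝ p z := by
    intro p hp
    have hcont : Continuous (fun w => gg w - S w - inner ℝ p w) := by
      have h1 : Continuous gg := continuous_finsetSum _ fun i _ => hgc i
      have h2 : Continuous S := hSc.continuous
      fun_prop
    obtain ⟨z, hz, hmax⟩ := (isCompact_closedBall (0 : E) (6 * R)).exists_isMaxOn
      ⟨0, by simp; positivity⟩ hcont.continuousOn
    refine ⟨z, ?_, fun w hw => hmax hw⟩
    exact hKR (hUK (hinU p z hp hz fun w hw => hmax hw).1)
  obtain ⟨p, z, hp, hzN, hzR, hmax, hfirst⟩ := jensen_pert hsubs hSc hR hδ hZ hae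
  have hzR6 : z ∈ Metric.closedBall (0 : E) (6 * R) :=
    Metric.closedBall_subset_closedBall (by linarith) hzR
  obtain ⟨hzU, hYU⟩ := hinU p z hp hzR6 hmax
  have hzN' : ∀ i, ∃ A : E →L[ℝ] E, HasFDerivAt (s i) A z := by
    by_contra h
    exact hzN h
  choose A hA using hzN'
  set κ : ℝ := η / (2 * n) with hκ
  have hκpos : 0 < κ := by positivity
  have hpe : ∀ i, ∀ᶠ h in 𝓝 (0 : E), |g i (z + h) - g i z - inner ℝ (s i z) h -
      inner ℝ (A i h) h / 2| ≤ κ * ‖h‖ ^ 2 := fun i =>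
    subgrad_peano (hgc i) (hsub i) (hA i) hκpos
  have hfdS : ∀ h, fderiv ℝ S z h = fderiv ℝ φ z h + n * l * inner ℝ z h := by
    intro h
    have h1 : HasFDerivAt φ (fderiv ℝ φ z) z := (hφ.differentiable (by norm_num) z).hasFDerivAt
    have h2 := h1.add (((hasStrictFDerivAt_norm_sq z).hasFDerivAt).const_mul (n * (l / 2)))
    have h3 : HasFDerivAt S _ z := h2
    rw [h3.fderiv]
    simp
    ring
  have hnorm : ∀ (t : ℝ) (h : E), ‖z + t • h‖ ^ 2 = ‖z‖ ^ 2 + 2 * (t * inner ℝ z h) +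
      t ^ 2 * ‖h‖ ^ 2 := by
    intro t h
    rw [norm_add_sq_real, inner_smul_right, norm_smul, mul_pow, Real.norm_eq_abs, sq_abs]
  refine ⟨z, hzU, fun i => Y i z, fun i => s i z - l • z,
    fun i => A i + (2 * κ - l) • ContinuousLinearMap.id ℝ E, hYU, ?_, ?_, ?_⟩
  · intro i
    have hnh : ∀ᶠ h in 𝓝 (0 : E), Y i z + h ∈ U := by
      have : Tendsto (fun h => Y i z + h) (𝓝 (0 : E)) (𝓝 (Y i z)) :=
        Continuous.tendsto' (by fun_prop) _ _ (by simp)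
      exact this.eventually (hU.mem_nhds (hYU i))
    filter_upwards [hpe i, hnh] with h h1 h2
    have h3 := hYmax i (z + h) (Y i z + h) (hUK h2)
    have e : z + h - (Y i z + h) = z - Y i z := by abel
    rw [e] at h3
    have h4 : f i (Y i (z + h)) - l / 2 * ‖z + h - Y i (z + h)‖ ^ 2
        = g i (z + h) - l / 2 * ‖z + h‖ ^ 2 := by simp only [hg, hm]; ring
    have h5 : g i z = f i (Y i z) - l / 2 * ‖z - Y i z‖ ^ 2 + l / 2 * ‖z‖ ^ 2 := rfl
    have h6 := (abs_le.1 h1).2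
    have h7 := hnorm 1 h
    rw [one_smul] at h7
    rw [h4, h7] at h3
    simp only [add_apply, smul_apply,
      ContinuousLinearMap.id_apply, inner_add_left, inner_sub_left, inner_smul_left,
      conj_trivial, real_inner_self_eq_norm_sq]
    nlinarith
  · intro h
    have h1 := hfirst h
    rw [hfdS] at h1
    simp only [hss] at h1
    have e : ∑ i, inner ℝ (s i z - l • z) h - fderiv ℝ φ z h = inner ℝ p h := by
      simp only [inner_sub_left, Finset.sum_sub_distrib, inner_smul_left, conj_trivial,
        Finset.sum_const, Finset.card_univ, nsmul_eq_mul, ← hn]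
      rw [sum_inner] at h1
      linarith
    rw [e]
    refine (abs_real_inner_le_norm _ _).trans ?_
    gcongr
    exact hp.le.trans (min_le_left _ _)
  · intro h b hb
    have hline : Tendsto (fun t : ℝ => t • h) (𝓝 0) (𝓝 (0 : E)) :=
      Continuous.tendsto' (by fun_prop) _ _ (by simp)
    have hall : ∀ᶠ t in 𝓝 (0 : ℝ), ∀ i, |g i (z + t • h) - g i z - inner ℝ (s i z) (t • h) -
      inner ℝ (A i (t • h)) (t • h) / 2| ≤ κ * ‖t • h‖ ^ 2 :=
      eventually_all.2 fun i => hline.eventually (hpe i)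
    have hzb : ∀ᶠ t in 𝓝 (0 : ℝ), z + t • h ∈ U := by
      have : Tendsto (fun t : ℝ => z + t • h) (𝓝 0) (𝓝 z) :=
        Continuous.tendsto' (by fun_prop) _ _ (by simp)
      exact this.eventually (hU.mem_nhds hzU)
    have hgt : ∃ᶠ t in 𝓝 (0 : ℝ), t ≠ 0 :=
      Filter.frequently_iff_forall_eventually_exists_and.2 fun {q} hq => by
        have := (hq.filter_mono (nhdsWithin_le_nhds (s := {0}ᶜ))).and self_mem_nhdsWithin
        obtain ⟨t, h1, h2⟩ := this.exists
        exact ⟨t, h2, h1⟩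
    obtain ⟨t, ht0, ht1, ht2, ht3⟩ := (hgt.and_eventually (hall.and (hzb.and hb))).exists
    have hball : z + t • h ∈ Metric.closedBall (0 : E) (6 * R) :=
      Metric.closedBall_subset_closedBall (by linarith) (hKR (hUK ht2))
    have k1 := hmax _ hball
    have k2 := hfirst h
    rw [hfdS] at k2
    have ht2pos : 0 < t ^ 2 := by positivity
    have k3 : ∑ i, (g i z + t * inner ℝ (s i z) h + t ^ 2 * (inner ℝ (A i h) h / 2)
        - κ * (t ^ 2 * ‖h‖ ^ 2)) ≤ gg (z + t • h) := by
      refine Finset.sum_le_sum fun i _ => ?_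
      have := (abs_le.1 (ht1 i)).1
      have e1 : inner ℝ (A i (t • h)) (t • h) = t ^ 2 * inner ℝ (A i h) h := by
        rw [map_smul, inner_smul_right, real_inner_smul_left]; ring
      have e2 : inner ℝ (s i z) (t • h) = t * inner ℝ (s i z) h := inner_smul_right _ _ _
      have e3 : ‖t • h‖ ^ 2 = t ^ 2 * ‖h‖ ^ 2 := by
        rw [norm_smul, mul_pow, Real.norm_eq_abs, sq_abs]
      rw [e1, e2, e3] at this
      linarith
    simp only [Finset.sum_add_distrib, Finset.sum_sub_distrib, ← Finset.mul_sum,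
      Finset.sum_const, Finset.card_univ, nsmul_eq_mul, ← hn] at k3
    have k4 : S (z + t • h) = φ (z + t • h) + n * (l / 2) * (‖z‖ ^ 2 + 2 * (t * inner ℝ z h) +
      t ^ 2 * ‖h‖ ^ 2) := by simp only [hS, hnorm]
    have k5 : S z = φ z + n * (l / 2) * ‖z‖ ^ 2 := rfl
    rw [k4, k5, inner_add_right, inner_smul_right] at k1
    simp only [hss] at k2
    rw [sum_inner] at k2
    have k6 : gg z = ∑ i, g i z := rfl
    rw [k6] at k1
    have k7 : n * κ = η / 2 := by rw [hκ]; field_simp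
    set Q := ∑ i, inner ℝ (A i h) h / 2 with hQ
    set q := ∑ i, inner ℝ (s i z) h with hq
    have k8 : t ^ 2 * (Q - n * (l / 2) * ‖h‖ ^ 2 - b - n * κ * ‖h‖ ^ 2) ≤ t ^ 2 * 0 := by
      have k11 : t * q = t * (fderiv ℝ φ z h + n * l * inner ℝ z h + inner ℝ p h) := by rw [k2]
      clear_value Q q
      clear hall hzb hgt hline ht1 hb k2 hfirst hmax hpen hpe
      linarith
    have k9 := le_of_mul_le_mul_left k8 ht2pos
    have k10 : ∑ i, inner ℝ ((A i + (2 * κ - l) • ContinuousLinearMap.id ℝ E) h) h / 2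
        = Q + n * ((2 * κ - l) / 2 * ‖h‖ ^ 2) := by
      simp only [add_apply, smul_apply,
        ContinuousLinearMap.id_apply, inner_add_left, inner_smul_left,
        conj_trivial, real_inner_self_eq_norm_sq, add_div, Finset.sum_add_distrib,
        Finset.sum_const, Finset.card_univ, nsmul_eq_mul, ← hn, hQ]
      ring
    rw [k10]
    have k12 : n * κ * ‖h‖ ^ 2 = η / 2 * ‖h‖ ^ 2 := by rw [k7]
    clear_value Q q
    linarith

/-- Space-time with its Euclidean structure. -/
abbrev STE (N : ℕ) := WithLp 2 (ℝ × Euc N)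

/-- Inclusion of the space directions. -/
def stJ (N : ℕ) : Euc N →L[ℝ] STE N :=
  ((WithLp.prodContinuousLinearEquiv 2 ℝ ℝ (Euc N)).symm : (ℝ × Euc N) →L[ℝ] STE N) ∘L
    ContinuousLinearMap.inr ℝ ℝ (Euc N)

lemma stJ_apply {N : ℕ} (x : Euc N) : stJ N x = WithLp.toLp 2 ((0 : ℝ), x) := rfl

/-- Symmetrized spatial block of an operator on space-time. -/
def stMat {N : ℕ} (A : STE N →L[ℝ] STE N) : Matrix (Fin N) (Fin N) ℝ := fun i j =>
  (inner ℝ (A (stJ N (EuclideanSpace.single i 1))) (stJ N (EuclideanSpace.single j 1)) +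
    inner ℝ (A (stJ N (EuclideanSpace.single j 1))) (stJ N (EuclideanSpace.single i 1))) / 2

lemma quad_hasFDerivAt {E : Type*} [NormedAddCommGroup E] [NormedSpace ℝ E]
    (L : E →L[ℝ] ℝ) (B : E →L[ℝ] E →L[ℝ] ℝ) (x z : E) :
    HasFDerivAt (fun z => L (z - x) + B (z - x) (z - x) / 2)
      (L + (1 / 2 : ℝ) • (B (z - x) + B.flip (z - x))) z := by
  have h1 : HasFDerivAt (fun z : E => z - x) (ContinuousLinearMap.id ℝ E) z :=
    (hasFDerivAt_id z).sub_const x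
  have h2 := L.hasFDerivAt.comp z h1
  have h3 := B.hasFDerivAt_of_bilinear h1 h1
  have h4 := h2.add (h3.const_mul (1 / 2 : ℝ))
  refine (h4.congr_fderiv ?_).congr_of_eventuallyEq (Eventually.of_forall fun w => ?_)
  · ext v
    simp
    try ring
  · simp
    ring

lemma quad_fderiv_two {E : Type*} [NormedAddCommGroup E] [NormedSpace ℝ E]
    (L : E →L[ℝ] ℝ) (B : E →L[ℝ] E →L[ℝ] ℝ) (x v w : E) :
    iteratedFDeriv ℝ 2 (fun z => L (z - x) + B (z - x) (z - x) / 2) x ![v, w]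
      = (B v w + B w v) / 2 := by
  rw [iteratedFDeriv_two_apply]
  have h1 : fderiv ℝ (fun z => L (z - x) + B (z - x) (z - x) / 2) =
      fun z => L + (1 / 2 : ℝ) • (B + B.flip) (z - x) := by
    funext z
    exact (quad_hasFDerivAt L B x z).fderiv
  have h2 : HasFDerivAt (fun z => L + (1 / 2 : ℝ) • (B + B.flip) (z - x))
      ((1 / 2 : ℝ) • (B + B.flip)) x := by
    have h1 : HasFDerivAt (fun z : E => z - x) (ContinuousLinearMap.id ℝ E) x :=
      (hasFDerivAt_id x).sub_const x
    exact (((B + B.flip).hasFDerivAt.comp x h1).const_smul (1 / 2 : ℝ)).const_add L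
  rw [h1, h2.fderiv]
  simp
  ring

/-- The quadratic test function. -/
def stQuad {N : ℕ} (p : STE N) (A : STE N →L[ℝ] STE N) (q : ℝ × Euc N) (w : ℝ × Euc N) : ℝ :=
  inner ℝ p (WithLp.toLp 2 (w - q)) +
    inner ℝ (A (WithLp.toLp 2 (w - q))) (WithLp.toLp 2 (w - q)) / 2

lemma stQuad_contDiff {N : ℕ} (p : STE N) (A : STE N →L[ℝ] STE N) (q : ℝ × Euc N) :
    ContDiff ℝ 2 (stQuad p A q) := by
  have h : ContDiff ℝ 2 (fun w : ℝ × Euc N => (WithLp.toLp 2 (w - q) : STE N)) :=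
    (WithLp.prodContinuousLinearEquiv 2 ℝ ℝ (Euc N)).symm.contDiff.comp
      (contDiff_id.sub contDiff_const)
  unfold stQuad
  exact (contDiff_const.inner ℝ h).add (((A.contDiff.comp h).inner ℝ h).div_const 2)

lemma stQuad_tderiv {N : ℕ} (p : STE N) (A : STE N →L[ℝ] STE N) (q : ℝ × Euc N) :
    tderiv (stQuad p A q) q = p.fst := by
  set e : STE N := WithLp.toLp 2 ((1 : ℝ), (0 : Euc N)) with he
  have h : (fun s => stQuad p A q (s, q.2)) =
      fun s => (s - q.1) * p.fst + (s - q.1) ^ 2 * (inner ℝ (A e) e / 2) := by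
    funext s
    have : (WithLp.toLp 2 ((s, q.2) - q) : STE N) = (s - q.1) • e := by
      rw [he, ← WithLp.toLp_smul]
      congr 1
      ext <;> simp
    unfold stQuad
    rw [this, map_smul, inner_smul_right, inner_smul_right, inner_smul_left]
    have : inner ℝ p e = p.fst := by simp [he, WithLp.prod_inner_apply]
    rw [this]
    simp only [conj_trivial]
    ring
  unfold tderiv
  rw [h]
  generalize inner ℝ (A e) e / 2 = c
  have h1 : HasDerivAt (fun s : ℝ => s - q.1) 1 q.1 := (hasDerivAt_id _).sub_const _
  have h2 := (h1.mul_const p.fst).add ((h1.pow 2).mul_const c)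
  have h3 := h2.deriv
  simp at h3
  exact h3

lemma stQuad_space {N : ℕ} (p : STE N) (A : STE N →L[ℝ] STE N) (q : ℝ × Euc N) :
    (fun z => stQuad p A q (q.1, z)) = fun z => (innerSL ℝ p.snd) (z - q.2) +
      ((innerSL ℝ).bilinearComp (A ∘L stJ N) (stJ N)) (z - q.2) (z - q.2) / 2 := by
  funext z
  have : (WithLp.toLp 2 ((q.1, z) - q) : STE N) = stJ N (z - q.2) := by
    rw [stJ_apply]
    congr 1
    ext <;> simp
  unfold stQuad
  rw [this]
  have h2 : inner ℝ p (stJ N (z - q.2)) = inner ℝ p.snd (z - q.2) := by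
    simp [stJ_apply, WithLp.prod_inner_apply]
  rw [h2]
  rfl

lemma stQuad_xgrad {N : ℕ} (p : STE N) (A : STE N →L[ℝ] STE N) (q : ℝ × Euc N) :
    xgrad (stQuad p A q) q = p.snd := by
  unfold xgrad
  rw [stQuad_space]
  apply HasGradientAt.gradient
  rw [hasGradientAt_iff_hasFDerivAt]
  refine (quad_hasFDerivAt _ _ _ _).congr_fderiv ?_
  ext v
  simp

lemma stQuad_xhess {N : ℕ} (p : STE N) (A : STE N →L[ℝ] STE N) (q : ℝ × Euc N) :
    xhess (stQuad p A q) q = stMat A := by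
  unfold xhess
  rw [stQuad_space]
  funext i j
  rw [quad_fderiv_two]
  simp [stMat]

lemma stMat_symm {N : ℕ} (A : STE N →L[ℝ] STE N) : (stMat A).IsSymm := by
  ext i j
  simp only [Matrix.transpose_apply, stMat]
  ring

lemma stMat_neg {N : ℕ} (A : STE N →L[ℝ] STE N) : stMat (-A) = -stMat A := by
  ext i j
  simp only [stMat, neg_apply, inner_neg_left, Matrix.neg_apply]
  ring

open Topology in
lemma jet_pull {N : ℕ} {y : STE N} {P : STE N → Prop} (h : ∀ᶠ h in 𝓝 (0 : STE N), P h) :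
    ∀ᶠ w in 𝓝 y.ofLp, P (WithLp.toLp 2 (w - y.ofLp)) := by
  have : Tendsto (fun w : ℝ × Euc N => (WithLp.toLp 2 (w - y.ofLp) : STE N)) (𝓝 y.ofLp)
      (𝓝 0) := by
    refine Continuous.tendsto' ?_ _ _ (by simp)
    exact (WithLp.prodContinuousLinearEquiv 2 ℝ ℝ (Euc N)).symm.continuous.comp
      (continuous_id.sub continuous_const)
  exact this.eventually h

open Topology in
lemma jet_sub {N : ℕ} {T : ℝ} {F : Euc N → Matrix (Fin N) (Fin N) ℝ → ℝ} {u : ℝ × Euc N → ℝ}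
    (hu : IsViscSubsol' T F u) (y p : STE N) (A : STE N →L[ℝ] STE N) (hy : y.fst ∈ Ioo 0 T)
    (hj : ∀ᶠ h in 𝓝 (0 : STE N), u (y + h).ofLp ≤
      u y.ofLp + inner ℝ p h + inner ℝ (A h) h / 2) :
    p.fst ≤ F p.snd (stMat A) := by
  have h := hu (stQuad p A y.ofLp) (stQuad_contDiff _ _ _) y.ofLp hy ?_
  · rw [stQuad_tderiv, stQuad_xgrad, stQuad_xhess] at h
    linarith
  · refine (IsLocalMax.on ?_ _)
    filter_upwards [jet_pull hj] with w hw
    have e : (y + WithLp.toLp 2 (w - y.ofLp)).ofLp = w := by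
      rw [WithLp.ofLp_add]; simp
    have e2 : stQuad p A y.ofLp y.ofLp = 0 := by simp [stQuad]
    rw [e] at hw
    rw [e2]
    unfold stQuad
    linarith

open Topology in
lemma jet_super {N : ℕ} {T : ℝ} {F : Euc N → Matrix (Fin N) (Fin N) ℝ → ℝ} {u : ℝ × Euc N → ℝ}
    (hu : IsViscSupersol' T F u) (y p : STE N) (A : STE N →L[ℝ] STE N) (hy : y.fst ∈ Ioo 0 T)
    (hj : ∀ᶠ h in 𝓝 (0 : STE N), - u (y + h).ofLp ≤
      - u y.ofLp + inner ℝ p h + inner ℝ (A h) h / 2) :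
    p.fst ≤ - F (-p.snd) (-stMat A) := by
  have h := hu (stQuad (-p) (-A) y.ofLp) (stQuad_contDiff _ _ _) y.ofLp hy ?_
  · rw [stQuad_tderiv, stQuad_xgrad, stQuad_xhess, stMat_neg] at h
    simp at h
    linarith
  · refine (IsLocalMin.on ?_ _)
    filter_upwards [jet_pull hj] with w hw
    have e : (y + WithLp.toLp 2 (w - y.ofLp)).ofLp = w := by
      rw [WithLp.ofLp_add]; simp
    have e2 : stQuad (-p) (-A) y.ofLp y.ofLp = 0 := by simp [stQuad]
    rw [e] at hw
    rw [e2]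
    unfold stQuad
    rw [neg_apply, inner_neg_left, inner_neg_left]
    linarith


lemma stMat_quad {N : ℕ} (A : STE N →L[ℝ] STE N) (x : Fin N → ℝ) :
    x ⬝ᵥ (stMat A).mulVec x = inner ℝ (A (stJ N (WithLp.toLp 2 x))) (stJ N (WithLp.toLp 2 x)) := by
  have hx : (WithLp.toLp 2 x : Euc N) = ∑ i, x i • EuclideanSpace.single i (1 : ℝ) := by
    ext j
    simp [Finset.sum_apply, Pi.single_apply]
  rw [hx]
  simp only [map_sum, map_smul, sum_inner, inner_sum, inner_smul_left, inner_smul_right,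
    conj_trivial]
  simp only [dotProduct, Matrix.mulVec, stMat, Finset.mul_sum]
  set B : Fin N → Fin N → ℝ := fun i j =>
    inner ℝ (A (stJ N (EuclideanSpace.single i 1))) (stJ N (EuclideanSpace.single j 1)) with hB
  have h1 : ∑ i, ∑ j, x i * ((B i j + B j i) / 2 * x j) =
      (∑ i, ∑ j, x j * (x i * B i j) + ∑ i, ∑ j, x j * (x i * B j i)) / 2 := by
    rw [← Finset.sum_add_distrib, Finset.sum_div]
    refine Finset.sum_congr rfl fun i _ => ?_
    rw [← Finset.sum_add_distrib, Finset.sum_div]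
    refine Finset.sum_congr rfl fun j _ => ?_
    ring
  have h2 : ∑ i, ∑ j, x j * (x i * B j i) = ∑ i, ∑ j, x j * (x i * B i j) := by
    rw [Finset.sum_comm]
    refine Finset.sum_congr rfl fun i _ => Finset.sum_congr rfl fun j _ => ?_
    ring
  have h3 : ∑ i, ∑ j, x i * (x j * B i j) = ∑ i, ∑ j, x j * (x i * B i j) :=
    Finset.sum_congr rfl fun i _ => Finset.sum_congr rfl fun j _ => by ring
  rw [h2] at h1
  refine h1.trans ?_
  first
    | linarith
    | (rw [Finset.sum_comm]; linarith)

lemma matOpNorm_smul_one {N : ℕ} {b : ℝ} (hb : 0 ≤ b) :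
    matOpNorm (b • (1 : Matrix (Fin N) (Fin N) ℝ)) ≤ b := by
  unfold matOpNorm
  rw [map_smul, map_one, norm_smul, Real.norm_eq_abs, abs_of_nonneg hb]
  exact mul_le_of_le_one_right hb ContinuousLinearMap.norm_id_le

lemma one_add_pow_le (s : ℝ) (hs : |s| ≤ 1) (m : ℕ) :
    (1 + s) ^ m ≤ 1 + m * s + 4 ^ m * s ^ 2 := by
  obtain ⟨h1, h2⟩ := abs_le.1 hs
  induction m with
  | zero => simp; positivity
  | succ m ih =>
    have hm : (m : ℝ) ≤ 4 ^ m := by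
      exact_mod_cast (Nat.lt_pow_self (by norm_num : 1 < 4)).le
    have h3 : (1 + s) ^ (m + 1) ≤ (1 + m * s + 4 ^ m * s ^ 2) * (1 + s) := by
      rw [pow_succ]
      exact mul_le_mul_of_nonneg_right ih (by linarith)
    refine h3.trans ?_
    push_cast
    have e4 : (4 : ℝ) ^ (m + 1) = 4 ^ m * 4 := pow_succ _ _
    rw [e4]
    have h4 : 0 ≤ s ^ 2 := sq_nonneg s
    have h5 : (m : ℝ) * s ^ 2 ≤ 4 ^ m * s ^ 2 := mul_le_mul_of_nonneg_right hm h4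
    have h6 : (4 : ℝ) ^ m * s ^ 2 * s ≤ 4 ^ m * s ^ 2 * 1 :=
      mul_le_mul_of_nonneg_left h2 (by positivity)
    have h7 : 0 ≤ (4 : ℝ) ^ m * s ^ 2 := by positivity
    nlinarith

/-- The penalization. -/
def stPhi {N : ℕ} (δ Λ M κ T₁ : ℝ) (n : ℕ) (z : STE N) : ℝ :=
  δ * Real.exp (Λ * z.fst) * (1 + ‖z.snd‖ ^ 2) ^ (n + 1) + M * Real.exp (κ * (z.fst - T₁))

lemma stPhi_contDiff {N : ℕ} (δ Λ M κ T₁ : ℝ) (n : ℕ) :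
    ContDiff ℝ 2 (stPhi (N := N) δ Λ M κ T₁ n) := by
  have h1 : ContDiff ℝ 2 (fun z : STE N => z.fst) :=
    (contDiff_fst).comp (WithLp.prodContinuousLinearEquiv 2 ℝ ℝ (Euc N)).contDiff
  have h2 : ContDiff ℝ 2 (fun z : STE N => z.snd) :=
    (contDiff_snd).comp (WithLp.prodContinuousLinearEquiv 2 ℝ ℝ (Euc N)).contDiff
  unfold stPhi
  exact ((contDiff_const.mul (contDiff_const.mul h1).exp).mul
    ((contDiff_const.add (h2.norm_sq ℝ)).pow _)).add
    (contDiff_const.mul (contDiff_const.mul (h1.sub contDiff_const)).exp)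

lemma stPhi_time {N : ℕ} (δ Λ M κ T₁ : ℝ) (n : ℕ) (z : STE N) :
    fderiv ℝ (stPhi δ Λ M κ T₁ n) z (WithLp.toLp 2 ((1 : ℝ), (0 : Euc N))) =
      Λ * (δ * Real.exp (Λ * z.fst) * (1 + ‖z.snd‖ ^ 2) ^ (n + 1)) +
        κ * (M * Real.exp (κ * (z.fst - T₁))) := by
  have hd : DifferentiableAt ℝ (stPhi (N := N) δ Λ M κ T₁ n) z :=
    ((stPhi_contDiff δ Λ M κ T₁ n).differentiable (by norm_num)).differentiableAt
  rw [← hd.lineDeriv_eq_fderiv]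
  apply HasLineDerivAt.lineDeriv
  unfold HasLineDerivAt
  have e : (fun t : ℝ => stPhi δ Λ M κ T₁ n (z + t • WithLp.toLp 2 ((1 : ℝ), (0 : Euc N)))) =
      fun t => δ * Real.exp (Λ * (z.fst + t)) * (1 + ‖z.snd‖ ^ 2) ^ (n + 1) +
        M * Real.exp (κ * (z.fst + t - T₁)) := by
    funext t
    simp [stPhi]
  rw [e]
  have h0 : HasDerivAt (fun t : ℝ => z.fst + t) 1 0 := (hasDerivAt_id _).const_add _
  have h1 := ((h0.const_mul Λ).exp.const_mul δ).mul_const ((1 + ‖z.snd‖ ^ 2) ^ (n + 1))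
  have h2 := (((h0.sub_const T₁).const_mul κ).exp).const_mul M
  refine (h1.add h2).congr_deriv ?_
  simp
  ring

lemma stPhi_line {N : ℕ} (δ Λ M κ T₁ : ℝ) (n : ℕ) (z : STE N) (h : Euc N) (t : ℝ) :
    stPhi δ Λ M κ T₁ n (z + t • stJ N h) = δ * Real.exp (Λ * z.fst) *
      (1 + ‖z.snd‖ ^ 2 + (2 * inner ℝ z.snd h * t + ‖h‖ ^ 2 * t ^ 2)) ^ (n + 1) +
        M * Real.exp (κ * (z.fst - T₁)) := by
  have h2 : ‖z.snd + t • h‖ ^ 2 = ‖z.snd‖ ^ 2 + (2 * inner ℝ z.snd h * t + ‖h‖ ^ 2 * t ^ 2) := by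
    rw [norm_add_sq_real, inner_smul_right, norm_smul, mul_pow, Real.norm_eq_abs, sq_abs]
    ring
  have e1 : (stJ N h).fst = 0 := rfl
  have e2 : (stJ N h).snd = h := rfl
  simp only [stPhi, WithLp.add_fst, WithLp.add_snd, WithLp.smul_fst, WithLp.smul_snd,
    e1, e2, smul_zero, add_zero, h2, add_assoc]

lemma stPhi_space {N : ℕ} (δ Λ M κ T₁ : ℝ) (n : ℕ) (z : STE N) (h : Euc N) :
    fderiv ℝ (stPhi δ Λ M κ T₁ n) z (stJ N h) =
      δ * Real.exp (Λ * z.fst) * ((n + 1) * (1 + ‖z.snd‖ ^ 2) ^ n * (2 * inner ℝ z.snd h)) := by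
  have hd : DifferentiableAt ℝ (stPhi (N := N) δ Λ M κ T₁ n) z :=
    ((stPhi_contDiff δ Λ M κ T₁ n).differentiable (by norm_num)).differentiableAt
  rw [← hd.lineDeriv_eq_fderiv]
  apply HasLineDerivAt.lineDeriv
  unfold HasLineDerivAt
  simp only [stPhi_line]
  have h0 : HasDerivAt (fun t : ℝ => 1 + ‖z.snd‖ ^ 2 + (2 * inner ℝ z.snd h * t + ‖h‖ ^ 2 * t ^ 2))
      (2 * inner ℝ z.snd h) 0 := by
    have h1 := ((hasDerivAt_id (0 : ℝ)).const_mul (2 * inner ℝ z.snd h)).add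
      (((hasDerivAt_id (0 : ℝ)).pow 2).const_mul (‖h‖ ^ 2))
    refine (h1.const_add (1 + ‖z.snd‖ ^ 2)).congr_deriv ?_
    simp
  refine (((h0.pow (n + 1)).const_mul (δ * Real.exp (Λ * z.fst))).add_const _).congr_deriv ?_
  simp

open Topology in
lemma stPhi_second {N : ℕ} (δ Λ M κ T₁ : ℝ) (n : ℕ) (hδ : 0 ≤ δ) (z : STE N) (h : Euc N) :
    ∀ᶠ t in 𝓝 (0 : ℝ), stPhi δ Λ M κ T₁ n (z + t • stJ N h) ≤ stPhi δ Λ M κ T₁ n z +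
      t * fderiv ℝ (stPhi δ Λ M κ T₁ n) z (stJ N h) +
      (δ * Real.exp (Λ * z.fst) * (1 + ‖z.snd‖ ^ 2) ^ (n + 1) * (n + 1 + 9 * 4 ^ (n + 1)) *
        ‖h‖ ^ 2) * t ^ 2 := by
  have hev : ∀ᶠ t in 𝓝 (0 : ℝ), |t| * ‖h‖ ≤ 1 / 3 := by
    have : Tendsto (fun t : ℝ => |t| * ‖h‖) (𝓝 0) (𝓝 0) :=
      Continuous.tendsto' (by fun_prop) _ _ (by simp)
    exact this.eventually (ge_mem_nhds (by norm_num))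
  filter_upwards [hev] with t ht
  rw [stPhi_line, stPhi_space]
  unfold stPhi
  set D := δ * Real.exp (Λ * z.fst) with hD
  have hD0 : 0 ≤ D := by positivity
  set a := 1 + ‖z.snd‖ ^ 2 with ha
  have ha1 : 1 ≤ a := by nlinarith [sq_nonneg ‖z.snd‖]
  have ha0 : 0 < a := by linarith
  set β := inner ℝ z.snd h with hβ
  have hβa : |β| ≤ ‖z.snd‖ * ‖h‖ := abs_real_inner_le_norm _ _
  set r := 2 * β * t + ‖h‖ ^ 2 * t ^ 2 with hr
  set τ := |t| * ‖h‖ with hτ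
  have hτ0 : 0 ≤ τ := by positivity
  have hτ2 : τ ^ 2 = ‖h‖ ^ 2 * t ^ 2 := by rw [hτ, mul_pow, sq_abs]; ring
  have hx : 2 * ‖z.snd‖ ≤ a := by nlinarith [sq_nonneg (‖z.snd‖ - 1)]
  have hr1 : |r| ≤ 2 * ‖z.snd‖ * τ + τ ^ 2 := by
    rw [hr, ← hτ2]
    refine (abs_add_le _ _).trans ?_
    rw [abs_mul, abs_mul, abs_two, abs_of_nonneg (sq_nonneg τ)]
    have := mul_le_mul_of_nonneg_right hβa (abs_nonneg t)
    have e : ‖z.snd‖ * ‖h‖ * |t| = ‖z.snd‖ * τ := by rw [hτ]; ring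
    linarith
  have hr2 : |r| ≤ 2 * a * τ := by
    refine hr1.trans ?_
    nlinarith
  set s := r / a with hs
  have hs1 : |s| ≤ 2 * τ := by
    rw [hs, abs_div, abs_of_pos ha0, div_le_iff₀ ha0]
    linarith
  have hs2 : s ^ 2 ≤ 9 * (‖h‖ ^ 2 * t ^ 2) := by
    rw [← hτ2, ← sq_abs s]
    nlinarith [abs_nonneg s]
  have key := one_add_pow_le s (by linarith) (n + 1)
  have e1 : (a + r) ^ (n + 1) = a ^ (n + 1) * (1 + s) ^ (n + 1) := by
    rw [← mul_pow, hs]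
    congr 1
    field_simp
  have e2 : a ^ (n + 1) * s = a ^ n * r := by
    rw [hs, pow_succ]; field_simp
  have hw : 1 ≤ a ^ n := one_le_pow₀ ha1
  have hw1 : a ^ n ≤ a ^ (n + 1) := pow_le_pow_right₀ ha1 (Nat.le_succ n)
  have e3 : (a + r) ^ (n + 1) ≤ a ^ (n + 1) + (n + 1) * (a ^ n * r) +
      a ^ (n + 1) * (4 ^ (n + 1) * (9 * (‖h‖ ^ 2 * t ^ 2))) := by
    rw [e1, ← e2]
    push_cast at key
    have k1 := mul_le_mul_of_nonneg_left key (by positivity : 0 ≤ a ^ (n + 1))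
    have k2 : a ^ (n + 1) * (4 ^ (n + 1) * s ^ 2) ≤
      a ^ (n + 1) * (4 ^ (n + 1) * (9 * (‖h‖ ^ 2 * t ^ 2))) := by gcongr
    linarith
  have e4 : (n + 1 : ℝ) * (a ^ n * (‖h‖ ^ 2 * t ^ 2)) ≤
      (n + 1) * (a ^ (n + 1) * (‖h‖ ^ 2 * t ^ 2)) := by gcongr
  have e5 : (a + r) ^ (n + 1) ≤ a ^ (n + 1) + t * ((n + 1) * a ^ n * (2 * β)) +
      a ^ (n + 1) * (n + 1 + 9 * 4 ^ (n + 1)) * ‖h‖ ^ 2 * t ^ 2 := by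
    refine e3.trans ?_
    have : (n + 1 : ℝ) * (a ^ n * r) = t * ((n + 1) * a ^ n * (2 * β)) +
      (n + 1 : ℝ) * (a ^ n * (‖h‖ ^ 2 * t ^ 2)) := by rw [hr]; ring
    rw [this]
    linarith
  have e6 := mul_le_mul_of_nonneg_left e5 hD0
  linarith

lemma stPhi_grad_bound {N : ℕ} (δ Λ M κ T₁ : ℝ) (n : ℕ) (hδ : 0 ≤ δ) (z : STE N) (h : Euc N) :
    |fderiv ℝ (stPhi δ Λ M κ T₁ n) z (stJ N h)| ≤
      δ * Real.exp (Λ * z.fst) * (1 + ‖z.snd‖ ^ 2) ^ (n + 1) * (n + 1) * ‖h‖ := by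
  rw [stPhi_space]
  have hx : 2 * ‖z.snd‖ ≤ 1 + ‖z.snd‖ ^ 2 := by nlinarith [sq_nonneg (‖z.snd‖ - 1)]
  have hβa : |inner ℝ z.snd h| ≤ ‖z.snd‖ * ‖h‖ := abs_real_inner_le_norm _ _
  rw [abs_mul (δ * Real.exp (Λ * z.fst)), abs_mul ((n + 1 : ℝ) * (1 + ‖z.snd‖ ^ 2) ^ n),
    abs_mul 2, abs_two,
    abs_of_nonneg (by positivity : 0 ≤ δ * Real.exp (Λ * z.fst)),
    abs_of_nonneg (by positivity : (0 : ℝ) ≤ (n + 1) * (1 + ‖z.snd‖ ^ 2) ^ n)]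
  have h1 : 2 * |inner ℝ z.snd h| ≤ (1 + ‖z.snd‖ ^ 2) * ‖h‖ := by
    have := mul_le_mul_of_nonneg_right hx (norm_nonneg h)
    linarith
  calc _ ≤ δ * Real.exp (Λ * z.fst) * ((n + 1) * (1 + ‖z.snd‖ ^ 2) ^ n *
        ((1 + ‖z.snd‖ ^ 2) * ‖h‖)) := by gcongr
    _ = _ := by ring


lemma growth_bound {N : ℕ} {T : ℝ} {u : ℝ × Euc N → ℝ} (h : PolyGrowth T u) :
    ∃ (c : ℝ) (k : ℕ), 0 ≤ c ∧ ∀ m, k ≤ m → ∀ t ∈ Icc (0 : ℝ) T, ∀ x : Euc N,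
      |u (t, x)| ≤ c * (1 + ‖x‖ ^ 2) ^ m := by
  obtain ⟨C, k, hC⟩ := h
  refine ⟨2 * |C|, k, by positivity, fun m hm t ht x => (hC t ht x).trans ?_⟩
  have h1 : 1 ≤ 1 + ‖x‖ ^ 2 := by nlinarith [sq_nonneg ‖x‖]
  have h2 : ‖x‖ ≤ 1 + ‖x‖ ^ 2 := by nlinarith [sq_nonneg (‖x‖ - 1)]
  have h3 : ‖x‖ ^ k ≤ (1 + ‖x‖ ^ 2) ^ m :=
    (pow_le_pow_left₀ (norm_nonneg _) h2 k).trans (pow_le_pow_right₀ h1 hm)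
  have h4 : 1 ≤ (1 + ‖x‖ ^ 2) ^ m := one_le_pow₀ h1
  calc C * (1 + ‖x‖ ^ k) ≤ |C| * (1 + ‖x‖ ^ k) := by gcongr; exact le_abs_self C
    _ ≤ |C| * (2 * (1 + ‖x‖ ^ 2) ^ m) := by gcongr; linarith
    _ = _ := by ring

lemma stMat_psd {N : ℕ} (A : Fin 3 → STE N →L[ℝ] STE N) (b : ℝ)
    (h : ∀ v : Euc N, ∑ i, inner ℝ (A i (stJ N v)) (stJ N v) ≤ b * ‖v‖ ^ 2) :
    ((-stMat (A 2) + b • (1 : Matrix (Fin N) (Fin N) ℝ)) -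
      (stMat (A 0) - (-stMat (A 1)))).PosSemidef := by
  refine Matrix.PosSemidef.of_dotProduct_mulVec_nonneg ?_ ?_
  · rw [Matrix.IsHermitian, Matrix.conjTranspose_eq_transpose_of_trivial]
    simp only [Matrix.transpose_sub, Matrix.transpose_add, Matrix.transpose_neg,
      Matrix.transpose_smul, Matrix.transpose_one, (stMat_symm _).eq]
  · intro x
    have h1 := h (WithLp.toLp 2 x)
    rw [Fin.sum_univ_three, ← stMat_quad, ← stMat_quad, ← stMat_quad] at h1
    have h2 : ‖(WithLp.toLp 2 x : Euc N)‖ ^ 2 = x ⬝ᵥ x := by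
      rw [EuclideanSpace.norm_sq_eq]
      simp [dotProduct, sq]
    rw [h2] at h1
    simp only [star_trivial, Matrix.sub_mulVec, Matrix.add_mulVec, Matrix.neg_mulVec,
      Matrix.smul_mulVec, Matrix.one_mulVec, dotProduct_sub, dotProduct_add, dotProduct_neg,
      dotProduct_smul, smul_eq_mul]
    linarith

set_option maxHeartbeats 2000000 in
/-- Domination of supersolutions by a subsolution: if
`F₁(p, X) − F₁(q, Y) ≤ F₀(p − q, Z)` whenever `X − Y ≤ Z`, `v₀, v₁` are viscosity
supersolutions for `F₀, F₁`, `v₂` is a viscosity subsolution for `F₁`, and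
`v₀(0,·) + v₁(0,·) − v₂(0,·) ≥ 0`, then `v₀ + v₁ − v₂ ≥ 0`. -/
theorem stmt_18 {N : ℕ} (T : ℝ) (hT : 0 < T)
    (F₀ F₁ : Euc N → Matrix (Fin N) (Fin N) ℝ → ℝ)
    (hcont₀ : Continuous (fun z : Euc N × Matrix (Fin N) (Fin N) ℝ => F₀ z.1 z.2))
    (hcont₁ : Continuous (fun z : Euc N × Matrix (Fin N) (Fin N) ℝ => F₁ z.1 z.2))
    (C : ℝ) (hC : 0 < C)
    (hhom₀ : ∀ p : Euc N, ∀ Y : Matrix (Fin N) (Fin N) ℝ, Y.IsSymm →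
      ∀ l : ℝ, 0 ≤ l → l * F₀ p Y ≤ C * F₀ (l • p) (l • Y))
    (hhom₁ : ∀ p : Euc N, ∀ Y : Matrix (Fin N) (Fin N) ℝ, Y.IsSymm →
      ∀ l : ℝ, 0 ≤ l → l * F₁ p Y ≤ C * F₁ (l • p) (l • Y))
    (hlip₀ : ∀ p q : Euc N, ∀ A B : Matrix (Fin N) (Fin N) ℝ, A.IsSymm → B.IsSymm →
      |F₀ p A - F₀ q B| ≤ C * (‖p - q‖ + matOpNorm (A - B)))
    (hlip₁ : ∀ p q : Euc N, ∀ A B : Matrix (Fin N) (Fin N) ℝ, A.IsSymm → B.IsSymm →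
      |F₁ p A - F₁ q B| ≤ C * (‖p - q‖ + matOpNorm (A - B)))
    (hdom : ∀ p q : Euc N, ∀ X Y Z : Matrix (Fin N) (Fin N) ℝ,
      X.IsSymm → Y.IsSymm → Z.IsSymm → (Z - (X - Y)).PosSemidef →
      F₁ p X - F₁ q Y ≤ F₀ (p - q) Z)
    (v₀ v₁ v₂ : ℝ × Euc N → ℝ)
    (hlsc₀ : LowerSemicontinuousOn v₀ (Set.Icc (0 : ℝ) T ×ˢ (Set.univ : Set (Euc N))))
    (hlsc₁ : LowerSemicontinuousOn v₁ (Set.Icc (0 : ℝ) T ×ˢ (Set.univ : Set (Euc N))))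
    (husc₂ : UpperSemicontinuousOn v₂ (Set.Icc (0 : ℝ) T ×ˢ (Set.univ : Set (Euc N))))
    (hgrowth₀ : PolyGrowth T v₀) (hgrowth₁ : PolyGrowth T v₁)
    (hgrowth₂ : PolyGrowth T v₂)
    (hsuper₀ : IsViscSupersol' T F₀ v₀) (hsuper₁ : IsViscSupersol' T F₁ v₁)
    (hsub₂ : IsViscSubsol' T F₁ v₂)
    (hinit_cont : Continuous (fun x : Euc N => v₀ (0, x) + v₁ (0, x) - v₂ (0, x)))
    (hinit_nonneg : ∀ x : Euc N, 0 ≤ v₀ (0, x) + v₁ (0, x) - v₂ (0, x)) :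
    ∀ t ∈ Set.Ioo (0 : ℝ) T, ∀ x : Euc N,
      0 ≤ v₀ (t, x) + v₁ (t, x) - v₂ (t, x) := by
  by_contra! hneg
  obtain ⟨t₀, ht₀, x₀, hx₀⟩ := hneg
  set θ : ℝ := -(v₀ (t₀, x₀) + v₁ (t₀, x₀) - v₂ (t₀, x₀)) with hθ
  have hθ0 : 0 < θ := by linarith
  obtain ⟨c₀, k₀, hc₀, hg₀⟩ := growth_bound hgrowth₀
  obtain ⟨c₁, k₁, hc₁, hg₁⟩ := growth_bound hgrowth₁
  obtain ⟨c₂, k₂, hc₂, hg₂⟩ := growth_bound hgrowth₂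
  set n : ℕ := k₀ + k₁ + k₂ with hn
  set c : ℝ := c₀ + c₁ + c₂ with hc
  have hc0 : 0 ≤ c := by positivity
  have hgr : ∀ t ∈ Icc (0 : ℝ) T, ∀ x : Euc N,
      v₂ (t, x) - v₁ (t, x) - v₀ (t, x) ≤ c * (1 + ‖x‖ ^ 2) ^ n := by
    intro t ht x
    have a0 := abs_le.1 (hg₀ n (by omega) t ht x)
    have a1 := abs_le.1 (hg₁ n (by omega) t ht x)
    have a2 := abs_le.1 (hg₂ n (by omega) t ht x)
    have : c * (1 + ‖x‖ ^ 2) ^ n = c₀ * (1 + ‖x‖ ^ 2) ^ n + c₁ * (1 + ‖x‖ ^ 2) ^ n +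
      c₂ * (1 + ‖x‖ ^ 2) ^ n := by rw [hc]; ring
    linarith [a0.1, a1.1, a2.2]
  obtain ⟨T₁, hT₁a, hT₁b⟩ := exists_between ht₀.2
  have ht₀0 := ht₀.1
  set G : ℝ := n + 1 + 9 * 4 ^ (n + 1) with hG
  have hG0 : 0 ≤ G := by positivity
  set Λ : ℝ := C * ((n + 1) + 2 * G) + 1 with hΛ
  have hΛ0 : 0 ≤ Λ := by positivity
  set w₀ : ℝ := Real.exp (Λ * t₀) * (1 + ‖x₀‖ ^ 2) ^ (n + 1) with hw₀
  have hw₀0 : 0 < w₀ := by positivity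
  set δ : ℝ := θ / (3 * w₀) with hδdef
  have hδ : 0 < δ := by positivity
  have hδw : δ * w₀ = θ / 3 := by rw [hδdef]; field_simp
  set R : ℝ := 1 + ‖x₀‖ + c / δ with hR
  have hcd : 0 ≤ c / δ := by positivity
  have hR1 : 1 ≤ R := by linarith [norm_nonneg x₀]
  have hRδ : c ≤ δ * (1 + R ^ 2) := by
    have h1 : c / δ ≤ 1 + R ^ 2 := by nlinarith [norm_nonneg x₀]
    rw [div_le_iff₀ hδ] at h1
    linarith
  set M : ℝ := c * (1 + R ^ 2) ^ n with hM
  have hM0 : 0 ≤ M := by positivity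
  set κ : ℝ := 3 * M / (θ * (T₁ - t₀)) with hκ
  have hTt : 0 < T₁ - t₀ := by linarith
  have hκ0 : 0 ≤ κ := by positivity
  have hMκ : M * Real.exp (κ * (t₀ - T₁)) ≤ θ / 3 := by
    have h1 : κ * (T₁ - t₀) = 3 * M / θ := by rw [hκ]; field_simp
    have h2 : κ * (t₀ - T₁) = -(3 * M / θ) := by rw [← h1]; ring
    rw [h2, Real.exp_neg, ← div_eq_mul_inv, div_le_iff₀ (Real.exp_pos _)]
    have h3 := Real.add_one_le_exp (3 * M / θ)
    calc M ≤ θ / 3 * (3 * M / θ + 1) := by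
          have : θ / 3 * (3 * M / θ + 1) = M + θ / 3 := by field_simp
          linarith
      _ ≤ _ := by gcongr
  set φ : STE N → ℝ := stPhi δ Λ M κ T₁ n with hφ
  set η : ℝ := δ / (2 * (1 + 3 * C)) with hη
  have hη0 : 0 < η := by positivity
  have hηC : η * (1 + 3 * C) = δ / 2 := by rw [hη]; field_simp
  let f : Fin 3 → STE N → ℝ :=
    ![fun z => v₂ z.ofLp, fun z => - v₁ z.ofLp, fun z => - v₀ z.ofLp]
  have hfs : ∀ z : STE N, ∑ i, f i z = v₂ z.ofLp - v₁ z.ofLp - v₀ z.ofLp := by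
    intro z
    rw [Fin.sum_univ_three]
    simp only [f, Matrix.cons_val]
    ring
  let e := WithLp.prodContinuousLinearEquiv 2 ℝ ℝ (Euc N)
  set K : Set (STE N) := e ⁻¹' (Icc (0 : ℝ) T₁ ×ˢ Metric.closedBall (0 : Euc N) R) with hK
  set U : Set (STE N) := e ⁻¹' (Ioo (0 : ℝ) T₁ ×ˢ Metric.ball (0 : Euc N) R) with hU
  have hKc : IsCompact K :=
    e.toHomeomorph.isCompact_preimage.2 (isCompact_Icc.prod (isCompact_closedBall _ _))
  have hUo : IsOpen U := (isOpen_Ioo.prod Metric.isOpen_ball).preimage e.continuous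
  have hUK : U ⊆ K :=
    preimage_mono (prod_mono Ioo_subset_Icc_self Metric.ball_subset_closedBall)
  have hmaps : MapsTo (fun z : STE N => z.ofLp) K (Icc (0 : ℝ) T ×ˢ (univ : Set (Euc N))) :=
    fun z hz => ⟨⟨hz.1.1, hz.1.2.trans hT₁b.le⟩, mem_univ _⟩
  have hec : ContinuousOn (fun z : STE N => z.ofLp) K := e.continuous.continuousOn
  have hfu : ∀ i, UpperSemicontinuousOn (f i) K := by
    intro i
    fin_cases i
    · exact husc₂.comp hec hmaps
    · exact continuous_neg.comp_lowerSemicontinuousOn_antitone (hlsc₁.comp hec hmaps)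
        (fun a b h => neg_le_neg h)
    · exact continuous_neg.comp_lowerSemicontinuousOn_antitone (hlsc₀.comp hec hmaps)
        (fun a b h => neg_le_neg h)
  have hz0 : (WithLp.toLp 2 (t₀, x₀) : STE N) ∈ K := by
    refine ⟨⟨ht₀0.le, hT₁a.le⟩, ?_⟩
    rw [mem_closedBall_zero_iff]
    change ‖x₀‖ ≤ R
    linarith
  have hpos : 0 < ∑ i, f i (WithLp.toLp 2 (t₀, x₀)) - φ (WithLp.toLp 2 (t₀, x₀)) := by
    rw [hfs]
    have h1 : φ (WithLp.toLp 2 (t₀, x₀)) = δ * w₀ + M * Real.exp (κ * (t₀ - T₁)) := by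
      change δ * Real.exp (Λ * t₀) * (1 + ‖x₀‖ ^ 2) ^ (n + 1) + M * Real.exp (κ * (t₀ - T₁)) = _
      rw [hw₀]
      ring
    rw [h1, hδw]
    change 0 < v₂ (t₀, x₀) - v₁ (t₀, x₀) - v₀ (t₀, x₀) - _
    linarith
  have hexp : ∀ t : ℝ, 0 ≤ t → 1 ≤ Real.exp (Λ * t) := fun t ht =>
    Real.one_le_exp (by positivity)
  have hbd : ∀ z ∈ K, z ∉ U → ∑ i, f i z - φ z ≤ 0 := by
    intro z hzK hzU
    rw [hfs]
    obtain ⟨t, x⟩ := z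
    obtain ⟨⟨ha, hb⟩, hx⟩ := hzK
    change 0 ≤ t at ha
    change t ≤ T₁ at hb
    rw [mem_closedBall_zero_iff] at hx
    change ‖x‖ ≤ R at hx
    change v₂ (t, x) - v₁ (t, x) - v₀ (t, x) -
      (δ * Real.exp (Λ * t) * (1 + ‖x‖ ^ 2) ^ (n + 1) + M * Real.exp (κ * (t - T₁))) ≤ 0
    have p1 : 0 ≤ δ * Real.exp (Λ * t) * (1 + ‖x‖ ^ 2) ^ (n + 1) := by positivity
    have p2 : 0 ≤ M * Real.exp (κ * (t - T₁)) := by positivity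
    have g := hgr t ⟨ha, hb.trans hT₁b.le⟩ x
    rcases ha.eq_or_lt with h0 | h0
    · have := hinit_nonneg x
      rw [h0] at this
      linarith
    rcases hb.eq_or_lt with h1 | h1
    · have h2 : M * Real.exp (κ * (t - T₁)) = M := by rw [h1]; simp
      have h3 : c * (1 + ‖x‖ ^ 2) ^ n ≤ M := by rw [hM]; gcongr
      linarith
    · have hxR : R ≤ ‖x‖ := by
        by_contra! hlt
        exact hzU ⟨⟨h0, h1⟩, mem_ball_zero_iff.2 hlt⟩
      have hxe : ‖x‖ = R := le_antisymm hx hxR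
      have h2 : c * (1 + ‖x‖ ^ 2) ^ n ≤
          δ * Real.exp (Λ * t) * (1 + ‖x‖ ^ 2) ^ (n + 1) := by
        rw [hxe]
        calc c * (1 + R ^ 2) ^ n ≤ δ * (1 + R ^ 2) * (1 + R ^ 2) ^ n := by gcongr
          _ = δ * 1 * (1 + R ^ 2) ^ (n + 1) := by ring
          _ ≤ _ := by gcongr; exact hexp t ha
      linarith
  obtain ⟨z, hzU, y, p, A, hyU, hjet, hp, hA⟩ := theorem_on_sums hKc hUo hUK f hfu
    (stPhi_contDiff δ Λ M κ T₁ n) hz0 hpos hbd hη0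
  have hyT : ∀ i, (y i).fst ∈ Ioo 0 T := fun i => ⟨(hyU i).1.1, (hyU i).1.2.trans hT₁b⟩
  have j2 : (p 0).fst ≤ F₁ (p 0).snd (stMat (A 0)) :=
    jet_sub hsub₂ (y 0) (p 0) (A 0) (hyT 0) (hjet 0)
  have j1 : (p 1).fst ≤ - F₁ (-(p 1).snd) (-stMat (A 1)) :=
    jet_super hsuper₁ (y 1) (p 1) (A 1) (hyT 1) (hjet 1)
  have j0 : (p 2).fst ≤ - F₀ (-(p 2).snd) (-stMat (A 2)) :=
    jet_super hsuper₀ (y 2) (p 2) (A 2) (hyT 2) (hjet 2)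
  set W : ℝ := δ * Real.exp (Λ * z.fst) * (1 + ‖z.snd‖ ^ 2) ^ (n + 1) with hW
  have hWδ : δ ≤ W := by
    have h1 := hexp z.fst hzU.1.1.le
    have h2 : 1 ≤ (1 + ‖z.snd‖ ^ 2) ^ (n + 1) :=
      one_le_pow₀ (by nlinarith [sq_nonneg ‖z.snd‖])
    calc δ = δ * 1 * 1 := by ring
      _ ≤ _ := by rw [hW]; gcongr
  have hnJ : ∀ h : Euc N, ‖stJ N h‖ = ‖h‖ := by
    intro h
    rw [← sq_eq_sq₀ (norm_nonneg _) (norm_nonneg _), WithLp.prod_norm_sq_eq_of_L2]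
    simp [stJ_apply]
  -- time derivative
  have s1 : Λ * W - η ≤ (p 0).fst + (p 1).fst + (p 2).fst := by
    have h1 := hp (WithLp.toLp 2 ((1 : ℝ), (0 : Euc N)))
    have h2 : ‖(WithLp.toLp 2 ((1 : ℝ), (0 : Euc N)) : STE N)‖ = 1 := by
      rw [← sq_eq_sq₀ (norm_nonneg _) zero_le_one, WithLp.prod_norm_sq_eq_of_L2]
      simp
    have h3 : ∀ i, inner ℝ (p i) (WithLp.toLp 2 ((1 : ℝ), (0 : Euc N))) = (p i).fst := by
      intro i
      simp [WithLp.prod_inner_apply]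
    rw [h2, stPhi_time, Fin.sum_univ_three, h3, h3, h3] at h1
    have h4 := (abs_le.1 h1).1
    have h5 : 0 ≤ κ * (M * Real.exp (κ * (z.fst - T₁))) := by positivity
    linarith
  -- space gradient
  set P : Euc N := (p 0).snd + (p 1).snd + (p 2).snd with hP
  have s2 : ‖P‖ ≤ W * (n + 1) + η := by
    have h1 := hp (stJ N P)
    have h3 : ∀ i, inner ℝ (p i) (stJ N P) = inner ℝ (p i).snd P := by
      intro i
      simp [stJ_apply, WithLp.prod_inner_apply]
    rw [Fin.sum_univ_three, h3, h3, h3, ← inner_add_left, ← inner_add_left, ← hP,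
      real_inner_self_eq_norm_sq, hnJ] at h1
    have h4 := (abs_le.1 h1).2
    have h5 := (abs_le.1 (stPhi_grad_bound δ Λ M κ T₁ n hδ.le z P)).2
    rcases (norm_nonneg P).eq_or_lt with h0 | h0
    · rw [← h0]; positivity
    · refine le_of_mul_le_mul_right ?_ h0
      have : ‖P‖ ^ 2 = ‖P‖ * ‖P‖ := sq _
      linarith
  -- Hessian
  set b : ℝ := 2 * (W * G + η) with hb
  have hb0 : 0 ≤ b := by
    have : 0 ≤ W := hδ.le.trans hWδ
    positivity
  have s3 := stMat_psd A b (by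
    intro v
    have h1 := hA (stJ N v) _ (stPhi_second δ Λ M κ T₁ n hδ.le z v)
    rw [hnJ, ← Finset.sum_div] at h1
    have h2 : b * ‖v‖ ^ 2 = 2 * (W * G * ‖v‖ ^ 2 + η * ‖v‖ ^ 2) := by rw [hb]; ring
    rw [h2]
    linarith)
  have hZs : (-stMat (A 2) + b • (1 : Matrix (Fin N) (Fin N) ℝ)).IsSymm := by
    rw [Matrix.IsSymm]
    simp only [Matrix.transpose_add, Matrix.transpose_neg,
      Matrix.transpose_smul, Matrix.transpose_one, (stMat_symm _).eq]
  have hns : ∀ i, (-stMat (A i)).IsSymm := fun i => by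
    rw [Matrix.IsSymm, Matrix.transpose_neg, (stMat_symm _).eq]
  have d1 := hdom (p 0).snd (-(p 1).snd) _ _ _ (stMat_symm (A 0)) (hns 1) hZs s3
  have d2 := (abs_le.1 (hlip₀ ((p 0).snd - -(p 1).snd) (-(p 2).snd) _ _ hZs (hns 2))).2
  have e1 : (p 0).snd - -(p 1).snd - -(p 2).snd = P := by rw [hP]; abel
  have e2 : -stMat (A 2) + b • (1 : Matrix (Fin N) (Fin N) ℝ) - -stMat (A 2) =
      b • (1 : Matrix (Fin N) (Fin N) ℝ) := by abel
  rw [e1, e2] at d2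
  have d3 := matOpNorm_smul_one (N := N) hb0
  have d4 : C * (‖P‖ + matOpNorm (b • (1 : Matrix (Fin N) (Fin N) ℝ))) ≤
      C * (W * (n + 1) + η + b) := by gcongr
  have d5 : Λ * W - η ≤ C * (W * (n + 1) + η + b) := by linarith
  have d6 : Λ * W - η - C * (W * (n + 1) + η + b) = W - η * (1 + 3 * C) := by
    rw [hΛ, hb]; ring
  rw [hηC] at d6
  linarith
end
end
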